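/- Let G : ℝ⁴ → ℝ be continuous, convex, positively 2-homogeneous (G(rz) = r²G(z) for r ≥ 0), smooth on ℝ⁴ ∖ {0}, with G(z) > 0 for every z ≠ 0, and set X := {G ≤ 1}, Y := {G = 1} (a smooth bounded convex domain with 0 in its interior). Then there exist a closed characteristic γ on Y — a nonconstant solution of γ' = J₀∇G(γ) with γ(ℝ) ⊆ Y, periodic with minimal period T > 0 — which is a systole (every nonconstant periodic solution on Y has minimal period ≥ T), and a map u from the closed unit disk 𝔻̄ ⊆ ℂ to X, continuous and injective on 𝔻̄, smooth on the open disk 𝔻 with injective differential, such that u(∂𝔻) = γ(ℝ), u(𝔻) ⊆ {G < 1}, and ω₀(∂₁u(w), ∂₂u(w)) > 0 for every w ∈ 𝔻; that is, some systole of ∂X bounds an embedded positively symplectic disk in X (equivalently, is a Hopf orbit). -/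

import Mathlib

open Metric Set
open scoped InnerProductSpace

noncomputable section

/-- `ℝ⁴` as a Euclidean space. -/
abbrev E4 := EuclideanSpace ℝ (Fin 4)

/-- The standard complex structure `J₀(x₁,y₁,x₂,y₂) = (−y₁,x₁,−y₂,x₂)` on `ℝ⁴`. -/
def J0 (z : E4) : E4 :=
  WithLp.toLp 2 fun i => if i = 0 then -z 1 else if i = 1 then z 0 else if i = 2 then -z 3 else z 2

/-- The standard symplectic form `ω₀(u,v) = ⟨J₀u, v⟩` on `ℝ⁴`. -/
def omega0 (u v : E4) : ℝ := ⟪J0 u, v⟫_ℝ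

/-- `x` is a solution of the Hamiltonian system `x' = J₀∇G(x)`. -/
def IsHamSol (G : E4 → ℝ) (x : ℝ → E4) : Prop :=
  ∀ t, HasDerivAt x (J0 (gradient G (x t))) t

end

namespace Hopf
open Filter Topology

/-! ### Linear algebra of `J0` and `omega0` -/

theorem J0_add (u v : E4) : J0 (u + v) = J0 u + J0 v := by
  ext i; fin_cases i <;> simp [J0] <;> ring

theorem J0_smul (r : ℝ) (v : E4) : J0 (r • v) = r • J0 v := by
  ext i; fin_cases i <;> simp [J0]

theorem J0_J0 (v : E4) : J0 (J0 v) = -v := by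
  ext i; fin_cases i <;> simp [J0]

theorem inner_J0_J0 (u v : E4) : ⟪J0 u, J0 v⟫_ℝ = ⟪u, v⟫_ℝ := by
  simp [J0, PiLp.inner_apply, Fin.sum_univ_four]; ring

theorem inner_J0_left (u v : E4) : ⟪J0 u, v⟫_ℝ = -⟪u, J0 v⟫_ℝ := by
  rw [← inner_J0_J0, J0_J0, inner_neg_left]

theorem norm_J0 (v : E4) : ‖J0 v‖ = ‖v‖ := by
  have h := inner_J0_J0 v v
  rw [real_inner_self_eq_norm_sq, real_inner_self_eq_norm_sq] at h
  exact (sq_eq_sq₀ (norm_nonneg _) (norm_nonneg _)).1 h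

/-- `J0` as a continuous linear map. -/
noncomputable def Jl : E4 →L[ℝ] E4 :=
  LinearMap.toContinuousLinearMap { toFun := J0, map_add' := J0_add, map_smul' := J0_smul }

theorem Jl_apply (v : E4) : Jl v = J0 v := rfl

theorem J0_neg (v : E4) : J0 (-v) = -J0 v := by rw [← Jl_apply, map_neg, Jl_apply]
theorem J0_sub (u v : E4) : J0 (u - v) = J0 u - J0 v := by
  rw [← Jl_apply, map_sub, Jl_apply, Jl_apply]
@[simp] theorem J0_zero : J0 0 = 0 := by rw [← Jl_apply, map_zero]
theorem J0_continuous : Continuous J0 := Jl.continuous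

theorem om_add_left (u v w : E4) : omega0 (u + v) w = omega0 u w + omega0 v w := by
  simp only [omega0, J0_add, inner_add_left]
theorem om_add_right (u v w : E4) : omega0 u (v + w) = omega0 u v + omega0 u w := by
  simp only [omega0, inner_add_right]
theorem om_sub_left (u v w : E4) : omega0 (u - v) w = omega0 u w - omega0 v w := by
  simp only [omega0, J0_sub, inner_sub_left]
theorem om_sub_right (u v w : E4) : omega0 u (v - w) = omega0 u v - omega0 u w := by
  simp only [omega0, inner_sub_right]
theorem om_smul_left (r : ℝ) (u w : E4) : omega0 (r • u) w = r * omega0 u w := by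
  simp only [omega0, J0_smul, real_inner_smul_left]
theorem om_smul_right (r : ℝ) (u w : E4) : omega0 u (r • w) = r * omega0 u w := by
  simp only [omega0, real_inner_smul_right]
theorem om_neg_left (u w : E4) : omega0 (-u) w = -omega0 u w := by
  simp only [omega0, J0_neg, inner_neg_left]
theorem om_neg_right (u w : E4) : omega0 u (-w) = -omega0 u w := by
  simp only [omega0, inner_neg_right]
@[simp] theorem om_zero_left (w : E4) : omega0 0 w = 0 := by simp [omega0]
@[simp] theorem om_zero_right (w : E4) : omega0 w 0 = 0 := by simp [omega0]
theorem om_antisymm (u v : E4) : omega0 u v = -omega0 v u := by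
  simp only [omega0]; rw [inner_J0_left, real_inner_comm]
@[simp] theorem om_self (u : E4) : omega0 u u = 0 := by
  have := om_antisymm u u; linarith
theorem om_J0_right (u v : E4) : omega0 u (J0 v) = ⟪u, v⟫_ℝ := inner_J0_J0 u v
theorem om_eq (u v : E4) : omega0 u v = ⟪u, -J0 v⟫_ℝ := by
  rw [omega0, inner_J0_left, inner_neg_right]
theorem abs_om_le (u v : E4) : |omega0 u v| ≤ ‖u‖ * ‖v‖ := by
  have := abs_real_inner_le_norm (J0 u) v
  rwa [norm_J0] at this
theorem om_le (u v : E4) : omega0 u v ≤ ‖u‖ * ‖v‖ := (le_abs_self _).trans (abs_om_le u v)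
theorem om_continuous : Continuous fun p : E4 × E4 => omega0 p.1 p.2 := by
  unfold omega0
  exact (J0_continuous.comp continuous_fst).inner continuous_snd

/-! ### Good Hamiltonians -/

/-- The hypotheses on `G`. -/
structure GoodG (G : E4 → ℝ) : Prop where
  cont : Continuous G
  conv : ConvexOn ℝ Set.univ G
  hom : ∀ r : ℝ, 0 ≤ r → ∀ z : E4, G (r • z) = r ^ 2 * G z
  smooth : ContDiffOn ℝ (⊤ : ℕ∞) G {z : E4 | z ≠ 0}
  pos : ∀ z : E4, z ≠ 0 → 0 < G z

/-- The gradient (a wrapper which keeps `simp` from unfolding it). -/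
noncomputable def grd (G : E4 → ℝ) (z : E4) : E4 := gradient G z

namespace GoodG
variable {G : E4 → ℝ}

theorem zero (h : GoodG G) : G 0 = 0 := by simpa using h.hom 0 le_rfl 0

theorem nonneg (h : GoodG G) (z : E4) : 0 ≤ G z := by
  by_cases hz : z = 0
  · rw [hz, h.zero]
  · exact (h.pos z hz).le

theorem eq_norm (h : GoodG G) {z : E4} (hz : z ≠ 0) : G z = ‖z‖ ^ 2 * G (‖z‖⁻¹ • z) := by
  rw [← h.hom _ (norm_nonneg _), smul_smul, mul_inv_cancel₀ (norm_ne_zero_iff.2 hz), one_smul]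

theorem bounds (h : GoodG G) : ∃ m M : ℝ, 0 < m ∧ 0 < M ∧
    ∀ z, m * ‖z‖ ^ 2 ≤ G z ∧ G z ≤ M * ‖z‖ ^ 2 := by
  have hc : IsCompact (sphere (0 : E4) 1) := isCompact_sphere 0 1
  have hne : (sphere (0 : E4) 1).Nonempty := NormedSpace.sphere_nonempty.2 zero_le_one
  obtain ⟨a, ha, ha'⟩ := hc.exists_isMinOn hne h.cont.continuousOn
  obtain ⟨b, hb, hb'⟩ := hc.exists_isMaxOn hne h.cont.continuousOn
  have ne : ∀ c ∈ sphere (0 : E4) 1, c ≠ 0 := by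
    rintro c hc rfl; simp at hc
  refine ⟨G a, G b, h.pos a (ne a ha), h.pos b (ne b hb), fun z => ?_⟩
  by_cases hz : z = 0
  · simp [hz, h.zero]
  have hu : ‖z‖⁻¹ • z ∈ sphere (0 : E4) 1 := by
    simp [norm_smul, inv_mul_cancel₀ (norm_ne_zero_iff.2 hz)]
  have h1 := ha' hu
  have h2 := hb' hu
  simp only [mem_ofPred_eq] at h1 h2
  rw [h.eq_norm hz]
  constructor
  · nlinarith [sq_nonneg ‖z‖]
  · nlinarith [sq_nonneg ‖z‖]

theorem diffAt (h : GoodG G) (z : E4) : DifferentiableAt ℝ G z := by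
  by_cases hz : z = 0
  · subst hz
    obtain ⟨m, M, hm, hM, hb⟩ := h.bounds
    refine HasFDerivAt.differentiableAt (f' := 0) ?_
    rw [hasFDerivAt_iff_isLittleO_nhds_zero]
    simp only [zero_add, h.zero, sub_zero, zero_apply]
    have : (fun z : E4 => G z) =O[𝓝 0] fun z => ‖z‖ ^ 2 := by
      refine Asymptotics.IsBigO.of_bound M (Eventually.of_forall fun z => ?_)
      rw [Real.norm_of_nonneg (h.nonneg z), Real.norm_of_nonneg (by positivity)]
      exact (hb z).2
    refine this.trans_isLittleO ?_
    exact Asymptotics.isLittleO_norm_pow_id one_lt_two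
  · exact (h.smooth.differentiableOn (by simp)).differentiableAt
      (isOpen_ne.mem_nhds hz)

theorem hasGrad (h : GoodG G) (z : E4) : HasGradientAt G (grd G z) z :=
  (h.diffAt z).hasGradientAt

theorem hasF (h : GoodG G) (z : E4) : HasFDerivAt G (innerSL ℝ (grd G z)) z := by
  exact (h.hasGrad z).hasFDerivAt

theorem hasDerivAt_line (h : GoodG G) (x v : E4) (t : ℝ) :
    HasDerivAt (fun t : ℝ => G (x + t • v)) ⟪grd G (x + t • v), v⟫_ℝ t := by
  have h1 : HasDerivAt (fun t : ℝ => x + t • v) v t := by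
    simpa using ((hasDerivAt_id t).smul_const v).const_add x
  exact (h.hasF (x + t • v)).comp_hasDerivAt t h1

/-- Subgradient inequality. -/
theorem subgrad (h : GoodG G) (x y : E4) : G y + ⟪grd G y, x - y⟫_ℝ ≤ G x := by
  have hc : ConvexOn ℝ univ (fun t : ℝ => G (y + t • (x - y))) := by
    have := h.conv.comp_affineMap (AffineMap.lineMap (k := ℝ) y x)
    refine this.congr fun t _ => ?_
    simp [AffineMap.lineMap_apply, add_comm]
  have h1 := h.hasDerivAt_line y (x - y) 0
  have h2 := hc.le_slope_of_hasDerivAt (mem_univ 0) (mem_univ 1) one_pos h1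
  simp [slope_def_field] at h2
  linarith

/-- Euler's identity. -/
theorem euler (h : GoodG G) (y : E4) : ⟪grd G y, y⟫_ℝ = 2 * G y := by
  have h1 := h.hasDerivAt_line y y 0
  have h2 : HasDerivAt (fun t : ℝ => (1 + t) ^ 2 * G y) (2 * G y) 0 := by
    have := (((hasDerivAt_id (0 : ℝ)).const_add 1).pow 2).mul_const (G y)
    simpa using this
  have h3 : (fun t : ℝ => G (y + t • y)) =ᶠ[𝓝 0] fun t : ℝ => (1 + t) ^ 2 * G y := by
    filter_upwards [lt_mem_nhds (show (-1 : ℝ) < 0 by norm_num)] with t ht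
    rw [← h.hom (1 + t) (by linarith), add_smul, one_smul]
  have := h1.unique (h2.congr_of_eventuallyEq h3)
  simpa using this

theorem grad_zero (h : GoodG G) : grd G 0 = 0 := by
  have : IsLocalMin G 0 := Eventually.of_forall fun z => by rw [h.zero]; exact h.nonneg z
  have h2 := this.hasFDerivAt_eq_zero (h.hasF 0)
  have h3 := congrArg (fun L => L (grd G 0)) h2
  simpa using h3

theorem grad_smul (h : GoodG G) {r : ℝ} (hr : 0 ≤ r) (z : E4) :
    grd G (r • z) = r • grd G z := by
  rcases hr.eq_or_lt with rfl | hr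
  · simp [h.grad_zero]
  have h1 : HasFDerivAt (fun x => G (r • x)) ((innerSL ℝ (grd G (r • z))).comp
      (r • ContinuousLinearMap.id ℝ E4)) z :=
    (h.hasF (r • z)).comp z ((hasFDerivAt_id z).const_smul r)
  have h2 : HasFDerivAt (fun x => G (r • x)) (r ^ 2 • (innerSL ℝ (grd G z))) z := by
    have := (h.hasF z).const_mul (r ^ 2)
    simpa only [← h.hom r hr.le] using this
  have h3 := h1.unique h2
  refine ext_inner_right ℝ fun v => ?_
  have h4 := congrArg (fun L => L v) h3
  simp only [ContinuousLinearMap.comp_apply, smul_apply,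
    innerSL_apply_apply, ContinuousLinearMap.id_apply, real_inner_smul_right, smul_eq_mul] at h4
  rw [real_inner_smul_left]
  have : r * (⟪grd G (r • z), v⟫_ℝ - r * ⟪grd G z, v⟫_ℝ) = 0 := by linarith
  rcases mul_eq_zero.1 this with h5 | h5
  · exact absurd h5 hr.ne'
  · linarith

theorem grad_smooth (h : GoodG G) : ContDiffOn ℝ (⊤ : ℕ∞) (grd G) {z : E4 | z ≠ 0} := by
  have h1 : ContDiffOn ℝ (⊤ : ℕ∞) (fderiv ℝ G) {z : E4 | z ≠ 0} :=
    h.smooth.fderiv_of_isOpen isOpen_ne (by simp)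
  exact (InnerProductSpace.toDual ℝ E4).symm.toContinuousLinearEquiv.contDiff.comp_contDiffOn h1

theorem grad_lip (h : GoodG G) : ∃ L : ℝ, 0 < L ∧ ∀ x y : E4,
    ‖grd G x - grd G y‖ ≤ L * ‖x - y‖ := by
  have hd : ∀ z : E4, z ≠ 0 → DifferentiableAt ℝ (grd G) z := fun z hz =>
    (h.grad_smooth.differentiableOn (by simp)).differentiableAt (isOpen_ne.mem_nhds hz)
  have hcont : ContinuousOn (fderiv ℝ (grd G)) {z : E4 | z ≠ 0} :=
    h.grad_smooth.continuousOn_fderiv_of_isOpen isOpen_ne (by simp)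
  obtain ⟨C, hC⟩ := (isCompact_sphere (0 : E4) 1).exists_bound_of_continuousOn
    (hcont.mono (fun c hc => by rintro rfl; simp at hc))
  obtain ⟨D, hD⟩ := (isCompact_sphere (0 : E4) 1).exists_bound_of_continuousOn
    (h.grad_smooth.continuousOn.mono (fun c hc => by rintro rfl; simp at hc))
  have hfd : ∀ z : E4, z ≠ 0 → ‖fderiv ℝ (grd G) z‖ ≤ C := by
    intro z hz
    have hr : 0 < ‖z‖ := norm_pos_iff.2 hz
    have hu : ‖z‖⁻¹ • z ∈ sphere (0 : E4) 1 := by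
      simp [norm_smul, inv_mul_cancel₀ hr.ne']
    have hu0 : ‖z‖⁻¹ • z ≠ 0 := by simp [hz]
    have hri : 0 < ‖z‖⁻¹ := inv_pos.2 hr
    have h1 : HasFDerivAt (fun x => grd G (‖z‖⁻¹ • x))
        ((fderiv ℝ (grd G) (‖z‖⁻¹ • z)).comp (‖z‖⁻¹ • ContinuousLinearMap.id ℝ E4)) z :=
      (hd _ hu0).hasFDerivAt.comp z ((hasFDerivAt_id z).const_smul ‖z‖⁻¹)
    have h2 : HasFDerivAt (fun x => grd G (‖z‖⁻¹ • x))
        (‖z‖⁻¹ • fderiv ℝ (grd G) z) z := by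
      simp only [h.grad_smul hri.le]
      exact (hd z hz).hasFDerivAt.const_smul ‖z‖⁻¹
    have h3 := h1.unique h2
    rw [ContinuousLinearMap.comp_smul, ContinuousLinearMap.comp_id] at h3
    have h4 : fderiv ℝ (grd G) (‖z‖⁻¹ • z) = fderiv ℝ (grd G) z :=
      smul_right_injective (E4 →L[ℝ] E4) hri.ne' h3
    rw [← h4]
    exact hC _ hu
  have hgr : ∀ z : E4, ‖grd G z‖ ≤ D * ‖z‖ := by
    intro z
    by_cases hz : z = 0
    · simp [hz, h.grad_zero]
    have hr : 0 < ‖z‖ := norm_pos_iff.2 hz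
    have hu : ‖z‖⁻¹ • z ∈ sphere (0 : E4) 1 := by
      simp [norm_smul, inv_mul_cancel₀ hr.ne']
    have h1 : grd G z = ‖z‖ • grd G (‖z‖⁻¹ • z) := by
      rw [← h.grad_smul hr.le, smul_smul, mul_inv_cancel₀ hr.ne', one_smul]
    rw [h1, norm_smul, norm_norm, mul_comm]
    exact mul_le_mul_of_nonneg_right (hD _ hu) hr.le
  refine ⟨max (max C D) 1, by positivity, fun x y => ?_⟩
  have hle : ∀ a : ℝ, a ≤ C ∨ a ≤ D → a ≤ max (max C D) 1 := by
    rintro a (h | h)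
    · exact h.trans ((le_max_left _ _).trans (le_max_left _ _))
    · exact h.trans ((le_max_right _ _).trans (le_max_left _ _))
  by_cases hs : (0 : E4) ∈ segment ℝ y x
  · have h1 := dist_add_dist_of_mem_segment hs
    simp only [dist_zero_right, dist_zero_left] at h1
    calc ‖grd G x - grd G y‖ ≤ ‖grd G x‖ + ‖grd G y‖ := norm_sub_le _ _
      _ ≤ D * ‖x‖ + D * ‖y‖ := add_le_add (hgr x) (hgr y)
      _ = D * ‖x - y‖ := by rw [← dist_eq_norm, dist_comm, ← h1]; ring
      _ ≤ _ := mul_le_mul_of_nonneg_right (hle _ (Or.inr le_rfl)) (norm_nonneg _)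
  · have hne : ∀ z ∈ segment ℝ y x, z ≠ 0 := by rintro z hz rfl; exact hs hz
    exact (convex_segment y x).norm_image_sub_le_of_norm_hasFDerivWithin_le
      (fun z hz => (hd z (hne z hz)).hasFDerivAt.hasFDerivWithinAt)
      (fun z hz => hle _ (Or.inl (hfd z (hne z hz)))) (left_mem_segment ℝ y x)
      (right_mem_segment ℝ y x)

end GoodG
end Hopf

namespace Hopf
open Filter Topology

/-! ### The convex conjugate -/

/-- The Legendre conjugate. -/
noncomputable def Gs (G : E4 → ℝ) (p : E4) : ℝ := ⨆ x : E4, (⟪p, x⟫_ℝ - G x)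

namespace GoodG
variable {G : E4 → ℝ}

theorem exists_max (h : GoodG G) (p : E4) :
    ∃ x : E4, ∀ y : E4, ⟪p, y⟫_ℝ - G y ≤ ⟪p, x⟫_ℝ - G x := by
  obtain ⟨m, M, hm, hM, hb⟩ := h.bounds
  have hR : 0 ≤ ‖p‖ / m := by positivity
  have hcont : Continuous fun y : E4 => ⟪p, y⟫_ℝ - G y :=
    (continuous_const.inner continuous_id).sub h.cont
  obtain ⟨x, hx, hmax⟩ := (isCompact_closedBall (0 : E4) (‖p‖ / m)).exists_isMaxOn
    ⟨0, by simp [hR]⟩ hcont.continuousOn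
  refine ⟨x, fun y => ?_⟩
  by_cases hy : y ∈ closedBall (0 : E4) (‖p‖ / m)
  · exact hmax hy
  · have h0 : ⟪p, (0 : E4)⟫_ℝ - G 0 ≤ ⟪p, x⟫_ℝ - G x :=
      hmax (show (0 : E4) ∈ closedBall (0 : E4) (‖p‖ / m) by simp [hR])
    rw [h.zero, inner_zero_right, sub_zero] at h0
    refine le_trans ?_ h0
    simp only [mem_closedBall, dist_zero_right, not_le] at hy
    rw [div_lt_iff₀ hm] at hy
    have h1 := real_inner_le_norm p y
    have h2 := (hb y).1
    nlinarith [norm_nonneg y]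

theorem bdd (h : GoodG G) (p : E4) : BddAbove (range fun x : E4 => ⟪p, x⟫_ℝ - G x) := by
  obtain ⟨x, hx⟩ := h.exists_max p
  exact ⟨_, by rintro _ ⟨y, rfl⟩; exact hx y⟩

/-- Fenchel's inequality. -/
theorem fenchel (h : GoodG G) (p x : E4) : ⟪p, x⟫_ℝ ≤ G x + Gs G p := by
  have := le_ciSup (h.bdd p) x
  unfold Gs
  linarith

theorem Gs_attained (h : GoodG G) (p : E4) : ∃ x : E4, Gs G p = ⟪p, x⟫_ℝ - G x := by
  obtain ⟨x, hx⟩ := h.exists_max p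
  exact ⟨x, le_antisymm (ciSup_le hx) (le_ciSup (h.bdd p) x)⟩

theorem Gs_le (h : GoodG G) {p : E4} {c : ℝ} (hc : ∀ x : E4, ⟪p, x⟫_ℝ - G x ≤ c) : Gs G p ≤ c :=
  ciSup_le hc

theorem Gs_nonneg (h : GoodG G) (p : E4) : 0 ≤ Gs G p := by
  simpa [h.zero] using h.fenchel p 0

theorem Gs_grd (h : GoodG G) (x : E4) : Gs G (grd G x) = G x := by
  have h2 := h.euler x
  refine le_antisymm (h.Gs_le fun y => ?_) ?_
  · have h1 := h.subgrad y x
    rw [inner_sub_right] at h1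
    linarith
  · have := h.fenchel (grd G x) x
    linarith

theorem Gs_smul (h : GoodG G) {s : ℝ} (hs : 0 ≤ s) (p : E4) : Gs G (s • p) = s ^ 2 * Gs G p := by
  rcases hs.eq_or_lt with rfl | hs
  · have : Gs G 0 = 0 := le_antisymm (h.Gs_le fun x => by simpa using h.nonneg x) (h.Gs_nonneg 0)
    simp [this]
  refine le_antisymm (h.Gs_le fun x => ?_) ?_
  · have h1 := h.fenchel p (s⁻¹ • x)
    rw [h.hom _ (inv_pos.2 hs).le, real_inner_smul_right] at h1
    rw [real_inner_smul_left]
    have h2 := mul_le_mul_of_nonneg_left h1 (sq_nonneg s)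
    have h3 : s ^ 2 * (s⁻¹ * ⟪p, x⟫_ℝ) = s * ⟪p, x⟫_ℝ := by field_simp
    have h4 : s ^ 2 * (s⁻¹ ^ 2 * G x + Gs G p) = G x + s ^ 2 * Gs G p := by field_simp
    linarith
  · obtain ⟨x, hx⟩ := h.Gs_attained p
    have h1 := h.fenchel (s • p) (s • x)
    rw [h.hom _ hs.le, real_inner_smul_right, real_inner_smul_left] at h1
    rw [hx]; linarith

theorem Gs_bounds (h : GoodG G) : ∃ c C : ℝ, 0 < c ∧ 0 < C ∧
    ∀ p, c * ‖p‖ ^ 2 ≤ Gs G p ∧ Gs G p ≤ C * ‖p‖ ^ 2 := by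
  obtain ⟨m, M, hm, hM, hb⟩ := h.bounds
  refine ⟨1 / (4 * M), 1 / (4 * m), by positivity, by positivity, fun p => ⟨?_, ?_⟩⟩
  · have h1 := h.fenchel p ((1 / (2 * M)) • p)
    have h2 := (hb ((1 / (2 * M)) • p)).2
    rw [norm_smul, Real.norm_of_nonneg (by positivity)] at h2
    rw [real_inner_smul_right, real_inner_self_eq_norm_sq] at h1
    have h3 : M * (1 / (2 * M) * ‖p‖) ^ 2 = 1 / (4 * M) * ‖p‖ ^ 2 := by field_simp; ring
    have h4 : 1 / (2 * M) * ‖p‖ ^ 2 = 2 * (1 / (4 * M) * ‖p‖ ^ 2) := by field_simp; ring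
    linarith
  · refine h.Gs_le fun x => ?_
    have h1 := real_inner_le_norm p x
    have h2 := (hb x).1
    have h3 : 1 / (4 * m) * ‖p‖ ^ 2 - (‖p‖ * ‖x‖ - m * ‖x‖ ^ 2)
        = (‖p‖ - 2 * m * ‖x‖) ^ 2 / (4 * m) := by field_simp; ring
    have h4 : 0 ≤ (‖p‖ - 2 * m * ‖x‖) ^ 2 / (4 * m) := by positivity
    linarith

theorem Gs_convex (h : GoodG G) : ConvexOn ℝ univ (Gs G) := by
  refine ⟨convex_univ, fun p _ q _ a b ha hb hab => h.Gs_le fun x => ?_⟩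
  have h1 := mul_le_mul_of_nonneg_left (h.fenchel p x) ha
  have h2 := mul_le_mul_of_nonneg_left (h.fenchel q x) hb
  rw [inner_add_left, real_inner_smul_left, real_inner_smul_left, smul_eq_mul, smul_eq_mul]
  have : a * G x + b * G x = G x := by rw [← add_mul, hab, one_mul]
  linarith

theorem Gs_cont (h : GoodG G) : Continuous (Gs G) := by
  have := h.Gs_convex.continuousOn isOpen_univ
  exact continuousOn_univ.1 this

theorem eq_grd (h : GoodG G) {p x : E4} (he : ⟪p, x⟫_ℝ = G x + Gs G p) : p = grd G x := by
  have h1 : HasFDerivAt (fun y => G y - innerSL ℝ p y) (innerSL ℝ (grd G x) - innerSL ℝ p) x :=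
    (h.hasF x).sub (innerSL ℝ p).hasFDerivAt
  have h2 : IsLocalMin (fun y => G y - innerSL ℝ p y) x := Eventually.of_forall fun y => by
    have := h.fenchel p y
    simp only [innerSL_apply_apply]
    linarith
  have h3 := h2.hasFDerivAt_eq_zero h1
  refine ext_inner_right ℝ fun v => ?_
  have h4 := congrArg (fun L => L v) h3
  simp only [sub_apply, innerSL_apply_apply, zero_apply] at h4
  linarith

theorem Gs_avg_lt (h : GoodG G) {p q : E4} (hp : Gs G p = 1) (hq : Gs G q = 1) (hne : p ≠ q) :
    Gs G ((1 / 2 : ℝ) • (p + q)) < 1 := by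
  obtain ⟨x, hx⟩ := h.Gs_attained ((1 / 2 : ℝ) • (p + q))
  rw [real_inner_smul_left, inner_add_left] at hx
  have h1 := h.fenchel p x
  have h2 := h.fenchel q x
  rw [hp] at h1
  rw [hq] at h2
  rcases h1.lt_or_eq with h1 | h1
  · linarith
  rcases h2.lt_or_eq with h2 | h2
  · linarith
  exact absurd ((h.eq_grd (by rw [h1, hp])).trans (h.eq_grd (by rw [h2, hq])).symm) hne

theorem Gs_mono {G' : E4 → ℝ} (h : GoodG G) (h' : GoodG G') (hle : ∀ x, G x ≤ G' x) (p : E4) :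
    Gs G' p ≤ Gs G p :=
  h'.Gs_le fun x => by have := h.fenchel p x; have := hle x; linarith

theorem inner_grd_le (h : GoodG G) {y : E4} (hy : G y = 1) (x : E4) {s : ℝ} (hs : 0 < s) :
    ⟪grd G y, x⟫_ℝ ≤ G x / s + s := by
  have h1 := h.subgrad (s⁻¹ • x) y
  rw [inner_sub_right, h.euler, hy, h.hom _ (inv_pos.2 hs).le, real_inner_smul_right] at h1
  have h2 : s⁻¹ * ⟪grd G y, x⟫_ℝ ≤ s⁻¹ ^ 2 * G x + 1 := by linarith
  have h3 := mul_le_mul_of_nonneg_left h2 hs.le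
  have h4 : s * (s⁻¹ * ⟪grd G y, x⟫_ℝ) = ⟪grd G y, x⟫_ℝ := by field_simp
  have h5 : s * (s⁻¹ ^ 2 * G x + 1) = G x / s + s := by field_simp
  linarith

/-! ### Flow -/

theorem lip_field (h : GoodG G) : ∃ K : NNReal, LipschitzWith K fun x => J0 (grd G x) := by
  obtain ⟨L, hL, hl⟩ := h.grad_lip
  refine ⟨⟨L, hL.le⟩, LipschitzWith.of_dist_le_mul fun x y => ?_⟩
  rw [dist_eq_norm, dist_eq_norm, ← J0_sub, norm_J0]
  exact hl x y

end GoodG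

theorem global_flow {g : E4 → E4} {K : NNReal} (hK : LipschitzWith K g) {C : NNReal}
    (hC : ∀ x, ‖g x‖ ≤ C) (x0 : E4) :
    ∃ x : ℝ → E4, x 0 = x0 ∧ ∀ t, HasDerivAt x (g (x t)) t := by
  have key : ∀ N : ℕ, ∃ α : ℝ → E4, α 0 = x0 ∧
      ∀ t ∈ Ioo (-((N : ℝ) + 1)) (N + 1), HasDerivAt α (g (α t)) t := by
    intro N
    have h0 : (0 : ℝ) ∈ Icc (-((N : ℝ) + 1)) (N + 1) := by
      constructor <;> linarith [Nat.cast_nonneg (α := ℝ) N]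
    have hp : IsPicardLindelof (fun _ => g) (⟨0, h0⟩ : Icc (-((N : ℝ) + 1)) ((N : ℝ) + 1)) x0
        (C * (N + 1)) 0 C K :=
      IsPicardLindelof.of_time_independent (fun x _ => hC x) hK.lipschitzOnWith (by simp)
    obtain ⟨α, h1, h2⟩ := hp.exists_eq_forall_mem_Icc_hasDerivWithinAt₀
    exact ⟨α, h1, fun t ht => (h2 t (Ioo_subset_Icc_self ht)).hasDerivAt (Icc_mem_nhds ht.1 ht.2)⟩
  choose α hα0 hα using key
  have hu : ∀ N M : ℕ, N ≤ M → EqOn (α N) (α M) (Ioo (-((N : ℝ) + 1)) (N + 1)) := by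
    intro N M hNM
    have hNM' : (N : ℝ) ≤ M := by exact_mod_cast hNM
    refine ODE_solution_unique_of_mem_Ioo (v := fun _ => g) (s := fun _ => univ) (K := K)
      (t₀ := 0)
      (fun _ _ => hK.lipschitzOnWith) ?_ (fun t ht => ⟨hα N t ht, mem_univ _⟩)
      (fun t ht => ⟨hα M t ⟨by linarith [ht.1], by linarith [ht.2]⟩, mem_univ _⟩)
      (by rw [hα0, hα0])
    constructor <;> linarith [Nat.cast_nonneg (α := ℝ) N]
  refine ⟨fun t => α ⌈|t|⌉₊ t, by simp [hα0], fun t => ?_⟩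
  have heq : ∀ t' : ℝ, |t'| < (⌈|t|⌉₊ : ℝ) + 1 → α ⌈|t'|⌉₊ t' = α ⌈|t|⌉₊ t' := by
    intro t' ht'
    rcases le_total ⌈|t'|⌉₊ ⌈|t|⌉₊ with hle | hle
    · refine hu _ _ hle ?_
      have := Nat.le_ceil |t'|
      exact abs_lt.1 (by linarith)
    · exact (hu _ _ hle (abs_lt.1 ht')).symm
  have hlt : |t| < (⌈|t|⌉₊ : ℝ) + 1 := by linarith [Nat.le_ceil |t|]
  have hev : (fun t' => α ⌈|t'|⌉₊ t') =ᶠ[𝓝 t] α ⌈|t|⌉₊ := by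
    filter_upwards [continuous_abs.continuousAt.eventually_lt continuousAt_const hlt] with t' ht'
      using heq t' ht'
  exact (hα ⌈|t|⌉₊ t (abs_lt.1 hlt)).congr_of_eventuallyEq hev

/-- Solutions of the Hamiltonian system on the energy surface `G = 1`. -/
structure Orb (G : E4 → ℝ) (γ : ℝ → E4) : Prop where
  der : ∀ t, HasDerivAt γ (J0 (grd G (γ t))) t
  one : ∀ t, G (γ t) = 1

namespace GoodG
variable {G : E4 → ℝ}

theorem exists_orb (h : GoodG G) {x0 : E4} (h0 : G x0 = 1) :
    ∃ γ : ℝ → E4, γ 0 = x0 ∧ Orb G γ := by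
  obtain ⟨m, M, hm, hM, hb⟩ := h.bounds
  let b : ContDiffBump (1 : ℝ) := ⟨1 / 4, 1 / 2, by norm_num, by norm_num⟩
  have hb0 : ∀ s : ℝ, 1 / 2 ≤ |s - 1| → b s = 0 := fun s hs =>
    b.zero_of_le_dist (by simpa [Real.dist_eq, b] using hs)
  let g : E4 → E4 := fun x => b (G x) • J0 (grd G x)
  have hsm : ContDiff ℝ 1 g := by
    rw [contDiff_iff_contDiffAt]
    intro x
    by_cases hx : x = 0
    · have : g =ᶠ[𝓝 x] fun _ => 0 := by
        have hG : ∀ᶠ y in 𝓝 x, G y < 1 / 2 := by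
          refine h.cont.continuousAt.eventually_lt continuousAt_const ?_
          rw [hx, h.zero]; norm_num
        filter_upwards [hG] with y hy
        have : b (G y) = 0 := hb0 _ (by rw [abs_of_nonpos] <;> linarith)
        simp [g, this]
      exact contDiffAt_const.congr_of_eventuallyEq this
    · have hn : {z : E4 | z ≠ 0} ∈ 𝓝 x := isOpen_ne.mem_nhds hx
      have h1 : ContDiffAt ℝ 1 G x := (h.smooth.contDiffAt hn).of_le (by norm_cast)
      have h2 : ContDiffAt ℝ 1 (grd G) x := (h.grad_smooth.contDiffAt hn).of_le (by norm_cast)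
      have h3 : ContDiffAt ℝ 1 (fun y => Jl (grd G y)) x := Jl.contDiff.contDiffAt.comp x h2
      have h4 : ContDiffAt ℝ 1 (fun y => b (G y)) x := b.contDiffAt.comp x h1
      exact h4.smul h3
  have hsupp : HasCompactSupport g := by
    refine HasCompactSupport.of_support_subset_isCompact
      (isCompact_closedBall (0 : E4) (2 / m + 1)) fun x hx => ?_
    by_contra hx'
    apply hx
    have : b (G x) = 0 := by
      apply hb0
      have h1 := (hb x).1
      simp only [mem_closedBall, dist_zero_right, not_le] at hx'
      have h3 : 2 < m * ‖x‖ := by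
        have := mul_lt_mul_of_pos_left hx' hm
        have h4 : m * (2 / m + 1) = 2 + m := by field_simp
        linarith
      have h5 : 1 < ‖x‖ := by
        have : 0 < 2 / m := by positivity
        linarith
      have : 2 < G x := by nlinarith
      rw [abs_of_pos] <;> linarith
    simp [g, this]
  obtain ⟨K, hK⟩ := hsm.lipschitzWith_of_hasCompactSupport hsupp (by simp)
  obtain ⟨C, hC⟩ := hsupp.exists_bound_of_continuous hsm.continuous
  obtain ⟨x, hx0, hx⟩ := global_flow hK (C := C.toNNReal)
    (fun y => (hC y).trans (Real.le_coe_toNNReal C)) x0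
  have hconst : ∀ t, G (x t) = 1 := by
    have hd : ∀ t, HasDerivAt (fun t => G (x t)) 0 t := by
      intro t
      have := (h.hasF (x t)).comp_hasDerivAt t (hx t)
      refine HasDerivAt.congr_deriv this ?_
      simp only [g, innerSL_apply_apply, real_inner_smul_right]
      have h1 := inner_J0_left (grd G (x t)) (grd G (x t))
      rw [real_inner_comm] at h1
      have : ⟪grd G (x t), J0 (grd G (x t))⟫_ℝ = 0 := by linarith
      simp [this]
    intro t
    have := is_const_of_deriv_eq_zero (f := fun t => G (x t))
      (fun t => (hd t).differentiableAt) (fun t => (hd t).deriv) t 0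
    simpa [hx0, h0] using this
  refine ⟨x, hx0, fun t => ?_, hconst⟩
  have := hx t
  simp only [g, hconst t] at this
  rwa [b.one_of_mem_closedBall (by simp [b]), one_smul] at this

end GoodG

namespace Orb
variable {G : E4 → ℝ} {γ δ : ℝ → E4}

theorem shift (o : Orb G γ) (a : ℝ) : Orb G fun t => γ (t + a) :=
  ⟨fun t => (o.der (t + a)).comp_add_const t a, fun t => o.one _⟩

theorem cont (o : Orb G γ) : Continuous γ :=
  continuous_iff_continuousAt.2 fun t => (o.der t).continuousAt

theorem ne_zero (h : GoodG G) (o : Orb G γ) (t : ℝ) : γ t ≠ 0 := by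
  intro h0
  have := o.one t
  rw [h0, h.zero] at this
  norm_num at this

theorem eq_of_eq (h : GoodG G) (o : Orb G γ) (o' : Orb G δ) {s : ℝ} (he : γ s = δ s) : γ = δ := by
  obtain ⟨K, hK⟩ := h.lip_field
  exact ODE_solution_unique_univ (v := fun _ x => J0 (grd G x)) (s := fun _ => univ) (K := K)
    (fun _ => hK.lipschitzOnWith) (fun t => ⟨o.der t, mem_univ _⟩) (fun t => ⟨o'.der t, mem_univ _⟩)
    he

theorem periodic_of_eq (h : GoodG G) (o : Orb G γ) {s t : ℝ} (he : γ s = γ t) :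
    Function.Periodic γ (t - s) := by
  have := eq_of_eq h o (o.shift (t - s)) (s := s) (by simp [he])
  intro r
  exact (congrFun this r).symm

theorem smooth (h : GoodG G) (o : Orb G γ) : ContDiff ℝ (⊤ : ℕ∞) γ := by
  rw [contDiff_infty]
  have hder : deriv γ = fun t => Jl (grd G (γ t)) := funext fun t => (o.der t).deriv
  intro n
  induction n with
  | zero => exact contDiff_zero.2 o.cont
  | succ n ih =>
    rw [show ((n + 1 : ℕ) : WithTop ℕ∞) = (n : WithTop ℕ∞) + 1 by push_cast; rfl,
      contDiff_succ_iff_deriv]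
    refine ⟨fun t => (o.der t).differentiableAt, by simp, ?_⟩
    rw [hder]
    refine Jl.contDiff.comp ?_
    rw [contDiff_iff_contDiffAt]
    intro t
    have h1 : ContDiffAt ℝ n (grd G) (γ t) :=
      (h.grad_smooth.contDiffAt (isOpen_ne.mem_nhds (o.ne_zero h t))).of_le
        (by norm_cast; exact le_top)
    exact h1.comp t ih.contDiffAt

theorem bound (h : GoodG G) : ∃ R : ℝ, 0 < R ∧ ∀ z, G z ≤ 1 → ‖z‖ ≤ R ∧ ‖grd G z‖ ≤ R := by
  obtain ⟨m, M, hm, hM, hb⟩ := h.bounds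
  obtain ⟨L, hL, hl⟩ := h.grad_lip
  have h1 : ∀ z, G z ≤ 1 → ‖z‖ ≤ 1 + 1 / m := by
    intro z hz
    have h1 := (hb z).1
    have h2 : ‖z‖ ^ 2 ≤ 1 / m := by rw [le_div_iff₀ hm]; linarith
    nlinarith [norm_nonneg z]
  have h3 : 0 < 1 + 1 / m := by positivity
  refine ⟨(1 + 1 / m) * (1 + L), by positivity, fun z hz => ⟨?_, ?_⟩⟩
  · have := h1 z hz
    nlinarith
  · have h2 := hl z 0
    rw [h.grad_zero, sub_zero, sub_zero] at h2
    have := h1 z hz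
    nlinarith [norm_nonneg z]

end Orb
end Hopf

namespace Hopf
open Filter Topology

/-! ### Polygons -/

/-- Symplectic area of the polygon with the given list of edges. -/
noncomputable def PA : List E4 → ℝ
  | [] => 0
  | v :: l => (1 / 2) * omega0 v l.sum + PA l

theorem PA_append (l₁ l₂ : List E4) :
    PA (l₁ ++ l₂) = PA l₁ + PA l₂ + (1 / 2) * omega0 l₁.sum l₂.sum := by
  induction l₁ with
  | nil => simp [PA]
  | cons v l ih =>
    simp only [List.cons_append, PA, ih, List.sum_append, List.sum_cons, om_add_left,
      om_add_right]
    ring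

theorem PA_replicate (n : ℕ) (v : E4) : PA (List.replicate n v) = 0 := by
  induction n with
  | zero => simp [PA]
  | succ n ih =>
    rw [List.replicate_succ, PA, ih, List.sum_replicate, ← Nat.cast_smul_eq_nsmul ℝ,
      om_smul_right]
    simp

/-- The quadratic cost of an edge. -/
noncomputable def qq (G : E4 → ℝ) (v : E4) : ℝ := Gs G (-J0 v)

/-- The cost of a list of edges. -/
noncomputable def PE (G : E4 → ℝ) (l : List E4) : ℝ := (l.map (qq G)).sum

theorem PE_append (G : E4 → ℝ) (l₁ l₂ : List E4) : PE G (l₁ ++ l₂) = PE G l₁ + PE G l₂ := by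
  simp [PE]

theorem PE_replicate (G : E4 → ℝ) (n : ℕ) (v : E4) : PE G (List.replicate n v) = n * qq G v := by
  simp [PE]

/-- Area, as a function of a sequence of edges. -/
noncomputable def fA (K : ℕ) (v : ℕ → E4) : ℝ :=
  (1 / 2) * ∑ i ∈ Finset.range K, omega0 (∑ j ∈ Finset.range i, v j) (v i)

theorem sum_map_range (K : ℕ) (v : ℕ → E4) :
    ((List.range K).map v).sum = ∑ i ∈ Finset.range K, v i := by
  induction K with
  | zero => simp
  | succ K ih => rw [List.range_succ, List.map_append, List.sum_append, ih,
      Finset.sum_range_succ]; simp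

theorem PA_range (K : ℕ) (v : ℕ → E4) : PA ((List.range K).map v) = fA K v := by
  induction K with
  | zero => simp [PA, fA]
  | succ K ih =>
    rw [List.range_succ, List.map_append, PA_append, ih, sum_map_range, fA, fA,
      Finset.sum_range_succ]
    simp [PA]
    ring

theorem PE_range (G : E4 → ℝ) (K : ℕ) (v : ℕ → E4) :
    PE G ((List.range K).map v) = ∑ i ∈ Finset.range K, qq G (v i) := by
  induction K with
  | zero => simp [PE]
  | succ K ih => rw [List.range_succ, List.map_append, PE_append, ih, Finset.sum_range_succ]
                 simp [PE]

theorem list_eq_range (l : List E4) : l = (List.range l.length).map (fun i => l.getD i 0) := by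
  refine List.ext_getElem (by simp) fun i h1 h2 => ?_
  simp [h1]

theorem abs_fA_le (K : ℕ) (v : ℕ → E4) : |fA K v| ≤ (1 / 2) * (∑ i ∈ Finset.range K, ‖v i‖) ^ 2 := by
  rw [fA, abs_mul, abs_of_pos (by norm_num : (0 : ℝ) < 1 / 2)]
  refine mul_le_mul_of_nonneg_left ?_ (by norm_num)
  calc |∑ i ∈ Finset.range K, omega0 (∑ j ∈ Finset.range i, v j) (v i)|
      ≤ ∑ i ∈ Finset.range K, |omega0 (∑ j ∈ Finset.range i, v j) (v i)| :=
        Finset.abs_sum_le_sum_abs _ _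
    _ ≤ ∑ i ∈ Finset.range K, (∑ j ∈ Finset.range K, ‖v j‖) * ‖v i‖ := by
        refine Finset.sum_le_sum fun i hi => (abs_om_le _ _).trans ?_
        refine mul_le_mul_of_nonneg_right ((norm_sum_le _ _).trans ?_) (norm_nonneg _)
        exact Finset.sum_le_sum_of_subset_of_nonneg
          (Finset.range_subset_range.2 (Finset.mem_range.1 hi).le) fun _ _ _ => norm_nonneg _
    _ = (∑ i ∈ Finset.range K, ‖v i‖) ^ 2 := by rw [← Finset.mul_sum, sq]

/-- Mixed term of the area form for closed polygons. -/
noncomputable def xm (v : ℕ → E4) (i : ℕ) : E4 := ∑ j ∈ Finset.range i, v j + (1 / 2 : ℝ) • v i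

theorem om_sum_left {ι : Type*} (s : Finset ι) (f : ι → E4) (w : E4) :
    omega0 (∑ i ∈ s, f i) w = ∑ i ∈ s, omega0 (f i) w := by
  classical
  induction s using Finset.induction_on with
  | empty => simp
  | insert a s ha ih => rw [Finset.sum_insert ha, Finset.sum_insert ha, om_add_left, ih]

theorem om_sum_right {ι : Type*} (s : Finset ι) (f : ι → E4) (w : E4) :
    omega0 w (∑ i ∈ s, f i) = ∑ i ∈ s, omega0 w (f i) := by
  rw [om_antisymm, om_sum_left, ← Finset.sum_neg_distrib]
  exact Finset.sum_congr rfl fun i _ => (om_antisymm _ _).symm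

/-- Summation by parts. -/
theorem sum_parts (K : ℕ) (v y : ℕ → E4) :
    ∑ i ∈ Finset.range K, (omega0 (∑ j ∈ Finset.range i, v j) (y i)
        + omega0 (∑ j ∈ Finset.range i, y j) (v i))
      = 2 * ∑ i ∈ Finset.range K, omega0 (xm v i) (y i)
        + omega0 (∑ i ∈ Finset.range K, y i) (∑ i ∈ Finset.range K, v i) := by
  induction K with
  | zero => simp
  | succ K ih =>
    simp only [Finset.sum_range_succ, xm, om_add_left, om_add_right, om_smul_left] at ih ⊢
    rw [ih, om_antisymm (y K) (∑ x ∈ Finset.range K, v x), om_antisymm (y K) (v K)]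
    ring

theorem fA_comb (K : ℕ) (v y : ℕ → E4) (a b : ℝ) (hy : ∑ i ∈ Finset.range K, y i = 0) :
    fA K (fun i => a • v i + b • y i) = a ^ 2 * fA K v
      + a * b * ∑ i ∈ Finset.range K, omega0 (xm v i) (y i) + b ^ 2 * fA K y := by
  have h := sum_parts K v y
  rw [hy, om_zero_left, add_zero, Finset.sum_add_distrib] at h
  have h2 : ∑ i ∈ Finset.range K, omega0 (∑ j ∈ Finset.range i, (a • v j + b • y j))
      (a • v i + b • y i) = a ^ 2 * ∑ i ∈ Finset.range K, omega0 (∑ j ∈ Finset.range i, v j) (v i)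
      + a * b * (∑ i ∈ Finset.range K, omega0 (∑ j ∈ Finset.range i, v j) (y i)
        + ∑ i ∈ Finset.range K, omega0 (∑ j ∈ Finset.range i, y j) (v i))
      + b ^ 2 * ∑ i ∈ Finset.range K, omega0 (∑ j ∈ Finset.range i, y j) (y i) := by
    rw [← Finset.sum_add_distrib, Finset.mul_sum, Finset.mul_sum, Finset.mul_sum,
      ← Finset.sum_add_distrib, ← Finset.sum_add_distrib]
    refine Finset.sum_congr rfl fun i _ => ?_
    rw [Finset.sum_add_distrib, ← Finset.smul_sum, ← Finset.smul_sum]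
    simp only [om_add_left, om_add_right, om_smul_left, om_smul_right]
    ring
  rw [fA, h2, h, fA, fA]
  ring

theorem sum_om_xm (K : ℕ) (v : ℕ → E4) :
    ∑ i ∈ Finset.range K, omega0 (xm v i) (v i) = 2 * fA K v := by
  simp only [xm, om_add_left, om_smul_left, om_self, mul_zero, add_zero, fA]
  ring

namespace GoodG
variable {G : E4 → ℝ}

theorem qq_nonneg (h : GoodG G) (v : E4) : 0 ≤ qq G v := h.Gs_nonneg _

theorem qq_smul (h : GoodG G) {s : ℝ} (hs : 0 ≤ s) (v : E4) : qq G (s • v) = s ^ 2 * qq G v := by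
  rw [qq, J0_smul, ← smul_neg, h.Gs_smul hs, qq]

theorem qq_cont (h : GoodG G) : Continuous (qq G) :=
  h.Gs_cont.comp J0_continuous.neg

theorem qq_bounds (h : GoodG G) : ∃ c C : ℝ, 0 < c ∧ 0 < C ∧
    ∀ p, c * ‖p‖ ^ 2 ≤ qq G p ∧ qq G p ≤ C * ‖p‖ ^ 2 := by
  obtain ⟨c, C, hc, hC, hb⟩ := h.Gs_bounds
  refine ⟨c, C, hc, hC, fun p => ?_⟩
  have := hb (-J0 p)
  rwa [norm_neg, norm_J0] at this

theorem qq_comb (h : GoodG G) (v y : E4) {a b : ℝ} (ha : 0 ≤ a) (hb : 0 ≤ b) (hab : a + b = 1) :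
    qq G (a • v + b • y) ≤ a * qq G v + b * qq G y := by
  have := h.Gs_convex.2 (mem_univ (-J0 v)) (mem_univ (-J0 y)) ha hb hab
  rw [qq, J0_add, J0_smul, J0_smul, neg_add, ← smul_neg, ← smul_neg]
  exact this

end GoodG

/-- Feasible closed polygons. -/
def Feas (G : E4 → ℝ) (K : ℕ) : Set (ℕ → E4) :=
  {v | (∀ i, K ≤ i → v i = 0) ∧ ∑ i ∈ Finset.range K, v i = 0 ∧
    K * ∑ i ∈ Finset.range K, qq G (v i) ≤ 1}

theorem fA_cont (K : ℕ) : Continuous (fA K) := by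
  unfold fA
  refine continuous_const.mul (continuous_finsetSum _ fun i _ => ?_)
  exact om_continuous.comp ((continuous_finsetSum _ fun j _ => continuous_apply j).prodMk
    (continuous_apply i))

namespace GoodG
variable {G : E4 → ℝ}

theorem sum_norm_sq_le (h : GoodG G) : ∃ c : ℝ, 0 < c ∧ ∀ (K : ℕ) (v : ℕ → E4),
    (∑ i ∈ Finset.range K, ‖v i‖) ^ 2 ≤ c * (K * ∑ i ∈ Finset.range K, qq G (v i)) := by
  obtain ⟨c, C, hc, hC, hb⟩ := h.qq_bounds
  refine ⟨1 / c, by positivity, fun K v => ?_⟩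
  have h1 := sq_sum_le_card_mul_sum_sq (s := Finset.range K) (f := fun i => ‖v i‖)
  rw [Finset.card_range] at h1
  have h2 : ∑ i ∈ Finset.range K, ‖v i‖ ^ 2 ≤ 1 / c * ∑ i ∈ Finset.range K, qq G (v i) := by
    rw [Finset.mul_sum]
    refine Finset.sum_le_sum fun i _ => ?_
    have := (hb (v i)).1
    rw [div_mul_eq_mul_div, one_mul, le_div_iff₀ hc]
    linarith
  calc _ ≤ _ := h1
    _ ≤ K * (1 / c * ∑ i ∈ Finset.range K, qq G (v i)) :=
      mul_le_mul_of_nonneg_left h2 (Nat.cast_nonneg K)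
    _ = _ := by ring

theorem feas_compact (h : GoodG G) {K : ℕ} (hK : 0 < K) : IsCompact (Feas G K) := by
  obtain ⟨c, hc, hb⟩ := h.sum_norm_sq_le
  have hcl : IsClosed (Feas G K) := by
    have h1 : IsClosed {v : ℕ → E4 | ∀ i, K ≤ i → v i = 0} := by
      simp only [Set.ofPred_forall]
      refine isClosed_iInter fun i => isClosed_iInter fun _ =>
        isClosed_eq (continuous_apply i) continuous_const
    have h2 : IsClosed {v : ℕ → E4 | ∑ i ∈ Finset.range K, v i = 0} :=
      isClosed_eq (continuous_finsetSum _ fun j _ => continuous_apply j) continuous_const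
    have h3 : IsClosed {v : ℕ → E4 | K * ∑ i ∈ Finset.range K, qq G (v i) ≤ 1} :=
      isClosed_le (continuous_const.mul (continuous_finsetSum _ fun j _ =>
        h.qq_cont.comp (continuous_apply j))) continuous_const
    exact h1.inter (h2.inter h3)
  have hcomp : IsCompact (Set.pi univ fun _ : ℕ => closedBall (0 : E4) (1 + c)) :=
    isCompact_univ_pi fun _ => isCompact_closedBall _ _
  refine hcomp.of_isClosed_subset hcl ?_
  rintro v ⟨h1, h2, h3⟩ i -
  rw [mem_closedBall, dist_zero_right]
  rcases le_or_gt K i with hi | hi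
  · rw [h1 i hi, norm_zero]; positivity
  · have h4 := hb K v
    have h5 : ‖v i‖ ≤ ∑ i ∈ Finset.range K, ‖v i‖ :=
      Finset.single_le_sum (f := fun i => ‖v i‖) (fun _ _ => norm_nonneg _) (Finset.mem_range.2 hi)
    have h6 : (∑ i ∈ Finset.range K, ‖v i‖) ^ 2 ≤ c := h4.trans (by nlinarith)
    nlinarith [norm_nonneg (v i)]

theorem exists_maximizer (h : GoodG G) {K : ℕ} (hK : 0 < K) :
    ∃ v ∈ Feas G K, (∀ y ∈ Feas G K, fA K y ≤ fA K v) ∧ 0 ≤ fA K v := by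
  have h0 : (fun _ => 0 : ℕ → E4) ∈ Feas G K := by
    have : qq G 0 = 0 := by simpa using h.qq_smul (le_refl (0 : ℝ)) 0
    simp [Feas, this]
  obtain ⟨v, hv, hm⟩ := (h.feas_compact hK).exists_isMaxOn ⟨_, h0⟩ (fA_cont K).continuousOn
  refine ⟨v, hv, fun y hy => hm hy, ?_⟩
  have : fA K (fun _ => 0) ≤ fA K v := hm h0
  simpa [fA] using this

/-- Homogeneous form of maximality. -/
theorem maximizer_list (h : GoodG G) {K : ℕ} (hK : 0 < K) {v : ℕ → E4}
    (hv : ∀ y ∈ Feas G K, fA K y ≤ fA K v) (l : List E4) (hl : l.length = K) (hs : l.sum = 0) :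
    PA l ≤ fA K v * (K * PE G l) := by
  obtain ⟨c, hc, hb⟩ := h.sum_norm_sq_le
  let y : ℕ → E4 := fun i => if i < K then l.getD i 0 else 0
  have hy : l = (List.range K).map y := by
    conv_lhs => rw [list_eq_range l, hl]
    refine List.map_congr_left fun i hi => ?_
    simp [y, List.mem_range.1 hi]
  have hK' : (0 : ℝ) < K := by exact_mod_cast hK
  rw [hy, PA_range, PE_range]
  rw [hy, sum_map_range] at hs
  set E := K * ∑ i ∈ Finset.range K, qq G (y i) with hE
  have hE0 : 0 ≤ E := mul_nonneg hK'.le (Finset.sum_nonneg fun i _ => h.qq_nonneg _)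
  rcases hE0.eq_or_lt with hE0 | hE0
  · have h1 := hb K y
    rw [← hE, ← hE0, mul_zero] at h1
    have h2 := (le_abs_self _).trans (abs_fA_le K y)
    rw [← hE0]; nlinarith
  · have hr : 0 < √E := Real.sqrt_pos.2 hE0
    have hsq : √E ^ 2 = E := Real.sq_sqrt hE0.le
    have hf : (fun i => (√E)⁻¹ • y i) ∈ Feas G K := by
      refine ⟨fun i hi => by simp [y, not_lt.2 hi], by rw [← Finset.smul_sum, hs, smul_zero], ?_⟩
      simp only [h.qq_smul (inv_pos.2 hr).le]
      rw [← Finset.mul_sum, mul_left_comm, ← hE, inv_pow, hsq, inv_mul_cancel₀ hE0.ne']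
    have h1 := hv _ hf
    have h2 : fA K (fun i => (√E)⁻¹ • y i) = E⁻¹ * fA K y := by
      have := fA_comb K y (fun _ => 0) (√E)⁻¹ 0 (by simp)
      simp only [smul_zero, add_zero, om_zero_right, Finset.sum_const_zero, mul_zero] at this
      rw [this, inv_pow, hsq]; simp
    rw [h2, inv_mul_le_iff₀ hE0] at h1
    linarith

/-- Minimizing translate. -/
theorem exists_center (h : GoodG G) {K : ℕ} (hK : 0 < K) (x : ℕ → E4) :
    ∃ c : E4, ∑ i ∈ Finset.range K, grd G (x i - c) = 0 := by
  obtain ⟨m, M, hm, hM, hb⟩ := h.bounds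
  let φ : E4 → ℝ := fun c => ∑ i ∈ Finset.range K, G (x i - c)
  have hφ : Continuous φ := continuous_finsetSum _ fun i _ =>
    h.cont.comp (continuous_const.sub continuous_id)
  have htend : Tendsto φ (cocompact E4) atTop := by
    have h1 : Tendsto (fun c : E4 => m * (‖c‖ - ‖x 0‖) ^ 2) (cocompact E4) atTop := by
      refine Tendsto.const_mul_atTop hm ?_
      refine (tendsto_pow_atTop two_ne_zero).comp ?_
      exact tendsto_atTop_add_const_right _ (-‖x 0‖) (tendsto_norm_cocompact_atTop (E := E4))
    refine tendsto_atTop_mono (fun c => ?_) h1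
    have h2 : G (x 0 - c) ≤ φ c :=
      Finset.single_le_sum (f := fun i => G (x i - c)) (fun _ _ => h.nonneg _)
        (Finset.mem_range.2 hK)
    refine le_trans ?_ h2
    refine le_trans ?_ (hb _).1
    refine mul_le_mul_of_nonneg_left ?_ hm.le
    rw [sq_le_sq, abs_norm, abs_sub_comm]
    exact abs_norm_sub_norm_le _ _
  obtain ⟨c, hc⟩ := hφ.exists_forall_le htend
  refine ⟨c, ?_⟩
  have hd : HasFDerivAt φ (∑ i ∈ Finset.range K, -(innerSL ℝ (grd G (x i - c)))) c := by
    refine HasFDerivAt.fun_sum fun i _ => ?_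
    have h1 : HasFDerivAt (fun c : E4 => x i - c) (-ContinuousLinearMap.id ℝ E4) c :=
      (hasFDerivAt_id c).const_sub (x i)
    have := (h.hasF (x i - c)).comp c h1
    refine this.congr_fderiv ?_
    ext v; simp
  have h0 := IsLocalMin.hasFDerivAt_eq_zero (Eventually.of_forall hc) hd
  refine ext_inner_right ℝ fun w => ?_
  have h1 := congrArg (fun L => L w) h0
  simp only [sum_apply, neg_apply, innerSL_apply_apply, zero_apply, Finset.sum_neg_distrib,
    neg_eq_zero] at h1
  rw [sum_inner, h1, inner_zero_left]

/-- Discrete Euler-Lagrange equation. -/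
theorem euler_lagrange (h : GoodG G) {K : ℕ} (hK : 0 < K) {v : ℕ → E4} (hvF : v ∈ Feas G K)
    (hv : ∀ y ∈ Feas G K, fA K y ≤ fA K v) (hpos : 0 < fA K v) :
    ∃ c : E4, (∀ i < K, v i = (1 / (K * fA K v)) • J0 (grd G (xm v i - c))) ∧
      ∑ i ∈ Finset.range K, G (xm v i - c) = K * fA K v ^ 2 := by
  obtain ⟨hv0, hvs, hvE⟩ := hvF
  have hK' : (0 : ℝ) < K := by exact_mod_cast hK
  obtain ⟨c, hc⟩ := h.exists_center hK (xm v)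
  set A := fA K v with hA
  have hlin : ∀ y ∈ Feas G K, ∑ i ∈ Finset.range K, omega0 (xm v i) (y i) ≤ 2 * A := by
    rintro y ⟨hy0, hys, hyE⟩
    set L := ∑ i ∈ Finset.range K, omega0 (xm v i) (y i) with hL
    have h1 : ∀ e : ℝ, 0 < e → e < 1 → (e - 2) * A + (1 - e) * L + e * fA K y ≤ 0 := by
      intro e he he1
      have hf : (fun i => (1 - e) • v i + e • y i) ∈ Feas G K := by
        refine ⟨fun i hi => by simp [hv0 i hi, hy0 i hi], ?_, ?_⟩
        · rw [Finset.sum_add_distrib, ← Finset.smul_sum, ← Finset.smul_sum, hvs, hys]; simp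
        · have : ∑ i ∈ Finset.range K, qq G ((1 - e) • v i + e • y i) ≤
              (1 - e) * ∑ i ∈ Finset.range K, qq G (v i) + e * ∑ i ∈ Finset.range K, qq G (y i) := by
            rw [Finset.mul_sum, Finset.mul_sum, ← Finset.sum_add_distrib]
            exact Finset.sum_le_sum fun i _ => h.qq_comb _ _ (by linarith) he.le (by ring)
          nlinarith
      have h2 := hv _ hf
      rw [fA_comb K v y _ _ hys, ← hA, ← hL] at h2
      have h3 : e * ((e - 2) * A + (1 - e) * L + e * fA K y) ≤ 0 := by nlinarith
      exact nonpos_of_mul_nonpos_right h3 he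
    have h2 : Tendsto (fun e : ℝ => (e - 2) * A + (1 - e) * L + e * fA K y) (𝓝[>] 0)
        (𝓝 ((0 - 2) * A + (1 - 0) * L + 0 * fA K y)) := by
      refine Tendsto.mono_left (Continuous.tendsto ?_ 0) nhdsWithin_le_nhds
      fun_prop
    have h3 := le_of_tendsto h2 (by
      filter_upwards [Ioo_mem_nhdsGT (show (0 : ℝ) < 1 by norm_num)] with e he using h1 e he.1 he.2)
    linarith
  have hshift : ∀ y : ℕ → E4, ∑ i ∈ Finset.range K, y i = 0 →
      ∑ i ∈ Finset.range K, omega0 (xm v i - c) (y i)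
        = ∑ i ∈ Finset.range K, omega0 (xm v i) (y i) := by
    intro y hy
    simp only [om_sub_left, Finset.sum_sub_distrib, ← om_sum_right, hy, om_zero_right, sub_zero]
  set S := ∑ i ∈ Finset.range K, G (xm v i - c) with hS
  have hS0 : 0 ≤ S := Finset.sum_nonneg fun i _ => h.nonneg _
  have h2A : ∑ i ∈ Finset.range K, omega0 (xm v i - c) (v i) = 2 * A := by
    rw [hshift v hvs, sum_om_xm]
  have hSpos : 0 < S := by
    rcases hS0.eq_or_lt with h0 | h0
    · exfalso
      have h1 := (Finset.sum_eq_zero_iff_of_nonneg (fun i _ => h.nonneg (xm v i - c))).1 h0.symm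
      have h2 : ∑ i ∈ Finset.range K, omega0 (xm v i - c) (v i) = 0 := by
        refine Finset.sum_eq_zero fun i hi => ?_
        have h3 : xm v i - c = 0 := by
          by_contra h4
          exact (h.pos _ h4).ne' (h1 i hi)
        rw [h3, om_zero_left]
      linarith
    · exact h0
  have hKS : 0 < K * S := mul_pos hK' hSpos
  set μ := (√(K * S))⁻¹ with hμ
  have hμ0 : 0 < μ := inv_pos.2 (Real.sqrt_pos.2 hKS)
  have hμ2 : μ ^ 2 * (K * S) = 1 := by
    rw [hμ, inv_pow, Real.sq_sqrt hKS.le, inv_mul_cancel₀ hKS.ne']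
  have hle : μ * S ≤ A := by
    let y : ℕ → E4 := fun i => if i < K then μ • J0 (grd G (xm v i - c)) else 0
    have hy : ∀ i ∈ Finset.range K, y i = μ • J0 (grd G (xm v i - c)) := fun i hi => by
      simp [y, Finset.mem_range.1 hi]
    have hys : ∑ i ∈ Finset.range K, y i = 0 := by
      rw [Finset.sum_congr rfl hy, ← Finset.smul_sum]
      simp only [← Jl_apply]
      rw [← map_sum, hc, map_zero, smul_zero]
    have hyF : y ∈ Feas G K := by
      refine ⟨fun i hi => by simp [y, not_lt.2 hi], hys, ?_⟩
      have : ∀ i ∈ Finset.range K, qq G (y i) = μ ^ 2 * G (xm v i - c) := fun i hi => by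
        rw [hy i hi, h.qq_smul hμ0.le, qq, J0_J0, neg_neg, h.Gs_grd]
      rw [Finset.sum_congr rfl this, ← Finset.mul_sum]
      linarith
    have h1 := hlin y hyF
    rw [← hshift y hys] at h1
    have h2 : ∀ i ∈ Finset.range K, omega0 (xm v i - c) (y i) = 2 * μ * G (xm v i - c) :=
      fun i hi => by
        rw [hy i hi, om_smul_right, om_J0_right, real_inner_comm, h.euler]; ring
    rw [Finset.sum_congr rfl h2, ← Finset.mul_sum] at h1
    linarith
  -- Fenchel
  have hqe : ∀ i, qq G (v i) = μ ^ 2 * Gs G (μ⁻¹ • (-J0 (v i))) := fun i => by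
    rw [h.Gs_smul (inv_pos.2 hμ0).le, qq]; field_simp
  have hF : ∀ i ∈ Finset.range K, omega0 (xm v i - c) (v i) ≤
      μ * (G (xm v i - c) + Gs G (μ⁻¹ • (-J0 (v i)))) := by
    intro i _
    have h1 := h.fenchel (μ⁻¹ • (-J0 (v i))) (xm v i - c)
    rw [om_eq, real_inner_comm]
    rw [real_inner_smul_left, inv_mul_le_iff₀ hμ0] at h1
    exact h1
  have hsumR : ∑ i ∈ Finset.range K, μ * (G (xm v i - c) + Gs G (μ⁻¹ • (-J0 (v i)))) ≤ 2 * (μ * S) := by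
    rw [← Finset.mul_sum, Finset.sum_add_distrib, ← hS]
    have h1 : ∑ i ∈ Finset.range K, qq G (v i)
        = μ ^ 2 * ∑ i ∈ Finset.range K, Gs G (μ⁻¹ • (-J0 (v i))) := by
      rw [Finset.mul_sum]; exact Finset.sum_congr rfl fun i _ => hqe i
    rw [h1] at hvE
    have h2 : ∑ i ∈ Finset.range K, Gs G (μ⁻¹ • (-J0 (v i))) ≤ S := by
      have h3 : (K * μ ^ 2) * ∑ i ∈ Finset.range K, Gs G (μ⁻¹ • (-J0 (v i))) ≤ (K * μ ^ 2) * S := by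
        linarith
      exact le_of_mul_le_mul_left h3 (by positivity)
    nlinarith
  have hAeq : A = μ * S := by
    have := Finset.sum_le_sum hF
    linarith
  have heq : ∀ i ∈ Finset.range K, omega0 (xm v i - c) (v i) =
      μ * (G (xm v i - c) + Gs G (μ⁻¹ • (-J0 (v i)))) := by
    refine (Finset.sum_eq_sum_iff_of_le hF).1 (le_antisymm (Finset.sum_le_sum hF) ?_)
    linarith
  have hμA : 1 / (K * A) = μ := by
    rw [div_eq_iff (by positivity), hAeq]; linarith
  refine ⟨c, fun i hi => ?_, ?_⟩
  · have h1 := heq i (Finset.mem_range.2 hi)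
    rw [om_eq, real_inner_comm] at h1
    have h2 : ⟪μ⁻¹ • (-J0 (v i)), xm v i - c⟫_ℝ = G (xm v i - c) + Gs G (μ⁻¹ • (-J0 (v i))) := by
      rw [real_inner_smul_left, inv_mul_eq_iff_eq_mul₀ hμ0.ne']; exact h1
    have h3 := h.eq_grd h2
    rw [hμA, ← h3, J0_smul, J0_neg, J0_J0, neg_neg, smul_smul, mul_inv_cancel₀ hμ0.ne', one_smul]
  · rw [hAeq]
    have : K * (μ * S) ^ 2 = (μ ^ 2 * (K * S)) * S := by ring
    rw [this, hμ2, one_mul]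

end GoodG
end Hopf

namespace Hopf
open Filter Topology

namespace Orb
variable {G : E4 → ℝ}

theorem lip (h : GoodG G) : ∃ R : ℝ, 0 < R ∧ ∀ γ, Orb G γ → ∀ s t, ‖γ s - γ t‖ ≤ R * |s - t| := by
  obtain ⟨R, hR, hb⟩ := bound h
  refine ⟨R, hR, fun γ o s t => ?_⟩
  exact convex_univ.norm_image_sub_le_of_norm_hasDerivWithin_le
    (fun x _ => (o.der x).hasDerivWithinAt)
    (fun x _ => by rw [norm_J0]; exact (hb _ (o.one x).le).2) (mem_univ t) (mem_univ s)

theorem second (h : GoodG G) : ∃ C : ℝ, 0 < C ∧ ∀ γ, Orb G γ → ∀ t s,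
    ‖γ (t + s) - γ t - s • J0 (grd G (γ t))‖ ≤ C * s ^ 2 := by
  obtain ⟨R, hR, hb⟩ := lip h
  obtain ⟨L, hL, hl⟩ := h.grad_lip
  refine ⟨L * R, by positivity, fun γ o t s => ?_⟩
  have hd : ∀ x ∈ uIcc 0 s, HasDerivWithinAt (fun r => γ (t + r) - r • J0 (grd G (γ t)))
      (J0 (grd G (γ (t + x))) - J0 (grd G (γ t))) (uIcc 0 s) x := by
    intro x _
    have h1 : HasDerivAt (fun r => γ (t + r)) (J0 (grd G (γ (t + x)))) x :=
      (o.der (t + x)).comp_const_add t x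
    have h2 : HasDerivAt (fun r : ℝ => r • J0 (grd G (γ t))) (J0 (grd G (γ t))) x := by
      simpa using (hasDerivAt_id x).smul_const (J0 (grd G (γ t)))
    exact (h1.sub h2).hasDerivWithinAt
  have hbd : ∀ x ∈ uIcc 0 s, ‖J0 (grd G (γ (t + x))) - J0 (grd G (γ t))‖ ≤ L * R * |s| := by
    intro x hx
    rw [← J0_sub, norm_J0]
    have h1 := hl (γ (t + x)) (γ t)
    have h2 := hb γ o (t + x) t
    have h3 : |t + x - t| ≤ |s| := by
      have := abs_sub_left_of_mem_uIcc hx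
      simpa using this
    calc _ ≤ _ := h1
      _ ≤ L * (R * |s|) := by gcongr; exact h2.trans (by gcongr)
      _ = _ := by ring
  have := (convex_uIcc 0 s).norm_image_sub_le_of_norm_hasDerivWithin_le hd hbd
    left_mem_uIcc right_mem_uIcc
  simp only [add_zero, zero_smul, sub_zero] at this
  rw [show γ (t + s) - γ t - s • J0 (grd G (γ t)) = γ (t + s) - s • J0 (grd G (γ t)) - γ t by abel]
  refine this.trans (le_of_eq ?_)
  rw [Real.norm_eq_abs, mul_assoc, abs_mul_abs_self, sq]

end Orb

/-- Discrete solutions. -/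
structure DSol (G : E4 → ℝ) (K : ℕ) (T : ℝ) (W : ℕ → E4) : Prop where
  closed : W K = W 0
  step : ∀ i < K, W (i + 1) - W i = (T / K) • J0 (grd G ((1 / 2 : ℝ) • (W i + W (i + 1))))
  mean : ∑ i ∈ Finset.range K, G ((1 / 2 : ℝ) • (W i + W (i + 1))) = K

namespace GoodG
variable {G : E4 → ℝ}

theorem taylor (h : GoodG G) {L : ℝ} (hl : ∀ x y, ‖grd G x - grd G y‖ ≤ L * ‖x - y‖) (x y : E4) :
    G x ≤ G y + ⟪grd G y, x - y⟫_ℝ + L * ‖x - y‖ ^ 2 := by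
  have h1 := h.subgrad y x
  have h2 := real_inner_le_norm (grd G x - grd G y) (x - y)
  have h3 := mul_le_mul_of_nonneg_right (hl x y) (norm_nonneg (x - y))
  rw [inner_sub_left] at h2
  have h4 : ⟪grd G x, y - x⟫_ℝ = -⟪grd G x, x - y⟫_ℝ := by rw [← inner_neg_right, neg_sub]
  nlinarith

theorem inner_grd_J0 (z : E4) : ⟪grd G z, J0 (grd G z)⟫_ℝ = 0 := by
  have h1 := inner_J0_left (grd G z) (grd G z)
  rw [real_inner_comm] at h1
  linarith

theorem dsol_close (h : GoodG G) (R b : ℝ) (hR : 0 < R) (hb : 0 < b) : ∃ C : ℝ, 0 < C ∧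
    ∀ (K : ℕ) (T : ℝ) (W : ℕ → E4), 0 < K → 0 < T → T ≤ b → DSol G K T W →
      (∀ i ≤ K, ‖W i‖ ≤ R) → |G (W 0) - 1| ≤ C / K ∧
      ∀ γ, Orb G γ → ‖W K - γ T‖ ≤ C * (‖W 0 - γ 0‖ + 1 / K) := by
  obtain ⟨L, hL, hl⟩ := h.grad_lip
  obtain ⟨C2, hC2, hs2⟩ := Orb.second h
  set D := L ^ 3 * R ^ 2 with hD
  have hD0 : 0 < D := by positivity
  set F := L * L * R + C2 with hF
  have hF0 : 0 < F := by positivity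
  refine ⟨2 * D * b ^ 2 + Real.exp (L * b) * (1 + F * b ^ 2), by positivity, ?_⟩
  intro K T W hK hT hTb hW hWR
  have hK' : (0 : ℝ) < K := by exact_mod_cast hK
  set τ := T / K with hτ
  have hτ0 : 0 < τ := by positivity
  have hKτ : K * τ = T := by rw [hτ]; field_simp
  have hmid : ∀ i < K, ‖(1 / 2 : ℝ) • (W i + W (i + 1))‖ ≤ R := by
    intro i hi
    rw [norm_smul, Real.norm_of_nonneg (by norm_num)]
    have h1 := norm_add_le (W i) (W (i + 1))
    have h2 := hWR i hi.le
    have h3 := hWR (i + 1) hi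
    linarith
  have hgr : ∀ i < K, ‖grd G ((1 / 2 : ℝ) • (W i + W (i + 1)))‖ ≤ L * R := by
    intro i hi
    have := hl ((1 / 2 : ℝ) • (W i + W (i + 1))) 0
    rw [h.grad_zero, sub_zero, sub_zero] at this
    exact this.trans (mul_le_mul_of_nonneg_left (hmid i hi) hL.le)
  have hΔ : ∀ i < K, ‖W (i + 1) - W i‖ ≤ τ * (L * R) := by
    intro i hi
    rw [hW.step i hi, norm_smul, norm_J0, Real.norm_of_nonneg hτ0.le]
    exact mul_le_mul_of_nonneg_left (hgr i hi) hτ0.le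
  have hen : ∀ i < K, G ((1 / 2 : ℝ) • (W i + W (i + 1))) ≤ G (W i) ∧
      G (W i) ≤ G ((1 / 2 : ℝ) • (W i + W (i + 1))) + D * τ ^ 2 ∧
      G ((1 / 2 : ℝ) • (W i + W (i + 1))) ≤ G (W (i + 1)) ∧
      G (W (i + 1)) ≤ G ((1 / 2 : ℝ) • (W i + W (i + 1))) + D * τ ^ 2 := by
    intro i hi
    set w := (1 / 2 : ℝ) • (W i + W (i + 1)) with hw
    have e1 : W i - w = (-(1 / 2 : ℝ)) • (W (i + 1) - W i) := by
      rw [hw]; module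
    have e2 : W (i + 1) - w = (1 / 2 : ℝ) • (W (i + 1) - W i) := by
      rw [hw]; module
    have hst := hW.step i hi
    rw [← hw] at hst
    have z : ⟪grd G w, W (i + 1) - W i⟫_ℝ = 0 := by
      rw [hst, real_inner_smul_right, inner_grd_J0, mul_zero]
    have n1 : L * ‖W i - w‖ ^ 2 ≤ D * τ ^ 2 := by
      rw [e1, norm_smul]
      have := hΔ i hi
      have h2 : ‖(-(1 / 2) : ℝ)‖ = 1 / 2 := by rw [norm_neg]; norm_num
      rw [h2]
      have h3 : (1 / 2 * ‖W (i + 1) - W i‖) ^ 2 ≤ (τ * (L * R)) ^ 2 := by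
        refine pow_le_pow_left₀ (by positivity) ?_ 2
        linarith [norm_nonneg (W (i + 1) - W i)]
      rw [hD]; nlinarith
    have n2 : L * ‖W (i + 1) - w‖ ^ 2 ≤ D * τ ^ 2 := by
      rw [e2, norm_smul]
      rw [e1, norm_smul, norm_neg] at n1
      exact n1
    have t1 := h.taylor hl (W i) w
    have t2 := h.taylor hl (W (i + 1)) w
    have s1 := h.subgrad (W i) w
    have s2 := h.subgrad (W (i + 1)) w
    rw [e1, real_inner_smul_right, z, mul_zero] at s1 
    rw [e2, real_inner_smul_right, z, mul_zero] at s2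
    have z1 : ⟪grd G w, W i - w⟫_ℝ = 0 := by rw [e1, real_inner_smul_right, z, mul_zero]
    have z2 : ⟪grd G w, W (i + 1) - w⟫_ℝ = 0 := by rw [e2, real_inner_smul_right, z, mul_zero]
    refine ⟨by linarith, by linarith, by linarith, by linarith⟩
  have hG0 : ∀ i ≤ K, |G (W i) - G (W 0)| ≤ i * (D * τ ^ 2) := by
    intro i
    induction i with
    | zero => intro _; simp
    | succ i ih =>
      intro hi
      have h1 := ih (by omega)
      obtain ⟨a1, a2, a3, a4⟩ := hen i (by omega)
      push_cast
      rw [abs_le] at h1 ⊢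
      constructor <;> linarith
  have hbase : (K : ℝ) * (D * τ ^ 2) ≤ D * b ^ 2 / K := by
    have : (K : ℝ) * (D * τ ^ 2) = D * T ^ 2 / K := by rw [hτ]; field_simp
    rw [this]; gcongr
  have hnn : 0 ≤ Real.exp (L * b) * (1 + F * b ^ 2) := by positivity
  constructor
  · have h1 : ∀ i ∈ Finset.range K, |G ((1 / 2 : ℝ) • (W i + W (i + 1))) - G (W 0)| ≤
        2 * (D * b ^ 2 / K) := by
      intro i hi
      have hi := Finset.mem_range.1 hi
      obtain ⟨a1, a2, a3, a4⟩ := hen i hi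
      have h2 := hG0 i hi.le
      have h3 : (i : ℝ) * (D * τ ^ 2) ≤ K * (D * τ ^ 2) := by gcongr
      have h4 : D * τ ^ 2 ≤ K * (D * τ ^ 2) :=
        le_mul_of_one_le_left (by positivity) (by exact_mod_cast hK)
      rw [abs_le] at h2 ⊢
      constructor <;> linarith
    have h2 := (Finset.abs_sum_le_sum_abs _ _).trans (Finset.sum_le_sum h1)
    rw [Finset.sum_sub_distrib, hW.mean, Finset.sum_const, Finset.sum_const, Finset.card_range,
      nsmul_eq_mul, nsmul_eq_mul] at h2
    have h3 : (K : ℝ) - K * G (W 0) = K * (1 - G (W 0)) := by ring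
    rw [h3, abs_mul, abs_of_pos hK'] at h2
    have h4 := le_of_mul_le_mul_left h2 hK'
    rw [abs_sub_comm]
    refine h4.trans ?_
    rw [mul_div_assoc', div_le_div_iff_of_pos_right hK']
    linarith
  · intro γ o
    have hrec : ∀ i < K, ‖W (i + 1) - γ ((i + 1 : ℕ) * τ)‖ ≤
        (1 + L * τ) * ‖W i - γ (i * τ)‖ + F * τ ^ 2 := by
      intro i hi
      set w := (1 / 2 : ℝ) • (W i + W (i + 1)) with hw
      have hst := hW.step i hi
      rw [← hw] at hst
      have h2 := hs2 γ o (i * τ) τ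
      have ht : ((i + 1 : ℕ) : ℝ) * τ = i * τ + τ := by push_cast; ring
      rw [ht]
      have e : W (i + 1) - γ (i * τ + τ) = (W i - γ (i * τ))
          + τ • J0 (grd G w - grd G (γ (i * τ)))
          - (γ (i * τ + τ) - γ (i * τ) - τ • J0 (grd G (γ (i * τ)))) := by
        rw [J0_sub, smul_sub, ← hst]; abel
      have h3 : ‖τ • J0 (grd G w - grd G (γ (i * τ)))‖ ≤
          τ * (L * (τ * (L * R) + ‖W i - γ (i * τ)‖)) := by
        rw [norm_smul, norm_J0, Real.norm_of_nonneg hτ0.le]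
        refine mul_le_mul_of_nonneg_left ((hl _ _).trans ?_) hτ0.le
        refine mul_le_mul_of_nonneg_left ?_ hL.le
        have e3 : w - γ (i * τ) = (1 / 2 : ℝ) • (W (i + 1) - W i) + (W i - γ (i * τ)) := by
          rw [hw]; module
        rw [e3]
        refine (norm_add_le _ _).trans (add_le_add_left ?_ _)
        rw [norm_smul, Real.norm_of_nonneg (by norm_num)]
        have := hΔ i hi
        nlinarith [norm_nonneg (W (i + 1) - W i)]
      rw [e]
      refine (norm_sub_le _ _).trans ?_
      have := norm_add_le (W i - γ (i * τ)) (τ • J0 (grd G w - grd G (γ (i * τ))))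
      rw [hF]
      nlinarith
    have hall : ∀ i ≤ K, ‖W i - γ (i * τ)‖ ≤ (1 + L * τ) ^ i * (‖W 0 - γ 0‖ + i * (F * τ ^ 2)) := by
      intro i
      induction i with
      | zero => intro _; simp
      | succ i ih =>
        intro hi
        have h1 := ih (by omega)
        have h2 := hrec i (by omega)
        have h3 : (1 : ℝ) ≤ (1 + L * τ) ^ (i + 1) := one_le_pow₀ (by nlinarith)
        have h4 : 0 ≤ F * τ ^ 2 := by positivity
        have h5 : (1 + L * τ) * ‖W i - γ (i * τ)‖ ≤
            (1 + L * τ) * ((1 + L * τ) ^ i * (‖W 0 - γ 0‖ + i * (F * τ ^ 2))) :=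
          mul_le_mul_of_nonneg_left h1 (by positivity)
        calc _ ≤ _ := h2
          _ ≤ (1 + L * τ) * ((1 + L * τ) ^ i * (‖W 0 - γ 0‖ + i * (F * τ ^ 2)))
              + (1 + L * τ) ^ (i + 1) * (F * τ ^ 2) := by nlinarith
          _ = _ := by push_cast; ring
    have h1 := hall K le_rfl
    rw [hKτ] at h1
    have h2 : (1 + L * τ) ^ K ≤ Real.exp (L * b) := by
      calc (1 + L * τ) ^ K ≤ (Real.exp (L * τ)) ^ K := by
            gcongr
            linarith [Real.add_one_le_exp (L * τ)]
        _ = Real.exp (L * T) := by rw [← Real.exp_nat_mul, ← hKτ]; ring_nf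
        _ ≤ _ := Real.exp_le_exp.2 (by gcongr)
    have h3 : (K : ℝ) * (F * τ ^ 2) ≤ F * b ^ 2 * (1 / K) := by
      have : (K : ℝ) * (F * τ ^ 2) = F * T ^ 2 * (1 / K) := by rw [hτ]; field_simp
      rw [this]; gcongr
    calc _ ≤ _ := h1
      _ ≤ Real.exp (L * b) * (‖W 0 - γ 0‖ + F * b ^ 2 * (1 / K)) := by gcongr
      _ ≤ (Real.exp (L * b) * (1 + F * b ^ 2)) * (‖W 0 - γ 0‖ + 1 / K) := by
        rw [mul_assoc (Real.exp (L * b)) (1 + F * b ^ 2)]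
        refine mul_le_mul_of_nonneg_left ?_ (Real.exp_pos _).le
        have a1 : 0 ≤ F * b ^ 2 := by positivity
        have a2 : (0 : ℝ) ≤ 1 / K := by positivity
        nlinarith [norm_nonneg (W 0 - γ 0)]
      _ ≤ _ := by
        refine mul_le_mul_of_nonneg_right ?_ (by positivity)
        have : 0 ≤ 2 * D * b ^ 2 := by positivity
        linarith

/-- The square loop. -/
theorem square_loop (h : GoodG G) : ∃ a : ℝ, 0 < a ∧ ∀ m : ℕ, 0 < m →
    ∃ l : List E4, l.length = 4 * m ∧ l.sum = 0 ∧ PA l = 1 ∧ (4 * m : ℕ) * PE G l ≤ a := by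
  obtain ⟨c, C, hc, hC, hb⟩ := h.qq_bounds
  refine ⟨16 * C, by positivity, fun m hm => ?_⟩
  have hm' : (0 : ℝ) < m := by exact_mod_cast hm
  obtain ⟨e, he⟩ : ∃ e : E4, ‖e‖ = 1 := ⟨EuclideanSpace.single 0 1, by simp⟩
  let r : E4 → List E4 := List.replicate m
  set a := (1 / m : ℝ) • e with ha
  set b := (1 / m : ℝ) • J0 e with hbb
  have sr : ∀ x, (List.replicate m x).sum = (m : ℝ) • (x : E4) := fun x => by
    rw [List.sum_replicate, Nat.cast_smul_eq_nsmul ℝ]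
  have na : ‖a‖ = 1 / m := by rw [ha, norm_smul, he, Real.norm_of_nonneg (by positivity), mul_one]
  have nb : ‖b‖ = 1 / m := by
    rw [hbb, norm_smul, norm_J0, he, Real.norm_of_nonneg (by positivity), mul_one]
  refine ⟨r a ++ (r b ++ (r (-a) ++ r (-b))), ?_, ?_, ?_, ?_⟩
  · simp [r]; ring
  · simp only [r, List.sum_append, sr]; module
  · have hab : omega0 a b = (1 / m) ^ 2 := by
      rw [ha, hbb, om_smul_left, om_smul_right, om_J0_right, real_inner_self_eq_norm_sq, he]; ring
    have hba : omega0 b a = -(1 / m) ^ 2 := by rw [om_antisymm, hab]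
    simp only [r, PA_append, PA_replicate, List.sum_append, sr, om_smul_left, om_smul_right,
      om_add_right, om_neg_left, om_neg_right, om_self, hab, hba]
    field_simp
    ring
  · simp only [r, PE_append, PE_replicate]
    have q1 : ∀ x : E4, ‖x‖ = 1 / m → qq G x ≤ C * (1 / m) ^ 2 := fun x hx => by
      have := (hb x).2
      rwa [hx] at this
    have h1 := q1 a na
    have h2 := q1 b nb
    have h3 := q1 (-a) (by rw [norm_neg, na])
    have h4 := q1 (-b) (by rw [norm_neg, nb])
    have h5 : ((4 * m : ℕ) : ℝ) * (m * qq G a + (m * qq G b + (m * qq G (-a) + m * qq G (-b))))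
        ≤ (4 * m) * (4 * m * (C * (1 / m) ^ 2)) := by
      push_cast
      refine mul_le_mul_of_nonneg_left ?_ (by positivity)
      nlinarith
    refine h5.trans (le_of_eq ?_)
    field_simp
    ring

/-- Discrete solutions with maximality. -/
theorem exists_dsol (h : GoodG G) : ∃ a b D : ℝ, 0 < a ∧ 0 < b ∧ 0 < D ∧ ∀ m : ℕ, 0 < m →
    ∃ (T : ℝ) (W : ℕ → E4), a ≤ T ∧ T ≤ b ∧ DSol G (4 * m) T W ∧ (∀ i ≤ 4 * m, ‖W i‖ ≤ D) ∧
      ∀ l : List E4, l.length = 4 * m → l.sum = 0 → PA l ≤ (1 / T) * ((4 * m : ℕ) * PE G l) := by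
  obtain ⟨b, hb, hsq⟩ := h.square_loop
  obtain ⟨c, hc, hcs⟩ := h.sum_norm_sq_le
  obtain ⟨R, hR, hRb⟩ := Orb.bound h
  refine ⟨2 / c, b, R + 2 * (b * (1 + c)), by positivity, hb, by positivity, fun m hm => ?_⟩
  have hK : 0 < 4 * m := by omega
  set K := 4 * m with hKdef
  have hK' : (0 : ℝ) < K := by exact_mod_cast hK
  obtain ⟨v, hvF, hv, hv0⟩ := h.exists_maximizer hK
  obtain ⟨l, hl1, hl2, hl3, hl4⟩ := hsq m hm
  have h1 := h.maximizer_list hK hv l hl1 hl2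
  rw [hl3] at h1
  set α := fA K v with hα
  have hα1 : 1 ≤ α * b := h1.trans (mul_le_mul_of_nonneg_left hl4 hv0)
  have hα0 : 0 < α := by
    rcases hv0.eq_or_lt with h0 | h0
    · rw [← h0] at hα1; norm_num at hα1
    · exact h0
  have hsum := hcs K v
  have hsum2 : (∑ i ∈ Finset.range K, ‖v i‖) ^ 2 ≤ c :=
    hsum.trans (by have := hvF.2.2; nlinarith)
  have hα2 : α ≤ c / 2 := by
    have := (le_abs_self _).trans (abs_fA_le K v)
    rw [← hα] at this
    linarith
  obtain ⟨ctr, hc1, hc2⟩ := h.euler_lagrange hK hvF hv hα0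
  rw [← hα] at hc1 hc2
  have hai : 0 < α⁻¹ := inv_pos.2 hα0
  have hainv : α⁻¹ ≤ b := by rw [inv_le_iff_one_le_mul₀ hα0]; linarith
  let W : ℕ → E4 := fun i => α⁻¹ • (∑ j ∈ Finset.range i, v j - ctr)
  have hd : ∀ i, W (i + 1) - W i = α⁻¹ • v i := by
    intro i; simp only [W, Finset.sum_range_succ]; module
  have hmid : ∀ i, (1 / 2 : ℝ) • (W i + W (i + 1)) = α⁻¹ • (xm v i - ctr) := by
    intro i; simp only [W, Finset.sum_range_succ, xm]; module
  have hmean : ∑ i ∈ Finset.range K, G ((1 / 2 : ℝ) • (W i + W (i + 1))) = K := by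
    simp only [hmid, h.hom _ hai.le]
    rw [← Finset.mul_sum, hc2]; field_simp
  have hsolve : DSol G K α⁻¹ W := by
    refine ⟨?_, fun i hi => ?_, hmean⟩
    · simp [W, hvF.2.1]
    · rw [hd, hmid, h.grad_smul hai.le, J0_smul, hc1 i hi, smul_smul, smul_smul]
      congr 1
      field_simp
  refine ⟨α⁻¹, W, ?_, hainv, hsolve, ?_, ?_⟩
  · rw [le_inv_comm₀ (by positivity) hα0, inv_div]; exact hα2
  · obtain ⟨i0, hi0, hle⟩ : ∃ i ∈ Finset.range K, G ((1 / 2 : ℝ) • (W i + W (i + 1))) ≤ 1 := by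
      refine Finset.exists_le_of_sum_le ⟨0, Finset.mem_range.2 hK⟩ ?_
      rw [hmean]; simp
    have hn := (hRb _ hle).1
    have hsum3 : ∑ i ∈ Finset.range K, ‖v i‖ ≤ 1 + c := by
      nlinarith [Finset.sum_nonneg (s := Finset.range K) (f := fun i => ‖v i‖)
        fun i _ => norm_nonneg _]
    have hps : ∀ i ≤ K, ‖∑ j ∈ Finset.range i, v j‖ ≤ 1 + c := fun i hi =>
      ((norm_sum_le _ _).trans (Finset.sum_le_sum_of_subset_of_nonneg
        (Finset.range_subset_range.2 hi) fun _ _ _ => norm_nonneg _)).trans hsum3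
    intro i hi
    have hi0' := Finset.mem_range.1 hi0
    have e : W i = (1 / 2 : ℝ) • (W i0 + W (i0 + 1)) + α⁻¹ • (∑ j ∈ Finset.range i, v j
        - (1 / 2 : ℝ) • (∑ j ∈ Finset.range i0, v j + ∑ j ∈ Finset.range (i0 + 1), v j)) := by
      simp only [W]; module
    have h2 : ‖(1 / 2 : ℝ) • (∑ j ∈ Finset.range i0, v j + ∑ j ∈ Finset.range (i0 + 1), v j)‖
        ≤ 1 + c := by
      rw [norm_smul, Real.norm_of_nonneg (by norm_num)]
      have a1 := norm_add_le (∑ j ∈ Finset.range i0, v j) (∑ j ∈ Finset.range (i0 + 1), v j)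
      have a2 := hps i0 hi0'.le
      have a3 := hps (i0 + 1) hi0'
      linarith
    rw [e]
    refine (norm_add_le _ _).trans (add_le_add hn ?_)
    rw [norm_smul, Real.norm_of_nonneg hai.le]
    have h3 := norm_sub_le (∑ j ∈ Finset.range i, v j)
      ((1 / 2 : ℝ) • (∑ j ∈ Finset.range i0, v j + ∑ j ∈ Finset.range (i0 + 1), v j))
    have h4 := hps i hi
    calc _ ≤ α⁻¹ * (2 * (1 + c)) := mul_le_mul_of_nonneg_left (by linarith) hai.le
      _ ≤ b * (2 * (1 + c)) := mul_le_mul_of_nonneg_right hainv (by positivity)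
      _ = _ := by ring
  · intro l hl hs
    rw [one_div, inv_inv]
    exact h.maximizer_list hK hv l hl hs

end GoodG

/-- The isoperimetric property of the minimal period `T`. -/
def Poly (G : E4 → ℝ) (T : ℝ) : Prop :=
  ∀ ε : ℝ, 0 < ε → ∀ᶠ m : ℕ in atTop, ∀ l : List E4, l.length = 4 * m → l.sum = 0 →
    PA l ≤ (1 / T + ε) * ((4 * m : ℕ) * PE G l)

theorem exists_subseq_min {T : ℕ → ℝ} {a b : ℝ} (h : ∀ n, a ≤ T n ∧ T n ≤ b) :
    ∃ (T0 : ℝ) (φ : ℕ → ℕ), StrictMono φ ∧ Tendsto (T ∘ φ) atTop (𝓝 T0) ∧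
      ∀ s < T0, ∀ᶠ n in atTop, s < T n := by
  have hbd : IsBoundedUnder (· ≥ ·) atTop T := isBoundedUnder_of ⟨a, fun n => (h n).1⟩
  have hbd' : IsBoundedUnder (· ≤ ·) atTop T := isBoundedUnder_of ⟨b, fun n => (h n).2⟩
  have hco : IsCoboundedUnder (· ≥ ·) atTop T := hbd'.isCoboundedUnder_ge
  set T0 := liminf T atTop with hT0
  have h1 : ∀ s < T0, ∀ᶠ n in atTop, s < T n := fun s hs => eventually_lt_of_lt_liminf hs hbd
  have h2 : ∀ n : ℕ, ∃ᶠ k in atTop, T k < T0 + 1 / ((n : ℝ) + 1) := fun n =>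
    frequently_lt_of_liminf_lt hco (by
      have : (0 : ℝ) < 1 / ((n : ℝ) + 1) := by positivity
      linarith)
  obtain ⟨φ, hφ, hφ'⟩ := extraction_forall_of_frequently h2
  refine ⟨T0, φ, hφ, ?_, h1⟩
  rw [tendsto_order]
  refine ⟨fun s hs => hφ.tendsto_atTop.eventually (h1 s hs), fun s hs => ?_⟩
  have h3 : Tendsto (fun n : ℕ => T0 + 1 / ((n : ℝ) + 1)) atTop (𝓝 (T0 + 0)) :=
    tendsto_const_nhds.add tendsto_one_div_add_atTop_nhds_zero_nat
  rw [add_zero] at h3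
  filter_upwards [h3.eventually_lt_const hs] with n hn using (hφ' n).trans hn

theorem GoodG.exists_min_orbit {G : E4 → ℝ} (h : GoodG G) :
    ∃ (γ : ℝ → E4) (T : ℝ), 0 < T ∧ Orb G γ ∧ γ T = γ 0 ∧ Poly G T := by
  obtain ⟨a, b, D, ha, hb, hD, hm⟩ := h.exists_dsol
  have hm' : ∀ n : ℕ, 0 < n + 1 := fun n => Nat.succ_pos n
  choose T W hTa hTb hds hWb hmax using fun n : ℕ => hm (n + 1) (hm' n)
  obtain ⟨T0, φ, hφ, hTφ, hTev⟩ := exists_subseq_min (T := T) fun n => ⟨hTa n, hTb n⟩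
  have hT0 : 0 < T0 := ha.trans_le (ge_of_tendsto' hTφ fun n => hTa _)
  obtain ⟨x0, -, ψ, hψ, hx0⟩ := (isCompact_closedBall (0 : E4) D).tendsto_subseq
    (x := fun n => W (φ n) 0) (fun n => by
      rw [mem_closedBall, dist_zero_right]; exact hWb _ 0 (Nat.zero_le _))
  obtain ⟨C, hC, hclose⟩ := h.dsol_close D b hD hb
  set χ : ℕ → ℕ := φ ∘ ψ with hχ
  have hχm : StrictMono χ := hφ.comp hψ
  have hKpos : ∀ n : ℕ, 0 < 4 * (χ n + 1) := fun n => by omega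
  have hK : Tendsto (fun n : ℕ => (1 : ℝ) / ((4 * (χ n + 1) : ℕ) : ℝ)) atTop (𝓝 0) := by
    refine (tendsto_const_div_atTop_nhds_zero_nat 1).comp ?_
    refine tendsto_atTop_mono (fun n => ?_) hχm.tendsto_atTop
    change χ n ≤ 4 * (χ n + 1)
    omega
  have hcl := fun n => hclose (4 * (χ n + 1)) (T (χ n)) (W (χ n)) (hKpos n)
    (ha.trans_le (hTa _)) (hTb _) (hds _) (hWb _)
  have hG1 : G x0 = 1 := by
    have h1 : Tendsto (fun n => |G (W (χ n) 0) - 1|) atTop (𝓝 |G x0 - 1|) :=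
      (((h.cont.tendsto x0).comp hx0).sub_const 1).abs
    have h2 : |G x0 - 1| ≤ 0 := by
      refine le_of_tendsto_of_tendsto' h1 ?_ fun n => (hcl n).1
      have := hK.const_mul C
      simpa only [mul_one_div, mul_zero] using this
    have := abs_nonpos_iff.1 h2
    linarith
  obtain ⟨γ, hγ0, o⟩ := h.exists_orb hG1
  refine ⟨γ, T0, hT0, o, ?_, ?_⟩
  · have hTχ : Tendsto (fun n => T (χ n)) atTop (𝓝 T0) := hTφ.comp hψ.tendsto_atTop
    have h1 : Tendsto (fun n => ‖W (χ n) 0 - γ (T (χ n))‖) atTop (𝓝 ‖x0 - γ T0‖) :=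
      (hx0.sub ((o.cont.tendsto T0).comp hTχ)).norm
    have h2 : Tendsto (fun n => C * (‖W (χ n) 0 - γ 0‖ + 1 / ((4 * (χ n + 1) : ℕ) : ℝ))) atTop
        (𝓝 (C * (‖x0 - γ 0‖ + 0))) :=
      ((hx0.sub_const (γ 0)).norm.add hK).const_mul C
    have h3 := le_of_tendsto_of_tendsto' h1 h2 fun n => by
      have := (hcl n).2 γ o
      rwa [(hds (χ n)).closed] at this
    rw [hγ0, sub_self, norm_zero, add_zero, mul_zero] at h3
    rw [hγ0]
    exact (sub_eq_zero.1 (norm_le_zero_iff.1 h3)).symm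
  · intro ε hε
    have hlt : (1 / T0 + ε)⁻¹ < T0 := by
      rw [inv_lt_comm₀ (by positivity) hT0]
      rw [one_div]; linarith
    have hev := hTev _ hlt
    obtain ⟨N, hN⟩ := eventually_atTop.1 hev
    filter_upwards [eventually_ge_atTop (N + 1)] with m hm
    obtain ⟨n, rfl⟩ : ∃ n, m = n + 1 := ⟨m - 1, by omega⟩
    · intro l hl hs
      have hn := hN n (by omega)
      refine (hmax n l hl hs).trans ?_
      refine mul_le_mul_of_nonneg_right ?_ ?_
      · rw [inv_lt_comm₀ (by positivity) (ha.trans_le (hTa n))] at hn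
        rw [one_div]; exact hn.le
      · refine mul_nonneg (Nat.cast_nonneg _) ?_
        exact List.sum_nonneg (by
          intro x hx
          obtain ⟨y, _, rfl⟩ := List.mem_map.1 hx
          exact h.qq_nonneg y)

end Hopf

namespace Hopf
open Filter Topology

/-- A piece of a loop: total displacement `s`, area `A`, duration `d` and energy `e`. -/
def Piece (G : E4 → ℝ) (s : E4) (A d e : ℝ) : Prop :=
  0 < d ∧ ∃ L : ℕ → List E4, (∀ k, 0 < k → (L k).length = k ∧ (L k).sum = s) ∧
    Tendsto (fun k => PA (L k)) atTop (𝓝 A) ∧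
    ∀ ε : ℝ, 0 < ε → ∀ᶠ k : ℕ in atTop, (k : ℝ) * PE G (L k) ≤ d * e + ε

theorem PE_nonneg {G : E4 → ℝ} (h : GoodG G) (l : List E4) : 0 ≤ PE G l :=
  List.sum_nonneg (by
    intro x hx
    obtain ⟨y, _, rfl⟩ := List.mem_map.1 hx
    exact h.qq_nonneg y)

theorem Piece.append {G : E4 → ℝ} {s s' : E4} {A A' d d' e e' : ℝ}
    (p : Piece G s A d e) (p' : Piece G s' A' d' e') :
    Piece G (s + s') (A + A' + (1 / 2) * omega0 s s') (d + d') (e + e') := by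
  obtain ⟨hd, L, hL, hA, hE⟩ := p
  obtain ⟨hd', L', hL', hA', hE'⟩ := p'
  refine ⟨by positivity, ?_⟩
  set q : ℝ := d / (d + d') with hq
  have hq0 : 0 < q := by positivity
  have hq1 : q < 1 := by rw [hq, div_lt_one (by positivity)]; linarith
  set a : ℕ → ℕ := fun k => ⌊q * k⌋₊ with ha
  have hak : ∀ k, 0 < k → a k < k := by
    intro k hk
    have hk' : (0 : ℝ) < k := by exact_mod_cast hk
    rw [ha]
    refine (Nat.floor_lt (by positivity)).2 ?_
    nlinarith
  have t1 : Tendsto (fun k : ℕ => (a k : ℝ) / k) atTop (𝓝 q) :=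
    (tendsto_nat_floor_mul_div_atTop hq0.le).comp tendsto_natCast_atTop_atTop
  have t2 : Tendsto (fun k : ℕ => ((k - a k : ℕ) : ℝ) / k) atTop (𝓝 (1 - q)) := by
    have := t1.const_sub 1
    refine this.congr' ?_
    filter_upwards [eventually_gt_atTop 0] with k hk
    have hk' : (0 : ℝ) < k := by exact_mod_cast hk
    rw [Nat.cast_sub (hak k hk).le, sub_div, div_self hk'.ne']
  have i1 : Tendsto a atTop atTop := by
    have : Tendsto (fun k : ℕ => (a k : ℝ)) atTop atTop := by
      have := t1.pos_mul_atTop hq0 tendsto_natCast_atTop_atTop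
      refine this.congr' ?_
      filter_upwards [eventually_gt_atTop 0] with k hk
      have hk' : (0 : ℝ) < k := by exact_mod_cast hk
      field_simp
    exact tendsto_natCast_atTop_iff.1 this
  have i2 : Tendsto (fun k => k - a k) atTop atTop := by
    have : Tendsto (fun k : ℕ => ((k - a k : ℕ) : ℝ)) atTop atTop := by
      have := t2.pos_mul_atTop (by linarith) tendsto_natCast_atTop_atTop
      refine this.congr' ?_
      filter_upwards [eventually_gt_atTop 0] with k hk
      have hk' : (0 : ℝ) < k := by exact_mod_cast hk
      field_simp
    exact tendsto_natCast_atTop_iff.1 this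
  have good : ∀ᶠ k in atTop, 0 < k ∧ 0 < a k ∧ 0 < k - a k :=
    (eventually_gt_atTop 0).and ((i1.eventually_gt_atTop 0).and (i2.eventually_gt_atTop 0))
  classical
  refine ⟨fun k => if 0 < k ∧ 0 < a k ∧ 0 < k - a k then L (a k) ++ L' (k - a k)
    else (s + s') :: List.replicate (k - 1) 0, ?_, ?_, ?_⟩
  · intro k hk
    beta_reduce
    split_ifs with hg
    · obtain ⟨h1, h2, h3⟩ := hg
      rw [List.length_append, List.sum_append, (hL _ h2).1, (hL _ h2).2, (hL' _ h3).1,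
        (hL' _ h3).2]
      exact ⟨by omega, rfl⟩
    · constructor
      · simp; omega
      · simp
  · have := ((hA.comp i1).add (hA'.comp i2)).add_const ((1 / 2) * omega0 s s')
    refine this.congr' ?_
    filter_upwards [good] with k hk
    rw [if_pos hk, PA_append, (hL _ hk.2.1).2, (hL' _ hk.2.2).2]
    rfl
  · intro ε hε
    have r1 : Tendsto (fun k : ℕ => (k : ℝ) / a k) atTop (𝓝 q⁻¹) := by
      refine (t1.inv₀ hq0.ne').congr fun k => ?_
      rw [inv_div]
    have r2 : Tendsto (fun k : ℕ => (k : ℝ) / (k - a k : ℕ)) atTop (𝓝 (1 - q)⁻¹) := by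
      refine (t2.inv₀ (by linarith : (1 - q) ≠ 0)).congr fun k => ?_
      rw [inv_div]
    obtain ⟨η, hη, hηε⟩ : ∃ η : ℝ, 0 < η ∧ q⁻¹ * η + (1 - q)⁻¹ * η < ε / 2 := by
      have hp : 0 < q⁻¹ + (1 - q)⁻¹ := by
        have : 0 < 1 - q := by linarith
        positivity
      refine ⟨ε / 4 / (q⁻¹ + (1 - q)⁻¹), by positivity, ?_⟩
      rw [← add_mul, mul_div_cancel₀ _ hp.ne']; linarith
    have lim : Tendsto (fun k : ℕ => (k : ℝ) / a k * (d * e + η)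
        + (k : ℝ) / (k - a k : ℕ) * (d' * e' + η)) atTop
        (𝓝 (q⁻¹ * (d * e + η) + (1 - q)⁻¹ * (d' * e' + η))) :=
      (r1.mul_const _).add (r2.mul_const _)
    have hval : q⁻¹ * (d * e + η) + (1 - q)⁻¹ * (d' * e' + η) < (d + d') * (e + e') + ε := by
      have e1 : q⁻¹ = (d + d') / d := by rw [hq, inv_div]
      have e2 : (1 - q)⁻¹ = (d + d') / d' := by
        rw [hq, one_sub_div (by positivity), add_sub_cancel_left, inv_div]
      have e3 : q⁻¹ * (d * e) = (d + d') * e := by rw [e1]; field_simp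
      have e4 : (1 - q)⁻¹ * (d' * e') = (d + d') * e' := by rw [e2]; field_simp
      rw [mul_add, mul_add, e3, e4]; linarith
    filter_upwards [good, lim.eventually_lt_const hval, i1.eventually (hE η hη),
      i2.eventually (hE' η hη)] with k hk hlt h1 h2
    rw [if_pos hk, PE_append, mul_add]
    obtain ⟨h3, h4, h5⟩ := hk
    have h4' : (0 : ℝ) < a k := by exact_mod_cast h4
    have h5' : (0 : ℝ) < (k - a k : ℕ) := by exact_mod_cast h5
    have j1 := mul_le_mul_of_nonneg_left h1 (by positivity : (0 : ℝ) ≤ (k : ℝ) / a k)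
    have j2 := mul_le_mul_of_nonneg_left h2 (by positivity : (0 : ℝ) ≤ (k : ℝ) / (k - a k : ℕ))
    rw [← mul_assoc, div_mul_cancel₀ _ h4'.ne'] at j1
    rw [← mul_assoc, div_mul_cancel₀ _ h5'.ne'] at j2
    linarith

theorem Piece.straight {G : E4 → ℝ} (h : GoodG G) (s : E4) {d : ℝ} (hd : 0 < d) :
    Piece G s 0 d (qq G s / d) := by
  refine ⟨hd, fun k => List.replicate k ((1 / k : ℝ) • s), ?_, ?_, ?_⟩
  · intro k hk
    have hk' : (k : ℝ) ≠ 0 := by exact_mod_cast hk.ne'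
    refine ⟨List.length_replicate, ?_⟩
    rw [List.sum_replicate, ← Nat.cast_smul_eq_nsmul ℝ, smul_smul, mul_one_div_cancel hk', one_smul]
  · simp only [PA_replicate]; exact tendsto_const_nhds
  · intro ε hε
    filter_upwards [eventually_gt_atTop 0] with k hk
    have hk' : (0 : ℝ) < k := by exact_mod_cast hk
    rw [PE_replicate, h.qq_smul (by positivity), mul_div_cancel₀ _ hd.ne']
    have : (k : ℝ) * (k * ((1 / (k : ℝ)) ^ 2 * qq G s)) = qq G s := by field_simp
    linarith

theorem Orb.qq_le {G : E4 → ℝ} (h : GoodG G) {γ : ℝ → E4} (o : Orb G γ) (t : ℝ) {s : ℝ}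
    (hs : 0 < s) : Gs G (-J0 (γ (t + s) - γ t)) ≤ s ^ 2 := by
  refine h.Gs_le fun x => ?_
  have hd : ∀ r, HasDerivAt (fun r => ⟪-J0 (γ r), x⟫_ℝ) ⟪grd G (γ r), x⟫_ℝ r := by
    intro r
    have h1 : HasDerivAt (fun r => -J0 (γ r)) (grd G (γ r)) r := by
      have := ((Jl.hasFDerivAt).comp_hasDerivAt r (o.der r)).neg
      refine this.congr_deriv ?_
      rw [Jl_apply, J0_J0, neg_neg]
    have := h1.inner ℝ (hasDerivAt_const r x)
    simpa using this
  have h1 : ∀ y ∈ Icc t (t + s), HasDerivWithinAt (fun r => ⟪-J0 (γ r), x⟫_ℝ)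
      ⟪grd G (γ y), x⟫_ℝ (Icc t (t + s)) y := fun y _ => (hd y).hasDerivWithinAt
  obtain ⟨c, hc, hcc⟩ := exists_hasDerivAt_eq_slope (fun r => ⟪-J0 (γ r), x⟫_ℝ)
    (fun r => ⟪grd G (γ r), x⟫_ℝ) (by linarith : t < t + s)
    (fun y _ => (hd y).continuousAt.continuousWithinAt) (fun y _ => hd y)
  have h2 := h.inner_grd_le (o.one c) x hs
  rw [hcc, add_sub_cancel_left, div_le_iff₀ hs, ← inner_sub_left] at h2
  have e1 : -J0 (γ (t + s)) - -J0 (γ t) = -J0 (γ (t + s) - γ t) := by rw [J0_sub]; abel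
  rw [e1] at h2
  have e2 : (G x / s + s) * s = G x + s ^ 2 := by field_simp
  linarith

theorem Piece.arc {G G0 : E4 → ℝ} (h : GoodG G) (h0 : GoodG G0) (hle : ∀ x, G0 x ≤ G x)
    {γ : ℝ → E4} (o : Orb G0 γ) {s t : ℝ} (hst : s < t) :
    Piece G (γ t - γ s) (t - s - (1 / 2) * omega0 (γ s) (γ t)) (t - s) (t - s) := by
  have hd : 0 < t - s := by linarith
  refine ⟨hd, fun k => (List.range k).map fun i : ℕ =>
    γ (s + (i + 1 : ℕ) * ((t - s) / k)) - γ (s + i * ((t - s) / k)), ?_, ?_, ?_⟩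
  · intro k hk
    have hk' : (k : ℝ) ≠ 0 := by exact_mod_cast hk.ne'
    refine ⟨by simp, ?_⟩
    rw [sum_map_range, Finset.sum_range_sub (fun i : ℕ => γ (s + i * ((t - s) / k)))]
    simp only [Nat.cast_zero, zero_mul, add_zero]
    congr 2
    field_simp; ring
  · obtain ⟨C, hC, hsec⟩ := Orb.second h0
    obtain ⟨R, hR, hb⟩ := Orb.bound h0
    have key : ∀ k : ℕ, 0 < k → |fA k (fun i : ℕ =>
        γ (s + (i + 1 : ℕ) * ((t - s) / k)) - γ (s + i * ((t - s) / k)))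
        - (t - s - (1 / 2) * omega0 (γ s) (γ t))| ≤ (1 / 2 * (R * C) * (t - s) ^ 2) / k := by
      intro k hk
      have hk' : (0 : ℝ) < k := by exact_mod_cast hk
      set τ := (t - s) / k with hτ
      have hkτ : k * τ = t - s := by rw [hτ]; field_simp
      have e1 : ∀ i : ℕ, ∑ j ∈ Finset.range i, (γ (s + (j + 1 : ℕ) * τ) - γ (s + j * τ))
          = γ (s + i * τ) - γ s := by
        intro i
        rw [Finset.sum_range_sub (fun i : ℕ => γ (s + i * τ))]; simp
      have e2 : fA k (fun i : ℕ => γ (s + (i + 1 : ℕ) * τ) - γ (s + i * τ))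
          = (1 / 2) * ∑ i ∈ Finset.range k,
            omega0 (γ (s + i * τ)) (γ (s + (i + 1 : ℕ) * τ) - γ (s + i * τ))
            - (1 / 2) * omega0 (γ s) (γ t) := by
        rw [fA]
        simp only [e1, om_sub_left]
        rw [Finset.sum_sub_distrib, ← om_sum_right, e1, hkτ, add_sub_cancel, om_sub_right, om_self]
        ring
      rw [e2]
      have e3 : (1 / 2) * ∑ i ∈ Finset.range k,
            omega0 (γ (s + i * τ)) (γ (s + (i + 1 : ℕ) * τ) - γ (s + i * τ))
            - (1 / 2) * omega0 (γ s) (γ t) - (t - s - (1 / 2) * omega0 (γ s) (γ t))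
          = (1 / 2) * ∑ i ∈ Finset.range k,
            (omega0 (γ (s + i * τ)) (γ (s + (i + 1 : ℕ) * τ) - γ (s + i * τ)) - 2 * τ) := by
        rw [Finset.sum_sub_distrib, Finset.sum_const, Finset.card_range, nsmul_eq_mul, ← hkτ]
        ring
      rw [e3, abs_mul, abs_of_pos (by norm_num : (0 : ℝ) < 1 / 2)]
      have e4 : ∀ i : ℕ, |omega0 (γ (s + i * τ)) (γ (s + (i + 1 : ℕ) * τ) - γ (s + i * τ)) - 2 * τ|
          ≤ R * (C * τ ^ 2) := by
        intro i
        have h1 := hsec γ o (s + i * τ) τ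
        have h2 : omega0 (γ (s + i * τ)) (J0 (grd G0 (γ (s + i * τ)))) = 2 := by
          rw [om_J0_right, real_inner_comm, h0.euler, o.one]; norm_num
        have h3 : s + (i + 1 : ℕ) * τ = s + i * τ + τ := by push_cast; ring
        rw [h3]
        have h4 : omega0 (γ (s + i * τ)) (γ (s + i * τ + τ) - γ (s + i * τ)) - 2 * τ
            = omega0 (γ (s + i * τ)) (γ (s + i * τ + τ) - γ (s + i * τ)
              - τ • J0 (grd G0 (γ (s + i * τ)))) := by
          rw [om_sub_right _ _ (τ • _), om_smul_right, h2]; ring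
        rw [h4]
        refine (abs_om_le _ _).trans ?_
        gcongr
        exact (hb _ (o.one _).le).1
      have e5 : |∑ i ∈ Finset.range k,
            (omega0 (γ (s + i * τ)) (γ (s + (i + 1 : ℕ) * τ) - γ (s + i * τ)) - 2 * τ)|
          ≤ k * (R * (C * τ ^ 2)) := by
        refine (Finset.abs_sum_le_sum_abs _ _).trans ?_
        refine (Finset.sum_le_sum fun i _ => e4 i).trans ?_
        rw [Finset.sum_const, Finset.card_range, nsmul_eq_mul]
      calc _ ≤ 1 / 2 * (k * (R * (C * τ ^ 2))) := by gcongr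
        _ = _ := by rw [hτ]; field_simp
    rw [tendsto_iff_norm_sub_tendsto_zero]
    refine squeeze_zero' (Eventually.of_forall fun _ => norm_nonneg _) ?_
      (tendsto_const_div_atTop_nhds_zero_nat (1 / 2 * (R * C) * (t - s) ^ 2))
    filter_upwards [eventually_gt_atTop 0] with k hk
    rw [PA_range]
    exact key k hk
  · intro ε hε
    filter_upwards [eventually_gt_atTop 0] with k hk
    have hk' : (0 : ℝ) < k := by exact_mod_cast hk
    rw [PE_range]
    have h1 : ∀ i ∈ Finset.range k, qq G (γ (s + (i + 1 : ℕ) * ((t - s) / k))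
        - γ (s + i * ((t - s) / k))) ≤ ((t - s) / k) ^ 2 := by
      intro i _
      rw [qq]
      refine (GoodG.Gs_mono h0 h hle _).trans ?_
      have h3 : s + (i + 1 : ℕ) * ((t - s) / k) = s + i * ((t - s) / k) + (t - s) / k := by
        push_cast; ring
      rw [h3]
      exact o.qq_le h0 _ (by positivity)
    have h2 := Finset.sum_le_sum h1
    rw [Finset.sum_const, Finset.card_range, nsmul_eq_mul] at h2
    have h3 := mul_le_mul_of_nonneg_left h2 hk'.le
    have h4 : (k : ℝ) * (k * ((t - s) / k) ^ 2) = (t - s) * (t - s) := by field_simp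
    linarith

theorem Poly.piece {G : E4 → ℝ} {T : ℝ} (hT : 0 < T) (P : Poly G T) {A d e : ℝ}
    (p : Piece G 0 A d e) : A ≤ (1 / T) * (d * e) := by
  obtain ⟨hd, L, hL, hA, hE⟩ := p
  have i4 : Tendsto (fun m : ℕ => 4 * m) atTop atTop :=
    tendsto_id.const_mul_atTop' (by norm_num)
  have h1 : ∀ ε : ℝ, 0 < ε → A ≤ (1 / T + ε) * (d * e + ε) := by
    intro ε hε
    refine le_of_tendsto (hA.comp i4) ?_
    filter_upwards [P ε hε, i4.eventually (hE ε hε), eventually_gt_atTop 0] with m h1 h2 h3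
    have h4 := hL (4 * m) (by omega)
    refine (h1 _ h4.1 h4.2).trans ?_
    exact mul_le_mul_of_nonneg_left h2 (by positivity)
  have h2 : Tendsto (fun ε : ℝ => (1 / T + ε) * (d * e + ε)) (𝓝[>] 0)
      (𝓝 ((1 / T + 0) * (d * e + 0))) := by
    have : Continuous fun ε : ℝ => (1 / T + ε) * (d * e + ε) := by fun_prop
    exact (this.tendsto 0).mono_left nhdsWithin_le_nhds
  rw [add_zero, add_zero] at h2
  refine ge_of_tendsto h2 ?_
  filter_upwards [self_mem_nhdsWithin] with ε hε
  exact h1 ε hε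

/-- The period of a closed orbit of a smaller Hamiltonian is at least `T`. -/
theorem Poly.le_period {G G0 : E4 → ℝ} (h : GoodG G) (h0 : GoodG G0) (hle : ∀ x, G0 x ≤ G x)
    {T : ℝ} (hT : 0 < T) (P : Poly G T) {δ : ℝ → E4} (o : Orb G0 δ) {T' : ℝ} (hT' : 0 < T')
    (hc : δ T' = δ 0) : T ≤ T' := by
  have p := Piece.arc h h0 hle o hT'
  rw [hc, sub_self, om_self, mul_zero, sub_zero, sub_zero] at p
  have := P.piece hT p
  rw [one_div, ← div_eq_inv_mul, le_div_iff₀ hT] at this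
  nlinarith

/-- Strict positivity of the areas of inscribed triangles. -/
theorem Poly.triangle {G : E4 → ℝ} (h : GoodG G) {T : ℝ} (hT : 0 < T) (P : Poly G T)
    {γ : ℝ → E4} (o : Orb G γ) (hc : γ T = γ 0) {a b : ℝ} (ha : 0 < a) (hab : a < b) (hbT : b < T)
    (hne : grd G (γ 0) ≠ grd G (γ a)) :
    0 < omega0 (γ a - γ 0) (γ b - γ a) := by
  have hper : Function.Periodic γ T := by
    have := o.periodic_of_eq h hc.symm; rwa [sub_zero] at this
  by_contra! hneg
  set S : ℝ → E4 := fun τ => γ 0 - γ (-τ) + (γ (a + τ) - γ a) with hS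
  set Q : ℝ → ℝ := fun τ => (1 / 2) * omega0 (γ b - γ (a + τ)) (γ a - γ 0)
    + (1 / 2) * omega0 (γ b - γ (a + τ) + (γ a - γ 0)) (γ (-τ) - γ b)
    - (1 / 2) * (omega0 (γ (a + τ)) (γ b) + omega0 (γ 0) (γ a) + omega0 (γ b) (γ (-τ))) with hQ
  have ineq : ∀ τ, 0 < τ → a + τ < b → b < T - τ → Q τ ≤ qq G (S τ) / (2 * τ) := by
    intro τ h1 h2 h3
    have p1 := Piece.arc h h (fun _ => le_rfl) o h2
    have p2 := Piece.arc h h (fun _ => le_rfl) o ha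
    have p3 := Piece.arc h h (fun _ => le_rfl) o h3
    have p4 := Piece.straight h (S τ) (by positivity : 0 < 2 * τ)
    have hp : γ (T - τ) = γ (-τ) := by
      have := hper (-τ); rw [← this]; congr 1; ring
    rw [hp] at p3
    have p := ((p1.append p2).append p3).append p4
    have z : γ b - γ (a + τ) + (γ a - γ 0) + (γ (-τ) - γ b) + S τ = 0 := by
      simp only [hS]; module
    rw [z] at p
    have z2 : omega0 (γ b - γ (a + τ) + (γ a - γ 0) + (γ (-τ) - γ b)) (S τ) = 0 := by
      rw [eq_neg_of_add_eq_zero_left z, om_neg_left, om_self, neg_zero]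
    rw [z2] at p
    have hd : b - (a + τ) + (a - 0) + (T - τ - b) + 2 * τ = T := by ring
    rw [hd] at p
    have := P.piece hT p
    rw [← mul_assoc, one_div_mul_cancel hT.ne', one_mul] at this
    rw [hQ]
    simp only
    linarith
  -- derivative of Q at zero
  have d1 : HasDerivAt (fun τ => γ (a + τ)) (J0 (grd G (γ a))) 0 := by
    have := (o.der (a + 0)).comp_const_add a 0
    rwa [add_zero] at this
  have d2 : HasDerivAt (fun τ => γ (-τ)) (-J0 (grd G (γ 0))) 0 := by
    have h0 : HasDerivAt γ (J0 (grd G (γ 0))) (-0) := by rw [neg_zero]; exact o.der 0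
    have := HasDerivAt.scomp (0 : ℝ) h0 (hasDerivAt_neg (0 : ℝ))
    refine this.congr_deriv ?_
    simp
  have om_der : ∀ {f g : ℝ → E4} {f' g' : E4}, HasDerivAt f f' 0 → HasDerivAt g g' 0 →
      HasDerivAt (fun τ => omega0 (f τ) (g τ)) (omega0 (f 0) g' + omega0 f' (g 0)) 0 := by
    intro f g f' g' hf hg
    have := ((Jl.hasFDerivAt).comp_hasDerivAt (0 : ℝ) hf).inner ℝ hg
    exact this
  have na : omega0 (J0 (grd G (γ a))) (γ a) = -2 := by
    rw [om_antisymm, om_J0_right, real_inner_comm, h.euler, o.one]; norm_num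
  have n0 : omega0 (J0 (grd G (γ 0))) (γ 0) = -2 := by
    rw [om_antisymm, om_J0_right, real_inner_comm, h.euler, o.one]; norm_num
  have dQ : HasDerivAt Q 2 0 := by
    have c1 := (om_der (d1.const_sub (γ b)) (hasDerivAt_const 0 (γ a - γ 0))).const_mul (1 / 2)
    have c2 := (om_der ((d1.const_sub (γ b)).add_const (γ a - γ 0)) (d2.sub_const (γ b))).const_mul
      (1 / 2)
    have c3 := (((om_der d1 (hasDerivAt_const 0 (γ b))).add_const (omega0 (γ 0) (γ a))).add
      (om_der (hasDerivAt_const 0 (γ b)) d2)).const_mul (1 / 2)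
    refine ((c1.add c2).sub c3).congr_deriv ?_
    simp only [om_sub_right, om_sub_left, om_add_left, om_add_right, om_neg_left, om_neg_right,
      om_zero_left, om_zero_right, add_zero, neg_zero, na]
    rw [om_antisymm (γ 0) (J0 _), n0]
    ring
  have Q0 : Q 0 = -omega0 (γ a - γ 0) (γ b - γ a) := by
    rw [hQ]
    simp only [add_zero, neg_zero, om_sub_right, om_sub_left, om_add_left, om_self]
    rw [om_antisymm (γ b) (γ a), om_antisymm (γ b) (γ 0), om_antisymm (γ a) (γ 0)]
    ring
  have dS : HasDerivAt S (J0 (grd G (γ 0)) + J0 (grd G (γ a))) 0 := by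
    refine ((d2.const_sub (γ 0)).add (d1.sub_const (γ a))).congr_deriv ?_
    rw [neg_neg]
  have S0 : S 0 = 0 := by rw [hS]; simp
  have hsl : Tendsto (fun τ => τ⁻¹ * (Q τ - Q 0)) (𝓝[>] 0) (𝓝 2) := by
    have := (hasDerivAt_iff_tendsto_slope_zero.1 dQ).mono_left
      (nhdsWithin_mono (s := Ioi (0 : ℝ)) 0 (fun x (hx : 0 < x) => hx.ne'))
    simpa using this
  have hsl2 : Tendsto (fun τ => (1 / 2) * qq G (τ⁻¹ • S τ)) (𝓝[>] 0)
      (𝓝 ((1 / 2) * qq G (J0 (grd G (γ 0)) + J0 (grd G (γ a))))) := by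
    have := (hasDerivAt_iff_tendsto_slope_zero.1 dS).mono_left
      (nhdsWithin_mono (s := Ioi (0 : ℝ)) 0 (fun x (hx : 0 < x) => hx.ne'))
    have h3 : Tendsto (fun τ : ℝ => τ⁻¹ • S τ) (𝓝[>] 0)
      (𝓝 (J0 (grd G (γ 0)) + J0 (grd G (γ a)))) := by simpa [S0] using this
    exact ((h.qq_cont.tendsto _).comp h3).const_mul _
  have hfin := le_of_tendsto_of_tendsto hsl hsl2 (by
    have hmem : Ioo (0 : ℝ) (min (b - a) (T - b)) ∈ 𝓝[>] (0 : ℝ) :=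
      Ioo_mem_nhdsGT (lt_min (by linarith) (by linarith))
    filter_upwards [hmem] with τ hτ
    obtain ⟨h1, h2⟩ := hτ
    have h3 := ineq τ h1 (by linarith [min_le_left (b - a) (T - b)])
      (by linarith [min_le_right (b - a) (T - b)])
    rw [h.qq_smul (by positivity)]
    have h4 : Q τ - Q 0 ≤ qq G (S τ) / (2 * τ) := by rw [Q0]; linarith
    have h5 := mul_le_mul_of_nonneg_left h4 (by positivity : 0 ≤ τ⁻¹)
    refine h5.trans (le_of_eq ?_)
    field_simp)
  have e1 : qq G (J0 (grd G (γ 0)) + J0 (grd G (γ a)))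
      = 4 * Gs G ((1 / 2 : ℝ) • (grd G (γ 0) + grd G (γ a))) := by
    rw [qq, ← J0_add, J0_J0, neg_neg, h.Gs_smul (by norm_num)]
    ring
  have g1 : ∀ t, Gs G (grd G (γ t)) = 1 := fun t => by rw [h.Gs_grd, o.one]
  have := h.Gs_avg_lt (g1 0) (g1 a) hne
  rw [e1] at hfin
  linarith

end Hopf

namespace Hopf
open Filter Topology

/-- The strictly convex perturbation of `G`. -/
noncomputable def Gp (G : E4 → ℝ) (ε : ℝ) (z : E4) : ℝ := G z + ε * ‖z‖ ^ 2

namespace GoodG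
variable {G : E4 → ℝ}

theorem gp (h : GoodG G) {ε : ℝ} (hε : 0 ≤ ε) : GoodG (Gp G ε) where
  cont := by
    have := h.cont
    unfold Gp
    fun_prop
  conv := by
    have h1 : ConvexOn ℝ univ (fun z : E4 => ‖z‖ ^ 2) :=
      (convexOn_norm convex_univ).pow (fun _ _ => norm_nonneg _) 2
    exact h.conv.add (h1.smul hε)
  hom := by
    intro r hr z
    rw [Gp, Gp, h.hom r hr, norm_smul, Real.norm_of_nonneg hr]; ring
  smooth := by
    exact h.smooth.add (contDiffOn_const.mul (contDiff_norm_sq ℝ).contDiffOn)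
  pos := by
    intro z hz
    have := h.pos z hz
    unfold Gp
    positivity

theorem grd_gp (h : GoodG G) {ε : ℝ} (hε : 0 ≤ ε) (z : E4) :
    grd (Gp G ε) z = grd G z + (2 * ε) • z := by
  have h1 := (h.gp hε).hasF z
  have h2 : HasFDerivAt (Gp G ε) (innerSL ℝ (grd G z) + ε • (2 • innerSL ℝ z)) z :=
    (h.hasF z).add ((hasStrictFDerivAt_norm_sq z).hasFDerivAt.const_smul ε)
  have h3 := h1.unique h2
  refine ext_inner_right ℝ fun v => ?_
  have h4 := congrArg (fun f : E4 →L[ℝ] ℝ => f v) h3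
  simp only [innerSL_apply_apply, add_apply, smul_apply, smul_eq_mul, nsmul_eq_mul] at h4
  rw [h4, inner_add_left, real_inner_smul_left]
  push_cast
  ring

theorem strong (h : GoodG G) {ε : ℝ} (hε : 0 ≤ ε) (x y : E4) :
    Gp G ε y + ⟪grd (Gp G ε) y, x - y⟫_ℝ + ε * ‖x - y‖ ^ 2 ≤ Gp G ε x := by
  have h1 := h.subgrad x y
  rw [h.grd_gp hε, Gp, Gp, inner_add_left, real_inner_smul_left]
  have h2 : ‖x‖ ^ 2 = ‖y‖ ^ 2 + 2 * ⟪y, x - y⟫_ℝ + ‖x - y‖ ^ 2 := by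
    rw [← norm_add_sq_real, add_sub_cancel]
  rw [h2]
  linarith

theorem grd_gp_inj (h : GoodG G) {ε : ℝ} (hε : 0 < ε) {x y : E4}
    (he : grd (Gp G ε) x = grd (Gp G ε) y) : x = y := by
  have h1 := h.strong hε.le x y
  have h2 := h.strong hε.le y x
  rw [he, ← neg_sub x y, inner_neg_right, norm_neg] at h2
  have h3 : ε * ‖x - y‖ ^ 2 ≤ 0 := by linarith
  have h4 : ‖x - y‖ ^ 2 ≤ 0 := by
    by_contra! hc
    nlinarith
  have h5 : ‖x - y‖ = 0 := by nlinarith [norm_nonneg (x - y)]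
  exact sub_eq_zero.1 (norm_eq_zero.1 h5)

theorem le_gp {ε : ℝ} (hε : 0 ≤ ε) (x : E4) : G x ≤ Gp G ε x := by
  unfold Gp
  have : 0 ≤ ε * ‖x‖ ^ 2 := by positivity
  linarith

theorem orb_close (h : GoodG G) {b : ℝ} (hb : 0 < b) : ∃ C : ℝ, 0 < C ∧ ∀ (ε : ℝ) (δ γ : ℝ → E4),
    0 ≤ ε → Orb (Gp G ε) δ → Orb G γ → ∀ t ∈ Icc 0 b, ‖δ t - γ t‖ ≤ C * (‖δ 0 - γ 0‖ + ε) := by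
  obtain ⟨L, hL, hl⟩ := h.grad_lip
  obtain ⟨R, hR, hbd⟩ := Orb.bound h
  refine ⟨Real.exp (L * b) * (1 + 2 * R / L), by positivity, fun ε δ γ hε oδ oγ t ht => ?_⟩
  have hlip : ∀ _ : ℝ, LipschitzWith (⟨L, hL.le⟩ : NNReal) (fun x => J0 (grd G x)) := fun _ =>
    LipschitzWith.of_dist_le_mul fun x y => by
      rw [dist_eq_norm, dist_eq_norm, ← J0_sub, norm_J0]
      exact hl x y
  have key := dist_le_of_approx_trajectories_ODE (v := fun _ x => J0 (grd G x)) (a := 0) (b := b)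
    (f := δ) (f' := fun t => J0 (grd (Gp G ε) (δ t))) (g := γ) (g' := fun t => J0 (grd G (γ t)))
    (εf := 2 * ε * R) (εg := 0) (δ := ‖δ 0 - γ 0‖) hlip oδ.cont.continuousOn
    (fun t _ => (oδ.der t).hasDerivWithinAt) (fun t _ => by
      rw [dist_eq_norm, ← J0_sub, norm_J0, h.grd_gp hε, add_sub_cancel_left, norm_smul,
        Real.norm_of_nonneg (by positivity)]
      gcongr
      exact (hbd _ ((le_gp hε _).trans (oδ.one t).le)).1)
    oγ.cont.continuousOn (fun t _ => (oγ.der t).hasDerivWithinAt) (fun t _ => by simp)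
    (by rw [dist_eq_norm]) t ht
  rw [dist_eq_norm, gronwallBound_of_K_ne_0 (by exact hL.ne')] at key
  simp only [sub_zero, add_zero, NNReal.coe_mk] at key
  refine key.trans ?_
  have e1 : Real.exp (L * t) ≤ Real.exp (L * b) := Real.exp_le_exp.2 (by have := ht.2; gcongr)
  have e2 : Real.exp (L * t) - 1 ≤ Real.exp (L * b) := by linarith
  calc ‖δ 0 - γ 0‖ * Real.exp (L * t) + 2 * ε * R / L * (Real.exp (L * t) - 1)
      ≤ ‖δ 0 - γ 0‖ * Real.exp (L * b) + 2 * ε * R / L * Real.exp (L * b) := by gcongr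
    _ = Real.exp (L * b) * (‖δ 0 - γ 0‖ + 2 * R / L * ε) := by ring
    _ ≤ Real.exp (L * b) * ((1 + 2 * R / L) * (‖δ 0 - γ 0‖ + ε)) := by
      refine mul_le_mul_of_nonneg_left ?_ (Real.exp_pos _).le
      have a1 : 0 ≤ 2 * R / L := by positivity
      nlinarith [norm_nonneg (δ 0 - γ 0), mul_nonneg a1 (norm_nonneg (δ 0 - γ 0))]
    _ = _ := by ring

/-- The limiting systole, approximated by systoles of strictly convex domains. -/
theorem approx (h : GoodG G) : ∃ (γ : ℝ → E4) (T : ℝ), 0 < T ∧ Orb G γ ∧ γ T = γ 0 ∧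
    (∀ (δ : ℝ → E4) (T' : ℝ), Orb G δ → 0 < T' → δ T' = δ 0 → T ≤ T') ∧
    ∀ η : ℝ, 0 < η → ∃ (ε : ℝ) (δ : ℝ → E4) (S : ℝ), 0 < ε ∧ 0 < S ∧ Orb (Gp G ε) δ ∧ δ S = δ 0 ∧
      Poly (Gp G ε) S ∧ ∀ r ∈ Icc (0 : ℝ) 1, ‖δ (S * r) - γ (T * r)‖ ≤ η ∧
        ‖S • J0 (grd (Gp G ε) (δ (S * r))) - T • J0 (grd G (γ (T * r)))‖ ≤ η := by
  obtain ⟨γ0, b, hb, o0, hc0, -⟩ := h.exists_min_orbit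
  set ε : ℕ → ℝ := fun n => 1 / ((n : ℝ) + 1) with hε
  have hε0 : ∀ n, 0 < ε n := fun n => by rw [hε]; positivity
  have hεt : Tendsto ε atTop (𝓝 0) := tendsto_one_div_add_atTop_nhds_zero_nat
  choose δ S hS oδ hcδ hP using fun n => (h.gp (hε0 n).le).exists_min_orbit
  have hper : ∀ n (δ' : ℝ → E4) (T' : ℝ), Orb G δ' → 0 < T' → δ' T' = δ' 0 → S n ≤ T' :=
    fun n δ' T' o hT' hc => (hP n).le_period (h.gp (hε0 n).le) h (le_gp (hε0 n).le) (hS n) o hT' hc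
  have hSb : ∀ n, S n ≤ b := fun n => hper n γ0 b o0 hb hc0
  have hSa : ∀ n, S 0 ≤ S n := fun n => by
    refine (hP 0).le_period (h.gp (hε0 0).le) (h.gp (hε0 n).le) (fun x => ?_) (hS 0) (oδ n) (hS n)
      (hcδ n)
    have : ε n ≤ ε 0 := by
      simp only [hε]
      gcongr
      simp
    unfold Gp
    gcongr
  obtain ⟨R, hR, hbd⟩ := Orb.bound h
  have hδR : ∀ n t, G (δ n t) ≤ 1 := fun n t => (le_gp (hε0 n).le _).trans ((oδ n).one t).le
  obtain ⟨T, hTm, φ, hφ, hTφ⟩ := (isCompact_Icc (a := S 0) (b := b)).tendsto_subseq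
    (fun n => (⟨hSa n, hSb n⟩ : S n ∈ Icc (S 0) b))
  have hT : 0 < T := (hS 0).trans_le hTm.1
  obtain ⟨x0, -, ψ, hψ, hx0⟩ := (isCompact_closedBall (0 : E4) R).tendsto_subseq
    (x := fun n => δ (φ n) 0) (fun n => by
      rw [mem_closedBall, dist_zero_right]; exact (hbd _ (hδR _ _)).1)
  set χ : ℕ → ℕ := φ ∘ ψ with hχ
  have hχt : Tendsto χ atTop atTop := hφ.tendsto_atTop.comp hψ.tendsto_atTop
  have hTχ : Tendsto (fun n => S (χ n)) atTop (𝓝 T) := hTφ.comp hψ.tendsto_atTop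
  have hεχ : Tendsto (fun n => ε (χ n)) atTop (𝓝 0) := hεt.comp hχt
  have hG1 : G x0 = 1 := by
    have t1 : Tendsto (fun n => Gp G (ε (χ n)) (δ (χ n) 0)) atTop (𝓝 (G x0 + 0 * ‖x0‖ ^ 2)) :=
      ((h.cont.tendsto x0).comp hx0).add (hεχ.mul (hx0.norm.pow 2))
    have t2 : Tendsto (fun n => Gp G (ε (χ n)) (δ (χ n) 0)) atTop (𝓝 1) := by
      simp only [fun n => (oδ n).one 0]
      exact tendsto_const_nhds
    have := tendsto_nhds_unique t1 t2
    simpa using this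
  obtain ⟨γ, hγ0, o⟩ := h.exists_orb hG1
  obtain ⟨C, hC, hcl⟩ := h.orb_close hb
  obtain ⟨Λ, hΛ, hlip⟩ := Orb.lip h
  obtain ⟨L, hL, hl⟩ := h.grad_lip
  -- error sequences
  set e1 : ℕ → ℝ := fun n => C * (‖δ (χ n) 0 - γ 0‖ + ε (χ n)) + Λ * |S (χ n) - T| with he1
  have te1 : Tendsto e1 atTop (𝓝 0) := by
    have a1 : Tendsto (fun n => ‖δ (χ n) 0 - γ 0‖) atTop (𝓝 0) := by
      rw [hγ0]
      exact tendsto_iff_norm_sub_tendsto_zero.1 hx0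
    have a2 : Tendsto (fun n => |S (χ n) - T|) atTop (𝓝 0) :=
      tendsto_iff_norm_sub_tendsto_zero.1 hTχ
    have := ((a1.add hεχ).const_mul C).add (a2.const_mul Λ)
    simpa using this
  set e2 : ℕ → ℝ := fun n => b * (L * e1 n + 2 * ε (χ n) * R) + |S (χ n) - T| * R with he2
  have te2 : Tendsto e2 atTop (𝓝 0) := by
    have a2 : Tendsto (fun n => |S (χ n) - T|) atTop (𝓝 0) :=
      tendsto_iff_norm_sub_tendsto_zero.1 hTχ
    have := (((te1.const_mul L).add ((hεχ.const_mul 2).mul_const R)).const_mul b).add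
      (a2.mul_const R)
    simpa using this
  have b1 : ∀ n, ∀ r ∈ Icc (0 : ℝ) 1, ‖δ (χ n) (S (χ n) * r) - γ (T * r)‖ ≤ e1 n := by
    intro n r hr
    have hmem : S (χ n) * r ∈ Icc 0 b :=
      ⟨mul_nonneg (hS _).le hr.1, (mul_le_of_le_one_right (hS _).le hr.2).trans (hSb _)⟩
    have i1 := hcl (ε (χ n)) (δ (χ n)) γ (hε0 _).le (oδ _) o _ hmem
    have i2 := hlip γ o (S (χ n) * r) (T * r)
    have i3 : |S (χ n) * r - T * r| ≤ |S (χ n) - T| := by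
      rw [← sub_mul, abs_mul, abs_of_nonneg hr.1]
      exact mul_le_of_le_one_right (abs_nonneg _) hr.2
    calc _ ≤ ‖δ (χ n) (S (χ n) * r) - γ (S (χ n) * r)‖ + ‖γ (S (χ n) * r) - γ (T * r)‖ :=
          norm_sub_le_norm_sub_add_norm_sub _ _ _
      _ ≤ _ := add_le_add i1 (i2.trans (by gcongr))
  have b2 : ∀ n, ∀ r ∈ Icc (0 : ℝ) 1, ‖S (χ n) • J0 (grd (Gp G (ε (χ n))) (δ (χ n) (S (χ n) * r)))
      - T • J0 (grd G (γ (T * r)))‖ ≤ e2 n := by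
    intro n r hr
    set x := δ (χ n) (S (χ n) * r)
    set y := γ (T * r)
    have i1 : ‖x - y‖ ≤ e1 n := b1 n r hr
    have i2 : ‖grd (Gp G (ε (χ n))) x - grd G y‖ ≤ L * e1 n + 2 * ε (χ n) * R := by
      rw [h.grd_gp (hε0 _).le, add_sub_right_comm]
      refine (norm_add_le _ _).trans (add_le_add ((hl x y).trans (by gcongr)) ?_)
      rw [norm_smul, Real.norm_of_nonneg (by have := hε0 (χ n); positivity)]
      have := hε0 (χ n)
      gcongr
      exact (hbd _ (hδR _ _)).1
    have i3 : S (χ n) • J0 (grd (Gp G (ε (χ n))) x) - T • J0 (grd G y)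
        = S (χ n) • J0 (grd (Gp G (ε (χ n))) x - grd G y) + (S (χ n) - T) • J0 (grd G y) := by
      rw [J0_sub]; module
    rw [i3]
    refine (norm_add_le _ _).trans (add_le_add ?_ ?_)
    · rw [norm_smul, norm_J0, Real.norm_of_nonneg (hS _).le]
      exact mul_le_mul (hSb _) i2 (norm_nonneg _) hb.le
    · rw [norm_smul, norm_J0, Real.norm_eq_abs]
      gcongr
      exact (hbd _ (o.one _).le).2
  refine ⟨γ, T, hT, o, ?_, ?_, ?_⟩
  · have i1 : ∀ n, ‖γ T - γ 0‖ ≤ e1 n + e1 n := by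
      intro n
      have j1 := b1 n 1 (by simp)
      have j0 := b1 n 0 (by simp)
      rw [mul_one, mul_one, hcδ, norm_sub_rev] at j1
      rw [mul_zero, mul_zero] at j0
      calc _ ≤ ‖γ T - δ (χ n) 0‖ + ‖δ (χ n) 0 - γ 0‖ := norm_sub_le_norm_sub_add_norm_sub _ _ _
        _ ≤ _ := add_le_add j1 j0
    have i2 := ge_of_tendsto' (te1.add te1) i1
    rw [add_zero] at i2
    exact sub_eq_zero.1 (norm_le_zero_iff.1 i2)
  · intro δ' T' o' hT' hc'
    exact le_of_tendsto' hTχ fun n => hper _ δ' T' o' hT' hc'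
  · intro η hη
    obtain ⟨n, hn1, hn2⟩ := ((te1.eventually_lt_const hη).and (te2.eventually_lt_const hη)).exists
    exact ⟨ε (χ n), δ (χ n), S (χ n), hε0 _, hS _, oδ _, hcδ _, hP _,
      fun r hr => ⟨(b1 n r hr).trans hn1.le, (b2 n r hr).trans hn2.le⟩⟩

end GoodG

end Hopf

namespace Hopf
open Filter Topology

/-- A closed curve bounding a ruled symplectic disk. -/
structure Crv (c : ℝ → E4) (κ : ℝ) : Prop where
  smooth : ContDiff ℝ (⊤ : ℕ∞) c
  per : Function.Periodic c (2 * Real.pi)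
  kpos : 0 < κ
  conv : ∀ θ φ, κ * ‖c φ - c θ‖ ^ 2 ≤ omega0 (deriv c θ) (c φ - c θ)
  area : ∀ r s t, r < s → s < t → t < r + 2 * Real.pi → 0 < omega0 (c s - c r) (c t - c s)
  dne : ∀ θ, deriv c θ ≠ 0

/-- Bi-Lipschitz property of embedded closed curves. -/
theorem bilip {c : ℝ → E4} (hs : ContDiff ℝ (⊤ : ℕ∞) c) (hp : Function.Periodic c (2 * Real.pi))
    (hd : ∀ θ, deriv c θ ≠ 0) (hi : ∀ θ t, 0 < t → t < 2 * Real.pi → c (θ + t) ≠ c θ) :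
    ∃ k : ℝ, 0 < k ∧ ∀ θ φ, |θ - φ| ≤ Real.pi → k * |θ - φ| ≤ ‖c θ - c φ‖ := by
  have hpi := Real.pi_pos
  have hc1 : ContDiff ℝ (⊤ : ℕ∞) (deriv c) := by
    exact (contDiff_infty_iff_deriv.1 hs).2
  have hdiff : Differentiable ℝ c := hs.differentiable (by simp)
  have hdiff1 : Differentiable ℝ (deriv c) := hc1.differentiable (by simp)
  have hcd1 : Continuous (deriv c) := hc1.continuous
  have hcd2 : Continuous (deriv (deriv c)) := (contDiff_infty_iff_deriv.1 hc1).2.continuous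
  have hp1 : Function.Periodic (deriv c) (2 * Real.pi) := by
    intro x
    rw [← deriv_comp_add_const]
    congr 1
    funext y; exact hp y
  -- bounds
  obtain ⟨M, hM⟩ := (isCompact_Icc (a := -Real.pi) (b := 2 * Real.pi + Real.pi)).exists_bound_of_continuousOn
    hcd2.continuousOn
  obtain ⟨θ0, -, hθ0⟩ := (isCompact_Icc (a := (0 : ℝ)) (b := 2 * Real.pi)).exists_isMinOn
    (nonempty_Icc.2 (by positivity)) hcd1.norm.continuousOn
  set m := ‖deriv c θ0‖ with hm
  have hm0 : 0 < m := norm_pos_iff.2 (hd θ0)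
  have hM1 : 0 < |M| + 1 := by positivity
  set ρ := min Real.pi (m / (2 * (|M| + 1))) with hρ
  have hρ0 : 0 < ρ := lt_min hpi (by positivity)
  -- local estimate
  have loc : ∀ θ ∈ Icc (0 : ℝ) (2 * Real.pi), ∀ t ∈ Icc (0 : ℝ) ρ,
      (m / 2) * t ≤ ‖c (θ + t) - c θ‖ := by
    intro θ hθ t ht
    have hρpi : ρ ≤ Real.pi := min_le_left _ _
    have h1 : ∀ s ∈ Icc (0 : ℝ) t, ‖deriv c (θ + s) - deriv c θ‖ ≤ (|M| + 1) * t := by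
      intro s hs'
      have := (convex_Icc (-Real.pi) (2 * Real.pi + Real.pi)).norm_image_sub_le_of_norm_hasDerivWithin_le
        (f := deriv c) (f' := deriv (deriv c)) (C := |M| + 1)
        (fun x _ => (hdiff1 x).hasDerivAt.hasDerivWithinAt)
        (fun x hx => (hM x hx).trans (by linarith [le_abs_self M])) (x := θ) (y := θ + s)
        ⟨by linarith [hθ.1], by linarith [hθ.2]⟩
        ⟨by linarith [hθ.1, hs'.1], by linarith [hθ.2, hs'.2, ht.2]⟩
      refine this.trans ?_
      rw [add_sub_cancel_left, Real.norm_of_nonneg hs'.1]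
      gcongr; exact hs'.2
    have h2 := (convex_Icc (0 : ℝ) t).norm_image_sub_le_of_norm_hasDerivWithin_le
      (f := fun s => c (θ + s) - s • deriv c θ) (f' := fun s => deriv c (θ + s) - deriv c θ)
      (C := (|M| + 1) * t) (fun s _ => by
        have a1 : HasDerivAt (fun s => c (θ + s)) (deriv c (θ + s)) s :=
          (hdiff (θ + s)).hasDerivAt.comp_const_add θ s
        have a2 : HasDerivAt (fun s : ℝ => s • deriv c θ) (deriv c θ) s := by
          simpa using (hasDerivAt_id s).smul_const (deriv c θ)
        exact (a1.sub a2).hasDerivWithinAt) h1 (left_mem_Icc.2 ht.1) (right_mem_Icc.2 ht.1)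
    simp only [add_zero, zero_smul, sub_zero] at h2
    rw [Real.norm_of_nonneg ht.1] at h2
    have h3 : m * t ≤ ‖t • deriv c θ‖ := by
      rw [norm_smul, Real.norm_of_nonneg ht.1, mul_comm]
      exact mul_le_mul_of_nonneg_left (isMinOn_iff.1 hθ0 θ hθ) ht.1
    have h4 : ‖t • deriv c θ‖ ≤ ‖c (θ + t) - c θ‖ + ‖c (θ + t) - t • deriv c θ - c θ‖ := by
      have : t • deriv c θ = (c (θ + t) - c θ) - (c (θ + t) - t • deriv c θ - c θ) := by abel
      calc _ = ‖(c (θ + t) - c θ) - (c (θ + t) - t • deriv c θ - c θ)‖ := by rw [← this]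
        _ ≤ _ := norm_sub_le _ _
    have h5 : (|M| + 1) * t ≤ m / 2 := by
      have : t ≤ m / (2 * (|M| + 1)) := ht.2.trans (min_le_right _ _)
      rw [le_div_iff₀ (by positivity)] at this
      linarith
    have h6 := mul_le_mul_of_nonneg_right h5 ht.1
    linarith
  -- far estimate
  have hK : IsCompact (Icc (0 : ℝ) (2 * Real.pi) ×ˢ Icc ρ Real.pi) := isCompact_Icc.prod isCompact_Icc
  have hcont : Continuous fun p : ℝ × ℝ => ‖c (p.1 + p.2) - c p.1‖ := by
    have := hs.continuous
    fun_prop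
  obtain ⟨p0, hp0, hmin⟩ := hK.exists_isMinOn ⟨(0, Real.pi),
    ⟨⟨le_rfl, by positivity⟩, ⟨min_le_left _ _, le_rfl⟩⟩⟩ hcont.continuousOn
  set μ := ‖c (p0.1 + p0.2) - c p0.1‖ with hμ
  have hμ0 : 0 < μ := by
    refine norm_pos_iff.2 (sub_ne_zero.2 (hi _ _ (hρ0.trans_le hp0.2.1) ?_))
    linarith [hp0.2.2]
  set k := min (m / 2) (μ / Real.pi) with hk
  have hk0 : 0 < k := lt_min (by positivity) (by positivity)
  have all : ∀ θ ∈ Icc (0 : ℝ) (2 * Real.pi), ∀ t ∈ Icc (0 : ℝ) Real.pi,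
      k * t ≤ ‖c (θ + t) - c θ‖ := by
    intro θ hθ t ht
    rcases le_total t ρ with h1 | h1
    · refine le_trans ?_ (loc θ hθ t ⟨ht.1, h1⟩)
      exact mul_le_mul_of_nonneg_right (min_le_left _ _) ht.1
    · have h2 : μ ≤ ‖c (θ + t) - c θ‖ :=
        isMinOn_iff.1 hmin (θ, t) (mem_prod.2 ⟨hθ, ⟨h1, ht.2⟩⟩)
      refine le_trans ?_ h2
      calc k * t ≤ μ / Real.pi * Real.pi :=
            mul_le_mul (min_le_right _ _) ht.2 ht.1 (by positivity)
        _ = μ := by field_simp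
  have all2 : ∀ θ t, 0 ≤ t → t ≤ Real.pi → k * t ≤ ‖c (θ + t) - c θ‖ := by
    intro θ t h1 h2
    set n : ℤ := toIcoDiv (by positivity : 0 < 2 * Real.pi) 0 θ
    have hy := sub_toIcoDiv_zsmul_mem_Ico (by positivity : 0 < 2 * Real.pi) 0 θ
    set y := θ - n • (2 * Real.pi) with hyd
    have hn : θ = y + n * (2 * Real.pi) := by rw [hyd, zsmul_eq_mul]; ring
    have e0 : c θ = c y := by rw [hn]; exact hp.int_mul n y
    rw [zero_add] at hy
    have e1 : c (θ + t) = c (y + t) := by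
      rw [hn, show y + n * (2 * Real.pi) + t = y + t + n * (2 * Real.pi) by ring]
      exact hp.int_mul n (y + t)
    rw [e1, e0]
    exact all y ⟨hy.1, hy.2.le⟩ t ⟨h1, h2⟩
  refine ⟨k, hk0, fun θ φ h1 => ?_⟩
  rcases le_total φ θ with h2 | h2
  · have h3 : 0 ≤ θ - φ := by linarith
    rw [abs_of_nonneg h3] at h1 ⊢
    have := all2 φ (θ - φ) h3 h1
    rwa [add_sub_cancel] at this
  · have h3 : 0 ≤ φ - θ := by linarith
    rw [abs_sub_comm, abs_of_nonneg h3] at h1 ⊢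
    have := all2 θ (φ - θ) h3 h1
    rwa [add_sub_cancel, norm_sub_rev] at this

end Hopf

namespace Hopf
open Filter Topology

theorem fold_one {f : ℝ → E4} {f' : E4} (h0 : f 0 = 0) (h : HasDerivAt f f' 0) :
    Tendsto (fun t : ℝ => (1 / Real.sin t) • f t) (𝓝[>] 0) (𝓝 f') := by
  have h1 : Tendsto (fun t : ℝ => t⁻¹ • f t) (𝓝[>] 0) (𝓝 f') := by
    have := (hasDerivAt_iff_tendsto_slope_zero.1 h).mono_left
      (nhdsWithin_mono (s := Ioi (0 : ℝ)) 0 (fun x hx => ne_of_gt hx))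
    simpa [h0] using this
  have h2 : Tendsto (fun t : ℝ => t⁻¹ * Real.sin t) (𝓝[>] 0) (𝓝 1) := by
    have := (hasDerivAt_iff_tendsto_slope_zero.1 (Real.hasDerivAt_sin 0)).mono_left
      (nhdsWithin_mono (s := Ioi (0 : ℝ)) 0 (fun x hx => ne_of_gt hx))
    simpa using this
  have h3 := (h2.inv₀ one_ne_zero).smul h1
  rw [inv_one, one_smul] at h3
  refine h3.congr' ?_
  filter_upwards [self_mem_nhdsWithin] with t ht
  have ht0 : t ≠ 0 := ne_of_gt ht
  rw [smul_smul]
  congr 1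
  field_simp

theorem fold_two {o : ℝ → E4} (ho : ContDiff ℝ (⊤ : ℕ∞) o) (h0 : o 0 = 0)
    (h2 : deriv (deriv o) 0 = 0) :
    Tendsto (fun t : ℝ => (1 / Real.sin t ^ 2) • (Real.sin t • deriv o t - Real.cos t • o t))
      (𝓝[>] 0) (𝓝 0) := by
  have ho1 := (contDiff_infty_iff_deriv.1 ho).2
  have ho2 := (contDiff_infty_iff_deriv.1 ho1).2
  have hd0 : Differentiable ℝ o := ho.differentiable (by simp)
  have hd1 : Differentiable ℝ (deriv o) := ho1.differentiable (by simp)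
  rw [Metric.tendsto_nhds]
  intro ε hε
  have hc : Continuous fun t => deriv (deriv o) t + o t := ho2.continuous.add ho.continuous
  have hz : Tendsto (fun t => deriv (deriv o) t + o t) (𝓝 0) (𝓝 0) := by
    have := hc.tendsto 0
    rwa [h0, h2, add_zero] at this
  obtain ⟨δ, hδ, hb⟩ := Metric.eventually_nhds_iff.1 (Metric.tendsto_nhds.1 hz (ε / 8) (by positivity))
  have hlt : ∀ᶠ t : ℝ in 𝓝[>] 0, t < min δ 1 :=
    nhdsWithin_le_nhds (Iio_mem_nhds (lt_min hδ one_pos))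
  filter_upwards [self_mem_nhdsWithin, hlt] with t ht htδ
  have ht0 : (0 : ℝ) < t := ht
  have ht1 : t < 1 := htδ.trans_le (min_le_right _ _)
  have hs : t ≤ 2 * Real.sin t := by
    have := Real.mul_le_sin ht0.le (by linarith [Real.pi_gt_three])
    have h4 := Real.pi_lt_four
    have hpi := Real.pi_pos
    have : 1 / 2 * t ≤ 2 / Real.pi * t := by
      apply mul_le_mul_of_nonneg_right _ ht0.le
      rw [div_le_div_iff₀ (by norm_num) hpi]; linarith
    linarith
  have hs0 : 0 < Real.sin t := by linarith
  have h3 := (convex_Icc (0 : ℝ) t).norm_image_sub_le_of_norm_hasDerivWithin_le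
      (f := fun s => Real.sin s • deriv o s - Real.cos s • o s)
      (f' := fun s => Real.sin s • (deriv (deriv o) s + o s))
      (C := t * (ε / 8)) (fun s _ => by
        have a1 := (Real.hasDerivAt_sin s).smul (hd1 s).hasDerivAt
        have a2 := (Real.hasDerivAt_cos s).smul (hd0 s).hasDerivAt
        refine ((a1.sub a2).congr_deriv ?_).hasDerivWithinAt
        module) (fun s hs' => by
        rw [norm_smul]
        have b1 : ‖Real.sin s‖ ≤ t := by
          rw [Real.norm_eq_abs]
          exact (Real.abs_sin_le_abs).trans (by rw [abs_of_nonneg hs'.1]; exact hs'.2)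
        have b2 : ‖deriv (deriv o) s + o s‖ ≤ ε / 8 := by
          have := hb (y := s) (by
            rw [Real.dist_eq, sub_zero, abs_of_nonneg hs'.1]
            exact hs'.2.trans_lt (htδ.trans_le (min_le_left _ _)))
          rw [dist_zero_right] at this
          exact this.le
        exact mul_le_mul b1 b2 (norm_nonneg _) ht0.le)
      (left_mem_Icc.2 ht0.le) (right_mem_Icc.2 ht0.le)
  simp only [h0, Real.sin_zero, zero_smul, smul_zero, sub_zero] at h3
  rw [Real.norm_of_nonneg ht0.le] at h3
  rw [dist_zero_right, norm_smul, Real.norm_of_nonneg (by positivity)]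
  calc 1 / Real.sin t ^ 2 * ‖Real.sin t • deriv o t - Real.cos t • o t‖
      ≤ 1 / Real.sin t ^ 2 * (t * (ε / 8) * t) := by gcongr
    _ = (t ^ 2 / Real.sin t ^ 2) * (ε / 8) := by ring
    _ ≤ 4 * (ε / 8) := by
        apply mul_le_mul_of_nonneg_right _ (by positivity)
        rw [div_le_iff₀ (by positivity)]
        nlinarith
    _ < ε := by linarith

/-- even part -/
noncomputable def ev (c : ℝ → E4) (t : ℝ) : E4 := (1 / 2 : ℝ) • (c t + c (-t))
/-- odd part -/
noncomputable def od (c : ℝ → E4) (t : ℝ) : E4 := (1 / 2 : ℝ) • (c t - c (-t))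

theorem ev_smooth {c : ℝ → E4} (h : ContDiff ℝ (⊤ : ℕ∞) c) : ContDiff ℝ (⊤ : ℕ∞) (ev c) :=
  (h.add (h.comp contDiff_neg)).const_smul _
theorem od_smooth {c : ℝ → E4} (h : ContDiff ℝ (⊤ : ℕ∞) c) : ContDiff ℝ (⊤ : ℕ∞) (od c) :=
  (h.sub (h.comp contDiff_neg)).const_smul _

theorem hasDerivAt_refl {c : ℝ → E4} (h : Differentiable ℝ c) (t : ℝ) :
    HasDerivAt (fun x => c (-x)) (-deriv c (-t)) t := by
  have := (h (-t)).hasDerivAt.scomp t (hasDerivAt_neg t)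
  simpa [Function.comp_def] using this

theorem ev_deriv {c : ℝ → E4} (h : Differentiable ℝ c) (t : ℝ) :
    HasDerivAt (ev c) (od (deriv c) t) t := by
  refine (((h t).hasDerivAt.add (hasDerivAt_refl h t)).const_smul (1 / 2 : ℝ)).congr_deriv ?_
  simp only [od]; module

theorem od_deriv {c : ℝ → E4} (h : Differentiable ℝ c) (t : ℝ) :
    HasDerivAt (od c) (ev (deriv c) t) t := by
  refine (((h t).hasDerivAt.sub (hasDerivAt_refl h t)).const_smul (1 / 2 : ℝ)).congr_deriv ?_
  simp only [ev]; module

theorem od_zero (c : ℝ → E4) : od c 0 = 0 := by simp [od]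

/-- the ruled disk -/
noncomputable def Rd (c : ℝ → E4) (z : ℂ) : E4 :=
  ev c (Real.arccos z.re) + (z.im / Real.sin (Real.arccos z.re)) • od c (Real.arccos z.re)

/-- x-derivative -/
noncomputable def Ra (c : ℝ → E4) (z : ℂ) : E4 :=
  -((1 / Real.sin (Real.arccos z.re)) • od (deriv c) (Real.arccos z.re)
    + (z.im / Real.sin (Real.arccos z.re)) • ((1 / Real.sin (Real.arccos z.re) ^ 2) •
      (Real.sin (Real.arccos z.re) • ev (deriv c) (Real.arccos z.re)
        - Real.cos (Real.arccos z.re) • od c (Real.arccos z.re))))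

/-- y-derivative -/
noncomputable def Rb (c : ℝ → E4) (z : ℂ) : E4 :=
  (1 / Real.sin (Real.arccos z.re)) • od c (Real.arccos z.re)

/-- derivative of the ruled disk -/
noncomputable def RD (c : ℝ → E4) (z : ℂ) : ℂ →L[ℝ] E4 :=
  Complex.reCLM.smulRight (Ra c z) + Complex.imCLM.smulRight (Rb c z)

theorem sin_arccos_pos {x : ℝ} (h1 : -1 < x) (h2 : x < 1) : 0 < Real.sin (Real.arccos x) := by
  rw [Real.sin_arccos]
  apply Real.sqrt_pos.2
  nlinarith

theorem Rd_smooth {c : ℝ → E4} (h : ContDiff ℝ (⊤ : ℕ∞) c) {z : ℂ} (h1 : -1 < z.re)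
    (h2 : z.re < 1) : ContDiffAt ℝ (⊤ : ℕ∞) (Rd c) z := by
  have hre : ContDiffAt ℝ (⊤ : ℕ∞) (fun z : ℂ => z.re) z := Complex.reCLM.contDiff.contDiffAt
  have him : ContDiffAt ℝ (⊤ : ℕ∞) (fun z : ℂ => z.im) z := Complex.imCLM.contDiff.contDiffAt
  have ha : ContDiffAt ℝ (⊤ : ℕ∞) (fun z : ℂ => Real.arccos z.re) z :=
    (Real.contDiffAt_arccos h1.ne' h2.ne).comp z hre
  have hsn : ContDiffAt ℝ (⊤ : ℕ∞) (fun z : ℂ => Real.sin (Real.arccos z.re)) z :=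
    Real.contDiff_sin.contDiffAt.comp z ha
  have he : ContDiffAt ℝ (⊤ : ℕ∞) (fun z : ℂ => ev c (Real.arccos z.re)) z :=
    (ev_smooth h).contDiffAt.comp z ha
  have ho : ContDiffAt ℝ (⊤ : ℕ∞) (fun z : ℂ => od c (Real.arccos z.re)) z :=
    (od_smooth h).contDiffAt.comp z ha
  exact he.add ((him.div hsn (sin_arccos_pos h1 h2).ne').smul ho)

theorem Rd_hasFDerivAt {c : ℝ → E4} (h : ContDiff ℝ (⊤ : ℕ∞) c) {z : ℂ} (h1 : -1 < z.re)
    (h2 : z.re < 1) : HasFDerivAt (Rd c) (RD c z) z := by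
  have hdf : Differentiable ℝ c := h.differentiable (by simp)
  set s := Real.sin (Real.arccos z.re) with hs
  have hs0 : 0 < s := sin_arccos_pos h1 h2
  have hq : HasDerivAt Real.arccos (-(1 / s)) z.re := by
    rw [hs, Real.sin_arccos]; exact Real.hasDerivAt_arccos h1.ne' h2.ne
  have ha : HasFDerivAt (fun z : ℂ => Real.arccos z.re) ((-(1 / s)) • Complex.reCLM) z := by
    exact hq.comp_hasFDerivAt z Complex.reCLM.hasFDerivAt
  have he : HasFDerivAt (fun z : ℂ => ev c (Real.arccos z.re))
      (((-(1 / s)) • Complex.reCLM).smulRight (od (deriv c) (Real.arccos z.re))) z := by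
    have := (ev_deriv hdf (Real.arccos z.re)).hasFDerivAt.comp z ha
    refine this.congr_fderiv ?_
    ext v; simp; ring
  have hO : HasDerivAt (fun t => (1 / Real.sin t) • od c t)
      ((1 / s ^ 2) • (s • ev (deriv c) (Real.arccos z.re)
        - Real.cos (Real.arccos z.re) • od c (Real.arccos z.re))) (Real.arccos z.re) := by
    have b1 := (Real.hasDerivAt_sin (Real.arccos z.re)).fun_inv hs0.ne'
    have b2 := b1.smul (od_deriv hdf (Real.arccos z.re))
    simp only [one_div]
    refine b2.congr_deriv ?_
    rw [← hs, smul_sub, smul_smul, smul_smul]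
    have e1 : (s ^ 2)⁻¹ * s = s⁻¹ := by field_simp
    rw [e1]
    have e2 : -Real.cos (Real.arccos z.re) / s ^ 2 = -((s ^ 2)⁻¹ * Real.cos (Real.arccos z.re)) := by
      field_simp
    rw [e2]; module
  have ho : HasFDerivAt (fun z : ℂ => (1 / Real.sin (Real.arccos z.re)) • od c (Real.arccos z.re))
      (((-(1 / s)) • Complex.reCLM).smulRight ((1 / s ^ 2) • (s • ev (deriv c) (Real.arccos z.re)
        - Real.cos (Real.arccos z.re) • od c (Real.arccos z.re)))) z := by
    have := hO.hasFDerivAt.comp z ha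
    refine this.congr_fderiv ?_
    ext v; simp; ring
  have hi : HasFDerivAt (fun z : ℂ => z.im) Complex.imCLM z := Complex.imCLM.hasFDerivAt
  have hfin := he.add (hi.smul ho)
  have heq : Rd c = fun z : ℂ => ev c (Real.arccos z.re) + z.im •
      ((1 / Real.sin (Real.arccos z.re)) • od c (Real.arccos z.re)) := by
    funext w
    simp only [Rd, smul_smul]
    congr 2; ring
  rw [heq]
  refine hfin.congr_fderiv ?_
  ext v
  simp only [RD, Ra, Rb, ← hs]
  simp
  ring

theorem Rd_symm {c : ℝ → E4} (hp : Function.Periodic c (2 * Real.pi)) (z : ℂ) :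
    Rd c z = Rd (fun t => c (t + Real.pi)) (-z) := by
  simp only [Rd, ev, od, Complex.neg_re, Complex.neg_im, Real.arccos_neg, Real.sin_pi_sub]
  have e1 : c (Real.pi - Real.arccos z.re + Real.pi) = c (-Real.arccos z.re) := by
    rw [← hp (-Real.arccos z.re)]; congr 1; ring
  have e2 : c (-(Real.pi - Real.arccos z.re) + Real.pi) = c (Real.arccos z.re) := by
    congr 1; ring
  rw [e1, e2]
  module

theorem im_le {z : ℂ} (hz : z ∈ closedBall (0 : ℂ) 1) :
    |z.im| ≤ Real.sin (Real.arccos z.re) := by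
  rw [Real.sin_arccos]
  apply Real.abs_le_sqrt
  have : ‖z‖ ≤ 1 := by simpa using hz
  have h2 := Complex.sq_norm z
  rw [Complex.normSq_apply] at h2
  nlinarith [norm_nonneg z]

theorem lam_le {z : ℂ} (hz : z ∈ closedBall (0 : ℂ) 1) :
    |z.im / Real.sin (Real.arccos z.re)| ≤ 1 := by
  have h := im_le hz
  have h0 := (abs_nonneg _).trans h
  rw [abs_div, abs_of_nonneg h0]
  exact div_le_one_of_le₀ h h0

theorem re_abs {z : ℂ} (hz : z ∈ closedBall (0 : ℂ) 1) :
    (-1 < z.re ∧ z.re < 1) ∨ z = 1 ∨ z = -1 := by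
  have h1 : ‖z‖ ≤ 1 := by simpa using hz
  have h2 := Complex.sq_norm z
  rw [Complex.normSq_apply] at h2
  have h3 : z.re * z.re + z.im * z.im ≤ 1 := by nlinarith [norm_nonneg z]
  rcases lt_or_ge z.re 1 with ha | ha
  · rcases lt_or_ge (-1) z.re with hb | hb
    · exact Or.inl ⟨hb, ha⟩
    · right; right
      apply Complex.ext
      · simp; nlinarith
      · simp; nlinarith
  · right; left
    apply Complex.ext
    · simp; nlinarith
    · simp; nlinarith

theorem ball_re {z : ℂ} (hz : z ∈ ball (0 : ℂ) 1) : -1 < z.re ∧ z.re < 1 := by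
  have h1 : ‖z‖ < 1 := by simpa using hz
  have := Complex.abs_re_le_norm z
  exact abs_lt.1 (this.trans_lt h1)

theorem arccos_one_tendsto : Tendsto (fun z : ℂ => Real.arccos z.re) (𝓝 1) (𝓝 0) := by
  have : Continuous fun z : ℂ => Real.arccos z.re :=
    Real.continuous_arccos.comp Complex.continuous_re
  have := this.tendsto 1
  simpa using this

theorem Rd_cont_one {c : ℝ → E4} (h : Continuous c) :
    ContinuousWithinAt (Rd c) (closedBall 0 1) 1 := by
  have h1 : Rd c 1 = c 0 := by simp [Rd, ev, od]; module
  have hE : Tendsto (fun t => c t - c 0) (𝓝 0) (𝓝 0) := by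
    have : Continuous fun t => c t - c 0 := by fun_prop
    have := this.tendsto 0
    simpa using this
  have hN : Tendsto (fun t => c (-t) - c 0) (𝓝 0) (𝓝 0) := by
    have : Continuous fun t => c (-t) - c 0 := by fun_prop
    have := this.tendsto 0
    simpa using this
  have hb : Tendsto (fun z : ℂ => ‖c (Real.arccos z.re) - c 0‖ + ‖c (-Real.arccos z.re) - c 0‖)
      (𝓝 1) (𝓝 0) := by
    have := ((hE.comp arccos_one_tendsto).norm).add ((hN.comp arccos_one_tendsto).norm)
    simpa using this
  rw [ContinuousWithinAt, h1, tendsto_iff_norm_sub_tendsto_zero]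
  refine squeeze_zero' (Eventually.of_forall fun _ => norm_nonneg _) ?_ (hb.mono_left nhdsWithin_le_nhds)
  filter_upwards [self_mem_nhdsWithin] with z hz
  have hl := abs_le.1 (lam_le hz)
  set l := z.im / Real.sin (Real.arccos z.re) with hld
  have e : Rd c z - c 0 = ((1 + l) / 2) • (c (Real.arccos z.re) - c 0)
      + ((1 - l) / 2) • (c (-Real.arccos z.re) - c 0) := by
    simp only [Rd, ev, od, ← hld]; module
  rw [e]
  refine (norm_add_le _ _).trans ?_
  rw [norm_smul, norm_smul, Real.norm_of_nonneg (by linarith), Real.norm_of_nonneg (by linarith)]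
  gcongr
  · exact mul_le_of_le_one_left (norm_nonneg _) (by linarith)
  · exact mul_le_of_le_one_left (norm_nonneg _) (by linarith)

theorem Rd_lim_one {c : ℝ → E4} (h : ContDiff ℝ (⊤ : ℕ∞) c) :
    ∃ L, Tendsto (fun z => fderiv ℝ (Rd c) z) (𝓝[ball 0 1] 1) (𝓝 L) := by
  have h1 := (contDiff_infty_iff_deriv.1 h).2
  have hd : Differentiable ℝ c := h.differentiable (by simp)
  have hd1 : Differentiable ℝ (deriv c) := h1.differentiable (by simp)
  have hth : Tendsto (fun z : ℂ => Real.arccos z.re) (𝓝[ball 0 1] 1) (𝓝[>] 0) := by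
    refine tendsto_nhdsWithin_iff.2 ⟨arccos_one_tendsto.mono_left nhdsWithin_le_nhds, ?_⟩
    filter_upwards [self_mem_nhdsWithin] with z hz
    exact Real.arccos_pos.2 (ball_re hz).2
  have dod : deriv (od c) = ev (deriv c) := funext fun t => (od_deriv hd t).deriv
  have t1 := (fold_one (od_zero (deriv c)) (od_deriv hd1 0)).comp hth
  have t2 := (fold_two (od_smooth h) (od_zero c) (by
    rw [dod, (ev_deriv hd1 0).deriv, od_zero])).comp hth
  rw [dod] at t2
  have t3 := (fold_one (od_zero c) (od_deriv hd 0)).comp hth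
  have t4 : Tendsto (fun z : ℂ => (z.im / Real.sin (Real.arccos z.re)) •
      ((1 / Real.sin (Real.arccos z.re) ^ 2) •
      (Real.sin (Real.arccos z.re) • ev (deriv c) (Real.arccos z.re)
        - Real.cos (Real.arccos z.re) • od c (Real.arccos z.re)))) (𝓝[ball 0 1] 1) (𝓝 0) := by
    refine squeeze_zero_norm' ?_ (tendsto_zero_iff_norm_tendsto_zero.1 t2)
    filter_upwards [self_mem_nhdsWithin] with z hz
    rw [norm_smul]
    exact mul_le_of_le_one_left (norm_nonneg _) (lam_le (ball_subset_closedBall hz))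
  have ta : Tendsto (Ra c) (𝓝[ball 0 1] 1) (𝓝 (-(ev (deriv (deriv c)) 0 + 0))) := (t1.add t4).neg
  have tb : Tendsto (Rb c) (𝓝[ball 0 1] 1) (𝓝 (ev (deriv c) 0)) := t3
  have hcts : Continuous fun q : E4 × E4 =>
      Complex.reCLM.smulRight q.1 + Complex.imCLM.smulRight q.2 := by
    have e1 : ∀ l : ℂ →L[ℝ] ℝ, Continuous fun q : E4 => l.smulRight q := fun l =>
      (ContinuousLinearMap.smulRightL ℝ ℂ E4 l).continuous
    exact ((e1 _).comp continuous_fst).add ((e1 _).comp continuous_snd)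
  refine ⟨_, ((hcts.tendsto _).comp (ta.prodMk_nhds tb)).congr' ?_⟩
  filter_upwards [self_mem_nhdsWithin] with z hz
  exact (Rd_hasFDerivAt h (ball_re hz).1 (ball_re hz).2).fderiv.symm

end Hopf

namespace Hopf
open Filter Topology

theorem Rd_lim {c : ℝ → E4} (h : ContDiff ℝ (⊤ : ℕ∞) c) (hp : Function.Periodic c (2 * Real.pi))
    {z : ℂ} (hz : z ∈ closedBall (0 : ℂ) 1) :
    ∃ L, Tendsto (fun z => fderiv ℝ (Rd c) z) (𝓝[ball 0 1] z) (𝓝 L) := by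
  rcases re_abs hz with h1 | rfl | rfl
  · refine ⟨_, ((Rd_smooth h h1.1 h1.2).continuousAt_fderiv (by simp)).tendsto.mono_left
      nhdsWithin_le_nhds⟩
  · exact Rd_lim_one h
  · obtain ⟨L, hL⟩ := Rd_lim_one (c := fun t => c (t + Real.pi)) (h.comp (contDiff_id.add contDiff_const))
    refine ⟨-L, ?_⟩
    have ht : Tendsto (fun z : ℂ => -z) (𝓝[ball 0 1] (-1)) (𝓝[ball 0 1] 1) := by
      refine tendsto_nhdsWithin_iff.2 ⟨?_, ?_⟩
      · have := (continuous_neg (G := ℂ)).tendsto (-1)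
        rw [neg_neg] at this
        exact this.mono_left nhdsWithin_le_nhds
      · filter_upwards [self_mem_nhdsWithin] with z hz
        simpa using hz
    refine (hL.comp ht).neg.congr' ?_
    filter_upwards [self_mem_nhdsWithin] with z hz
    have : Rd c = fun z => Rd (fun t => c (t + Real.pi)) (-z) := funext fun z => Rd_symm hp z
    have hr := ball_re (z := -z) (by simpa using hz)
    have h3 := Rd_hasFDerivAt (c := fun t => c (t + Real.pi))
      (h.comp (contDiff_id.add contDiff_const)) hr.1 hr.2
    have h4 := h3.comp z (hasFDerivAt_id z).neg
    rw [this]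
    refine Eq.symm (HasFDerivAt.fderiv (h4.congr_fderiv ?_))
    simp only [Function.comp_apply]
    rw [h3.fderiv]
    ext v
    simp

theorem Rd_cont {c : ℝ → E4} (h : ContDiff ℝ (⊤ : ℕ∞) c) (hp : Function.Periodic c (2 * Real.pi)) :
    ContinuousOn (Rd c) (closedBall 0 1) := by
  intro z hz
  rcases re_abs hz with h1 | rfl | rfl
  · exact (Rd_smooth h h1.1 h1.2).continuousAt.continuousWithinAt
  · exact Rd_cont_one h.continuous
  · have h1 := Rd_cont_one (c := fun t => c (t + Real.pi)) (by have := h.continuous; fun_prop)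
    have this : Rd c = fun z => Rd (fun t => c (t + Real.pi)) (-z) := funext fun z => Rd_symm hp z
    rw [this]
    have h2 : ContinuousWithinAt (fun z : ℂ => -z) (closedBall 0 1) (-1) :=
      continuous_neg.continuousWithinAt
    refine ContinuousWithinAt.comp (g := Rd (fun t => c (t + Real.pi))) (f := fun z : ℂ => -z)
      (t := closedBall 0 1) ?_ h2 ?_
    · rw [neg_neg]; exact h1
    · intro z hz; simpa using hz

theorem Rd_comb (c : ℝ → E4) (z : ℂ) :
    Rd c z = ((1 + z.im / Real.sin (Real.arccos z.re)) / 2) • c (Real.arccos z.re)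
      + ((1 - z.im / Real.sin (Real.arccos z.re)) / 2) • c (-Real.arccos z.re) := by
  simp only [Rd, ev, od]; module

theorem Crv.ne {c : ℝ → E4} {κ : ℝ} (h : Crv c κ) {r s : ℝ} (h1 : r < s)
    (h2 : s < r + 2 * Real.pi) : c s ≠ c r := by
  intro he
  have := h.area r s ((s + (r + 2 * Real.pi)) / 2) h1 (by linarith) (by linarith)
  rw [he, sub_self, om_zero_left] at this
  exact lt_irrefl _ this

theorem Crv.bilip {c : ℝ → E4} {κ : ℝ} (h : Crv c κ) :
    ∃ k : ℝ, 0 < k ∧ ∀ θ φ, |θ - φ| ≤ Real.pi → k * |θ - φ| ≤ ‖c θ - c φ‖ :=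
  Hopf.bilip h.smooth h.per h.dne fun θ t h1 h2 => h.ne (by linarith) (by linarith)

theorem Crv.Rd_inj_aux {c : ℝ → E4} {κ : ℝ} (h : Crv c κ) {z1 z2 : ℂ}
    (hz1 : z1 ∈ closedBall (0 : ℂ) 1) (hz2 : z2 ∈ closedBall (0 : ℂ) 1)
    (hlt : Real.arccos z1.re < Real.arccos z2.re) : Rd c z1 ≠ Rd c z2 := by
  have hpi := Real.pi_pos
  intro he
  have l1 := abs_le.1 (lam_le hz1)
  have l2 := abs_le.1 (lam_le hz2)
  have a1 := Real.arccos_nonneg z1.re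
  have a2 := Real.arccos_le_pi z2.re
  rw [Rd_comb c z1, Rd_comb c z2] at he
  set α := Real.arccos z1.re
  set β := Real.arccos z2.re
  set x := z1.im / Real.sin α
  set y := z2.im / Real.sin β
  have hm : c (-β) = c (2 * Real.pi - β) := by
    rw [← h.per (-β)]; congr 1; ring
  rcases a1.eq_or_lt with h0 | h0
  · rw [← h0, neg_zero, ← add_smul, show (1 + x) / 2 + (1 - x) / 2 = 1 by ring, one_smul] at he
    rcases a2.eq_or_lt with h3 | h3
    · have : c (-β) = c β := by rw [hm, h3]; congr 1; ring
      rw [this, ← add_smul, show (1 + y) / 2 + (1 - y) / 2 = 1 by ring, one_smul] at he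
      exact h.ne (r := 0) (s := β) (by linarith) (by linarith) he.symm
    · have ha := h.area (-β) 0 β (by linarith) (by linarith) (by linarith)
      have e1 : c 0 - c (-β) = ((1 + y) / 2) • (c β - c (-β)) := by rw [he]; module
      have e2 : c β - c 0 = ((1 - y) / 2) • (c β - c (-β)) := by rw [he]; module
      rw [e1, e2, om_smul_left, om_smul_right, om_self] at ha
      simp at ha
  · have ha1 := h.area (-α) α β (by linarith) hlt (by linarith)
    have ha2 := h.area (-α) α (2 * Real.pi - β) (by linarith) (by linarith) (by linarith)
    rw [← hm] at ha2
    have e1 : ((1 + y) / 2) • (c β - c α) + ((1 - y) / 2) • (c (-β) - c α)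
        = ((x - 1) / 2) • (c α - c (-α)) := by
      have : ((1 + y) / 2) • (c β - c α) + ((1 - y) / 2) • (c (-β) - c α)
        = ((1 + y) / 2) • c β + ((1 - y) / 2) • c (-β) - c α := by module
      rw [this, ← he]; module
    have e2 := congrArg (omega0 (c α - c (-α))) e1
    rw [om_add_right, om_smul_right, om_smul_right, om_smul_right, om_self, mul_zero] at e2
    nlinarith [mul_nonneg (show 0 ≤ (1 + y) / 2 by linarith) ha1.le,
      mul_nonneg (show 0 ≤ (1 - y) / 2 by linarith) ha2.le]

theorem Crv.Rd_inj {c : ℝ → E4} {κ : ℝ} (h : Crv c κ) : InjOn (Rd c) (closedBall 0 1) := by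
  intro z1 hz1 z2 hz2 he
  rcases lt_trichotomy (Real.arccos z1.re) (Real.arccos z2.re) with hl | hl | hl
  · exact absurd he (h.Rd_inj_aux hz1 hz2 hl)
  · have r1 : ∀ z ∈ closedBall (0 : ℂ) 1, z.re ∈ Icc (-1 : ℝ) 1 := fun z hz =>
      abs_le.1 ((Complex.abs_re_le_norm z).trans (by simpa using hz))
    have hre : z1.re = z2.re := Real.arccos_injOn (r1 z1 hz1) (r1 z2 hz2) hl
    refine Complex.ext hre ?_
    rcases re_abs hz1 with h1 | h1 | h1
    · have hs := sin_arccos_pos h1.1 h1.2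
      have ha : 0 < Real.arccos z1.re := Real.arccos_pos.2 h1.2
      have hb : Real.arccos z1.re < Real.pi := Real.arccos_lt_pi.2 h1.1
      simp only [Rd, ← hre] at he
      have he' := add_left_cancel he
      have hne : od c (Real.arccos z1.re) ≠ 0 := by
        simp only [od, ne_eq, smul_eq_zero, sub_eq_zero]
        push Not
        exact ⟨by norm_num, h.ne (by linarith) (by linarith)⟩
      have := smul_left_injective ℝ hne he'
      field_simp at this
      exact this
    · have : z2.re = 1 := by rw [← hre, h1]; simp
      have h3 := im_le hz2
      rw [this] at h3
      simp at h3
      rw [h1, h3]; simp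
    · have : z2.re = -1 := by rw [← hre, h1]; simp
      have h3 := im_le hz2
      rw [this] at h3
      simp at h3
      rw [h1, h3]; simp
  · exact absurd he.symm (h.Rd_inj_aux hz2 hz1 hl)

theorem Crv.Rd_om {c : ℝ → E4} {κ : ℝ} (h : Crv c κ) :
    ∃ m : ℝ, 0 < m ∧ ∀ z ∈ ball (0 : ℂ) 1,
      m ≤ omega0 (fderiv ℝ (Rd c) z 1) (fderiv ℝ (Rd c) z Complex.I) := by
  obtain ⟨k, hk, hb⟩ := h.bilip
  have hκ := h.kpos
  have hpi := Real.pi_pos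
  refine ⟨2 * κ * k ^ 2, by positivity, fun z hz => ?_⟩
  have hr := ball_re hz
  have hs := sin_arccos_pos hr.1 hr.2
  have l1 := abs_le.1 (lam_le (ball_subset_closedBall hz))
  have a0 : 0 < Real.arccos z.re := Real.arccos_pos.2 hr.2
  have a1 : Real.arccos z.re < Real.pi := Real.arccos_lt_pi.2 hr.1
  rw [(Rd_hasFDerivAt h.smooth hr.1 hr.2).fderiv]
  have e1 : RD c z 1 = Ra c z := by simp [RD]
  have e2 : RD c z Complex.I = Rb c z := by simp [RD]
  rw [e1, e2]
  simp only [Ra, Rb, ev, od]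
  set α := Real.arccos z.re
  set s := Real.sin α with hsd
  set x := z.im / s
  have hsep : 2 * k * s ≤ ‖c α - c (-α)‖ := by
    rcases le_total α (Real.pi / 2) with ha | ha
    · have := hb α (-α) (by rw [abs_of_nonneg (by linarith)]; linarith)
      rw [abs_of_nonneg (by linarith)] at this
      have h3 : s ≤ α := Real.sin_le a0.le
      nlinarith
    · have hm : c (-α) = c (2 * Real.pi - α) := by
        rw [← h.per (-α)]; congr 1; ring
      have := hb (2 * Real.pi - α) α (by rw [abs_of_nonneg (by linarith)]; linarith)
      rw [abs_of_nonneg (by linarith), ← hm, norm_sub_rev] at this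
      have h3 : s ≤ Real.pi - α := by
        rw [hsd, ← Real.sin_pi_sub]; exact Real.sin_le (by linarith)
      nlinarith
  have c1 := h.conv α (-α)
  have c2 := h.conv (-α) α
  rw [norm_sub_rev] at c1
  set W := ‖c α - c (-α)‖ with hW
  have hW2 : (2 * k * s) ^ 2 ≤ W ^ 2 := by gcongr
  have e3 : omega0 (deriv c α) (c (-α) - c α) = -omega0 (deriv c α) (c α - c (-α)) := by
    rw [← om_neg_right, neg_sub]
  rw [e3] at c1
  set A := omega0 (deriv c α) (c α - c (-α))
  set B := omega0 (deriv c (-α)) (c α - c (-α))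
  have key : omega0 (-((1 / s) • (1 / 2 : ℝ) • (deriv c α - deriv c (-α)) + x • (1 / s ^ 2) •
      (s • (1 / 2 : ℝ) • (deriv c α + deriv c (-α)) - Real.cos α • (1 / 2 : ℝ) • (c α - c (-α)))))
      ((1 / s) • (1 / 2 : ℝ) • (c α - c (-α)))
      = (1 / (4 * s ^ 2)) * ((1 + x) * (-A) + (1 - x) * B) := by
    simp only [om_neg_left, om_add_left, om_sub_left (deriv c α), om_smul_left, om_smul_right,
      om_sub_left (s • _), om_self]
    change _ = (1 / (4 * s ^ 2)) * ((1 + x) * (-omega0 (deriv c α) (c α - c (-α)))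
      + (1 - x) * omega0 (deriv c (-α)) (c α - c (-α)))
    field_simp
    ring
  rw [key]
  have h4 : 2 * (κ * W ^ 2) ≤ (1 + x) * (-A) + (1 - x) * B := by
    nlinarith [mul_le_mul_of_nonneg_left c1 (show 0 ≤ 1 + x by linarith),
      mul_le_mul_of_nonneg_left c2 (show 0 ≤ 1 - x by linarith)]
  calc 2 * κ * k ^ 2 = (1 / (4 * s ^ 2)) * (2 * (κ * (2 * k * s) ^ 2)) := by field_simp; ring
    _ ≤ (1 / (4 * s ^ 2)) * (2 * (κ * W ^ 2)) := by gcongr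
    _ ≤ _ := by gcongr

theorem Rd_bdry {c : ℝ → E4} (hp : Function.Periodic c (2 * Real.pi)) (θ : ℝ) :
    Rd c (Complex.exp (θ * Complex.I)) = c θ := by
  have hre : (Complex.exp (θ * Complex.I)).re = Real.cos θ := Complex.exp_ofReal_mul_I_re θ
  have him : (Complex.exp (θ * Complex.I)).im = Real.sin θ := Complex.exp_ofReal_mul_I_im θ
  rw [Rd_comb, hre, him]
  set α := Real.arccos (Real.cos θ) with hα
  have hc : Real.cos α = Real.cos θ := Real.cos_arccos (Real.neg_one_le_cos _) (Real.cos_le_one _)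
  have hdeg : Real.sin α = 0 → c (-α) = c α := by
    intro h0
    rcases Real.sin_eq_zero_iff.1 h0 with ⟨n, hn⟩
    rw [← hn, ← hp.int_mul n (-(n * Real.pi))]
    congr 1; ring
  obtain ⟨k, hk⟩ := Real.cos_eq_cos_iff.1 hc
  rcases hk with hk | hk
  · have e1 : c θ = c α := by
      rw [hk, show 2 * (k : ℝ) * Real.pi + α = α + k * (2 * Real.pi) by ring]
      exact hp.int_mul k α
    have e2 : Real.sin θ = Real.sin α := by
      rw [hk, show 2 * (k : ℝ) * Real.pi + α = α + k * (2 * Real.pi) by ring]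
      exact Real.sin_add_int_mul_two_pi α k
    rw [e1, e2]
    rcases eq_or_ne (Real.sin α) 0 with h0 | h0
    · rw [hdeg h0, h0]; simp; module
    · rw [div_self h0]; simp
  · have e1 : c θ = c (-α) := by
      rw [hk, show 2 * (k : ℝ) * Real.pi - α = -α + k * (2 * Real.pi) by ring]
      exact hp.int_mul k (-α)
    have e2 : Real.sin θ = -Real.sin α := by
      rw [hk, show 2 * (k : ℝ) * Real.pi - α = -α + k * (2 * Real.pi) by ring,
        Real.sin_add_int_mul_two_pi, Real.sin_neg]
    rw [e1, e2]
    rcases eq_or_ne (Real.sin α) 0 with h0 | h0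
    · rw [hdeg h0, h0]; simp; module
    · rw [neg_div, div_self h0]; simp

/-- data of an embedded symplectic disk, smooth up to order one at the boundary. -/
structure Dsk (c : ℝ → E4) (P : ℂ → E4) (D : ℂ → ℂ →L[ℝ] E4) : Prop where
  cont : ContinuousOn P (closedBall 0 1)
  dcont : ContinuousOn D (closedBall 0 1)
  der : ∀ z ∈ closedBall (0 : ℂ) 1, HasFDerivWithinAt P (D z) (closedBall 0 1) z
  smooth : ContDiffOn ℝ (⊤ : ℕ∞) P (ball 0 1)
  inj : InjOn P (closedBall 0 1)
  pos : ∀ z ∈ closedBall (0 : ℂ) 1, 0 < omega0 (D z 1) (D z Complex.I)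
  bdry : ∀ θ : ℝ, P (Complex.exp (θ * Complex.I)) = c θ
  comb : ∀ z ∈ closedBall (0 : ℂ) 1, ∃ a ∈ Icc (0 : ℝ) 1, ∃ θ φ : ℝ,
    P z = a • c θ + (1 - a) • c φ

theorem Crv.disk {c : ℝ → E4} {κ : ℝ} (h : Crv c κ) : ∃ P D, Dsk c P D := by
  have hcl : closure (ball (0 : ℂ) 1) = closedBall 0 1 := closure_ball 0 one_ne_zero
  have hlim := fun z (hz : z ∈ closedBall (0 : ℂ) 1) => Rd_lim h.smooth h.per hz
  have hsm : ContDiffOn ℝ (⊤ : ℕ∞) (Rd c) (ball 0 1) := fun z hz =>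
    (Rd_smooth h.smooth (ball_re hz).1 (ball_re hz).2).contDiffWithinAt
  have htend : ∀ z ∈ closedBall (0 : ℂ) 1, Tendsto (fun z => fderiv ℝ (Rd c) z) (𝓝[ball 0 1] z)
      (𝓝 (extendFrom (ball 0 1) (fderiv ℝ (Rd c)) z)) := fun z hz => tendsto_extendFrom (hlim z hz)
  have hdc : ContinuousOn (extendFrom (ball 0 1) (fderiv ℝ (Rd c))) (closedBall 0 1) :=
    continuousOn_extendFrom hcl.ge hlim
  refine ⟨Rd c, extendFrom (ball 0 1) (fderiv ℝ (Rd c)), ⟨Rd_cont h.smooth h.per, hdc, ?_, hsm,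
    h.Rd_inj, ?_, Rd_bdry h.per, ?_⟩⟩
  · intro z hz
    have := hasFDerivWithinAt_closure_of_tendsto_fderiv (f := Rd c) (s := ball 0 1) (x := z)
      (hsm.differentiableOn (by simp)) (convex_ball 0 1) isOpen_ball (fun y hy =>
        (Rd_cont h.smooth h.per y (hcl ▸ hy)).mono ball_subset_closedBall) (htend z hz)
    rwa [hcl] at this
  · intro z hz
    obtain ⟨m, hm, hb⟩ := h.Rd_om
    have hcts : Continuous fun L : ℂ →L[ℝ] E4 => omega0 (L 1) (L Complex.I) := by
      have h1 : Continuous fun L : ℂ →L[ℝ] E4 => (L 1, L Complex.I) := by fun_prop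
      exact om_continuous.comp h1
    have ht := (hcts.tendsto _).comp (htend z hz)
    have hne : (𝓝[ball (0 : ℂ) 1] z).NeBot := mem_closure_iff_nhdsWithin_neBot.1 (hcl ▸ hz)
    refine hm.trans_le (ge_of_tendsto ht ?_)
    filter_upwards [self_mem_nhdsWithin] with w hw using hb w hw
  · intro z hz
    have l1 := abs_le.1 (lam_le hz)
    refine ⟨(1 + z.im / Real.sin (Real.arccos z.re)) / 2, ⟨by linarith, by linarith⟩,
      Real.arccos z.re, -Real.arccos z.re, ?_⟩
    rw [Rd_comb]
    congr 2; ring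

end Hopf

namespace Hopf
open Filter Topology

/-- closed orbit reparametrized over the circle of length `2π`. -/
structure Loop (G : E4 → ℝ) (c : ℝ → E4) (k : ℝ) : Prop where
  smooth : ContDiff ℝ (⊤ : ℕ∞) c
  per : Function.Periodic c (2 * Real.pi)
  kpos : 0 < k
  der : ∀ θ, HasDerivAt c (k • J0 (grd G (c θ))) θ
  one : ∀ θ, G (c θ) = 1
  inj : ∀ θ t, 0 < t → t < 2 * Real.pi → c (θ + t) ≠ c θ

theorem Orb.loop {G : E4 → ℝ} (h : GoodG G) {γ : ℝ → E4} (o : Orb G γ) {T : ℝ} (hT : 0 < T)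
    (hc : γ T = γ 0) (hmin : ∀ T', 0 < T' → Function.Periodic γ T' → T ≤ T') :
    Loop G (fun θ => γ (T / (2 * Real.pi) * θ)) (T / (2 * Real.pi)) := by
  have hpi := Real.pi_pos
  have hk : 0 < T / (2 * Real.pi) := by positivity
  have hper : Function.Periodic γ T := by
    have := o.periodic_of_eq h hc.symm; rwa [sub_zero] at this
  refine ⟨(Orb.smooth h o).comp (contDiff_const.mul contDiff_id), ?_, hk, ?_, fun θ => o.one _, ?_⟩
  · intro θ
    have : T / (2 * Real.pi) * (θ + 2 * Real.pi) = T / (2 * Real.pi) * θ + T := by field_simp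
    simp only [this]
    exact hper _
  · intro θ
    have h1 : HasDerivAt (fun θ : ℝ => T / (2 * Real.pi) * θ) (T / (2 * Real.pi)) θ := by
      simpa using (hasDerivAt_id θ).const_mul (T / (2 * Real.pi))
    exact (o.der (T / (2 * Real.pi) * θ)).scomp θ h1
  · intro θ t h1 h2 he
    have h3 := o.periodic_of_eq h he.symm
    have h4 := hmin _ (by rw [mul_add, add_sub_cancel_left]; positivity) h3
    rw [mul_add, add_sub_cancel_left, div_mul_eq_mul_div, le_div_iff₀ (by positivity)] at h4
    nlinarith

theorem Loop.deriv_eq {G : E4 → ℝ} {c : ℝ → E4} {k : ℝ} (l : Loop G c k) (θ : ℝ) :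
    deriv c θ = k • J0 (grd G (c θ)) := (l.der θ).deriv

theorem Loop.om {G : E4 → ℝ} (h : GoodG G) {c : ℝ → E4} {k : ℝ} (l : Loop G c k) (θ : ℝ) :
    omega0 (c θ) (deriv c θ) = 2 * k := by
  rw [l.deriv_eq, om_smul_right, om_J0_right, real_inner_comm, h.euler, l.one]; ring

theorem Loop.dne {G : E4 → ℝ} (h : GoodG G) {c : ℝ → E4} {k : ℝ} (l : Loop G c k) (θ : ℝ) :
    deriv c θ ≠ 0 := by
  intro h0
  have := l.om h θ
  rw [h0, om_zero_right] at this
  linarith [l.kpos]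

theorem orbit_crv {G : E4 → ℝ} (h : GoodG G) {ε : ℝ} (hε : 0 < ε) {δ : ℝ → E4} {S : ℝ} (hS : 0 < S)
    (o : Orb (Gp G ε) δ) (hc : δ S = δ 0) (P : Poly (Gp G ε) S) :
    Loop (Gp G ε) (fun θ => δ (S / (2 * Real.pi) * θ)) (S / (2 * Real.pi)) ∧
    Crv (fun θ => δ (S / (2 * Real.pi) * θ)) (S / (2 * Real.pi) * ε) := by
  have hpi := Real.pi_pos
  have hg := h.gp hε.le
  have hper : Function.Periodic δ S := by
    have := o.periodic_of_eq hg hc.symm; rwa [sub_zero] at this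
  have hl := o.loop hg hS hc (fun T' h1 h2 => P.le_period hg hg (fun x => le_rfl) hS o h1
    (by simpa using h2 0))
  refine ⟨hl, ⟨hl.smooth, hl.per, mul_pos hl.kpos hε, ?_, ?_, hl.dne hg⟩⟩
  · intro θ φ
    rw [hl.deriv_eq, om_smul_left, mul_assoc]
    refine mul_le_mul_of_nonneg_left ?_ hl.kpos.le
    have h1 := h.strong hε.le (δ (S / (2 * Real.pi) * φ)) (δ (S / (2 * Real.pi) * θ))
    rw [o.one, o.one] at h1
    simp only [omega0, J0_J0, inner_neg_left]
    linarith
  · intro r s t h1 h2 h3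
    have hk := hl.kpos
    have h4 := P.triangle hg hS (o.shift (S / (2 * Real.pi) * r))
      (by rw [zero_add, add_comm]; exact hper _)
      (a := S / (2 * Real.pi) * (s - r)) (b := S / (2 * Real.pi) * (t - r))
      (mul_pos hk (by linarith)) (mul_lt_mul_of_pos_left (by linarith) hk)
      (by
        calc S / (2 * Real.pi) * (t - r) < S / (2 * Real.pi) * (2 * Real.pi) :=
              mul_lt_mul_of_pos_left (by linarith) hk
          _ = S := by field_simp)
      (by
        intro he
        have h5 := h.grd_gp_inj hε he
        have h6 := hl.inj r (s - r) (by linarith) (by linarith)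
        apply h6
        simp only [zero_add] at h5
        rw [h5]; congr 1; ring)
    simp only [zero_add] at h4
    rw [show S / (2 * Real.pi) * (s - r) + S / (2 * Real.pi) * r = S / (2 * Real.pi) * s by ring,
      show S / (2 * Real.pi) * (t - r) + S / (2 * Real.pi) * r = S / (2 * Real.pi) * t by ring] at h4
    exact h4

theorem periodic_bound {f : ℝ → ℝ} (hp : Function.Periodic f (2 * Real.pi)) {η : ℝ}
    (hb : ∀ r ∈ Icc (0 : ℝ) 1, f (2 * Real.pi * r) ≤ η) (θ : ℝ) : f θ ≤ η := by
  have hpi := Real.pi_pos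
  obtain ⟨y, hy, he⟩ := hp.exists_mem_Ico₀ (by positivity) θ
  rw [he]
  have := hb (y / (2 * Real.pi)) ⟨div_nonneg hy.1 (by positivity),
    (div_le_one (by positivity)).2 hy.2.le⟩
  rwa [mul_div_cancel₀ _ (by positivity)] at this

/-- The approximating disk datum. -/
structure Apx (G : E4 → ℝ) (c : ℝ → E4) (η : ℝ) (H : E4 → ℝ) (p : ℝ → E4) (l : ℝ) (P : ℂ → E4)
    (D : ℂ → ℂ →L[ℝ] E4) : Prop where
  good : GoodG H
  le : ∀ x, G x ≤ H x
  loop : Loop H p l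
  dsk : Dsk p P D
  near : ∀ θ, ‖p θ - c θ‖ ≤ η
  dnear : ∀ θ, ‖deriv p θ - deriv c θ‖ ≤ η

theorem periodic_deriv {c : ℝ → E4} {a : ℝ} (hp : Function.Periodic c a) :
    Function.Periodic (deriv c) a := by
  intro x
  rw [← deriv_comp_add_const]
  congr 1
  funext y; exact hp y

theorem GoodG.approx2 {G : E4 → ℝ} (h : GoodG G) : ∃ (γ : ℝ → E4) (T : ℝ) (c : ℝ → E4) (k : ℝ),
    0 < T ∧ Orb G γ ∧ γ T = γ 0 ∧
    (∀ (δ : ℝ → E4) (T' : ℝ), Orb G δ → 0 < T' → δ T' = δ 0 → T ≤ T') ∧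
    Loop G c k ∧ range c = range γ ∧
    ∀ η : ℝ, 0 < η → ∃ H p l P D, Apx G c η H p l P D := by
  have hpi := Real.pi_pos
  obtain ⟨γ, T, hT, o, hc, hmin, happ⟩ := h.approx
  have hl := o.loop h hT hc (fun T' h1 h2 => hmin γ T' o h1 (by simpa using h2 0))
  refine ⟨γ, T, _, _, hT, o, hc, hmin, hl, ?_, ?_⟩
  · ext x
    constructor
    · rintro ⟨θ, rfl⟩; exact ⟨_, rfl⟩
    · rintro ⟨t, rfl⟩
      refine ⟨2 * Real.pi / T * t, ?_⟩
      simp only []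
      congr 1; field_simp
  · intro η hη
    obtain ⟨ε, δ, S, hε, hS, od, hcd, P, hn⟩ := happ η hη
    obtain ⟨l1, cr⟩ := orbit_crv h hε hS od hcd P
    obtain ⟨Q, D, hD⟩ := cr.disk
    refine ⟨_, _, _, Q, D, ⟨h.gp hε.le, GoodG.le_gp hε.le, l1, hD, ?_, ?_⟩⟩
    · intro θ
      refine periodic_bound (f := fun θ => ‖δ (S / (2 * Real.pi) * θ) - γ (T / (2 * Real.pi) * θ)‖)
        ?_ ?_ θ
      · intro x
        have e1 := l1.per x
        have e2 := hl.per x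
        simp only [] at e1 e2 ⊢
        rw [e1, e2]
      · intro r hr
        have e1 : ∀ U : ℝ, U / (2 * Real.pi) * (2 * Real.pi * r) = U * r := fun U => by field_simp
        simp only [e1]
        exact (hn r hr).1
    · intro θ
      refine periodic_bound (f := fun x => ‖deriv (fun θ => δ (S / (2 * Real.pi) * θ)) x
        - deriv (fun θ => γ (T / (2 * Real.pi) * θ)) x‖) ?_ ?_ θ
      · intro x
        have e1 := periodic_deriv l1.per x
        have e2 := periodic_deriv hl.per x
        simp only [] at e1 e2 ⊢
        rw [e1, e2]
      · intro r hr
        have e1 : ∀ U : ℝ, U / (2 * Real.pi) * (2 * Real.pi * r) = U * r := fun U => by field_simp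
        simp only [l1.deriv_eq, hl.deriv_eq, e1]
        have e2 := (hn r hr).2
        have e3 : (S / (2 * Real.pi)) • J0 (grd (Gp G ε) (δ (S * r)))
            - (T / (2 * Real.pi)) • J0 (grd G (γ (T * r))) = (1 / (2 * Real.pi)) •
            (S • J0 (grd (Gp G ε) (δ (S * r))) - T • J0 (grd G (γ (T * r)))) := by module
        rw [e3, norm_smul, Real.norm_of_nonneg (by positivity)]
        refine (mul_le_of_le_one_left (norm_nonneg _) ?_).trans e2
        rw [div_le_one (by positivity)]
        linarith [Real.pi_gt_three]

end Hopf

namespace Hopf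
open Filter Topology

/-- radial profile -/
structure Prf (φ : ℝ → ℝ) (m : ℝ) : Prop where
  smooth : ContDiff ℝ (⊤ : ℕ∞) φ
  half : ∀ s ≤ 0, φ s = 1 / 2
  one : φ 1 = 1
  mono : Monotone φ
  lt : ∀ s < 1, φ s < 1
  mpos : 0 < m
  dge : ∀ s ∈ Icc (1 / 3 : ℝ) 1, m ≤ deriv φ s

theorem exists_prf : ∃ φ m, Prf φ m := by
  have hE1 : expNegInvGlue 1 = Real.exp (-1) := by simp [expNegInvGlue]
  have hE1p : 0 < expNegInvGlue 1 := expNegInvGlue.pos_of_pos one_pos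
  refine ⟨fun s => 1 / 2 + 1 / 2 * (expNegInvGlue s / expNegInvGlue 1),
    1 / 2 * (Real.exp (-3) / expNegInvGlue 1), ⟨?_, ?_, ?_, ?_, ?_, by positivity, ?_⟩⟩
  · exact contDiff_const.add (contDiff_const.mul (expNegInvGlue.contDiff.div_const _))
  · intro s hs
    simp [expNegInvGlue.zero_of_nonpos hs]
  · field_simp; norm_num
  · intro s t hst
    have := expNegInvGlue.monotone hst
    simp only []
    gcongr
  · intro s hs
    have : expNegInvGlue s < expNegInvGlue 1 := by
      rcases le_or_gt s 0 with h | h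
      · rw [expNegInvGlue.zero_of_nonpos h]; exact hE1p
      · rw [hE1]
        simp only [expNegInvGlue, not_le.2 h, if_false]
        apply Real.exp_lt_exp.2
        rw [neg_lt_neg_iff]
        exact (one_lt_inv₀ h).2 hs
    have h2 : expNegInvGlue s / expNegInvGlue 1 < 1 := (div_lt_one hE1p).2 this
    linarith
  · intro s hs
    have hs0 : 0 < s := by linarith [hs.1]
    have h1 : HasDerivAt expNegInvGlue (Real.exp (-s⁻¹) * (s ^ 2)⁻¹) s := by
      have h2 : HasDerivAt (fun x : ℝ => Real.exp (-x⁻¹)) (Real.exp (-s⁻¹) * (s ^ 2)⁻¹) s := by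
        have := ((hasDerivAt_inv hs0.ne').neg).exp
        simpa using this
      refine h2.congr_of_eventuallyEq ?_
      filter_upwards [Ioi_mem_nhds hs0] with x hx
      simp only [expNegInvGlue, not_le.2 (show 0 < x from hx), if_false]
    have h3 := ((h1.div_const (expNegInvGlue 1)).const_mul (1 / 2 : ℝ)).const_add (1 / 2)
    rw [h3.deriv]
    have h4 : Real.exp (-3) ≤ Real.exp (-s⁻¹) := by
      apply Real.exp_le_exp.2
      rw [neg_le_neg_iff]
      rw [inv_le_comm₀ hs0 (by norm_num)]
      linarith [hs.1]
    have h5 : 1 ≤ (s ^ 2)⁻¹ := (one_le_inv₀ (by positivity)).2 (by nlinarith [hs.2])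
    gcongr
    calc Real.exp (-3) = Real.exp (-3) * 1 := by ring
      _ ≤ _ := by gcongr

theorem Prf.ge_half {φ : ℝ → ℝ} {m : ℝ} (h : Prf φ m) (s : ℝ) : 1 / 2 ≤ φ s := by
  rcases le_total s 0 with h1 | h1
  · exact (h.half s h1).ge
  · rw [← h.half 0 le_rfl]; exact h.mono h1

theorem Prf.le_one {φ : ℝ → ℝ} {m : ℝ} (h : Prf φ m) {s : ℝ} (hs : s ≤ 1) : φ s ≤ 1 := by
  rw [← h.one]; exact h.mono hs

theorem Prf.der {φ : ℝ → ℝ} {m : ℝ} (h : Prf φ m) (s : ℝ) : HasDerivAt φ (deriv φ s) s :=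
  ((h.smooth.differentiable (by simp)) s).hasDerivAt

theorem Prf.dnonneg {φ : ℝ → ℝ} {m : ℝ} (h : Prf φ m) (s : ℝ) : 0 ≤ deriv φ s :=
  h.mono.deriv_nonneg

theorem Prf.dzero {φ : ℝ → ℝ} {m : ℝ} (h : Prf φ m) {s : ℝ} (hs : s ≤ 0) : deriv φ s = 0 := by
  apply IsLocalMin.deriv_eq_zero
  refine Eventually.of_forall fun x => ?_
  rw [h.half s hs]; exact h.ge_half x

theorem Prf.sep {φ : ℝ → ℝ} {m : ℝ} (h : Prf φ m) {s t : ℝ} (hs : s ∈ Icc (1 / 3 : ℝ) 1)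
    (ht : t ∈ Icc (1 / 3 : ℝ) 1) : m * |s - t| ≤ |φ s - φ t| := by
  have key : ∀ s ∈ Icc (1 / 3 : ℝ) 1, ∀ t ∈ Icc (1 / 3 : ℝ) 1, s ≤ t → m * (t - s) ≤ φ t - φ s := by
    intro s hs t ht hst
    have := (convex_Icc (1 / 3 : ℝ) 1).mul_sub_le_image_sub_of_le_deriv (f := φ) (C := m)
      h.smooth.continuous.continuousOn ((h.smooth.differentiable (by simp)).differentiableOn)
      (fun x hx => h.dge x (interior_subset hx)) s hs t ht hst
    exact this
  rcases le_total s t with h1 | h1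
  · rw [abs_sub_comm s t, abs_sub_comm (φ s), abs_of_nonneg (by linarith),
      abs_of_nonneg (by linarith [h.mono h1])]
    exact key s hs t ht h1
  · rw [abs_of_nonneg (by linarith), abs_of_nonneg (by linarith [h.mono h1])]
    exact key t ht s hs h1

/-- extension of a loop to the punctured plane -/
noncomputable def hatc (c : ℝ → E4) (w : ℂ) : E4 := c (Complex.arg w)

theorem hatc_polar {c : ℝ → E4} (hp : Function.Periodic c (2 * Real.pi)) {r : ℝ} (hr : 0 < r)
    (θ : ℝ) : hatc c (r * Complex.exp (θ * Complex.I)) = c θ := by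
  rw [hatc, Complex.arg_real_mul _ hr, Complex.arg_exp_mul_I]
  exact hp.sub_zsmul_eq _

theorem polar (w : ℂ) : w = (‖w‖ : ℝ) * Complex.exp (w.arg * Complex.I) :=
  (Complex.norm_mul_exp_arg_mul_I w).symm

theorem hatc_smooth {c : ℝ → E4} (hs : ContDiff ℝ (⊤ : ℕ∞) c)
    (hp : Function.Periodic c (2 * Real.pi)) {w : ℂ} (hw : w ≠ 0) :
    ContDiffAt ℝ (⊤ : ℕ∞) (hatc c) w := by
  have h1 : ∀ z : ℂ, z ≠ 0 → hatc c z = c ((Complex.log (z * w⁻¹)).im + w.arg) := by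
    intro z hz
    have hzw : z * w⁻¹ ≠ 0 := mul_ne_zero hz (inv_ne_zero hw)
    have e : z = ((‖z * w⁻¹‖ * ‖w‖ : ℝ)) *
        Complex.exp ((((z * w⁻¹).arg + w.arg : ℝ)) * Complex.I) := by
      calc z = (z * w⁻¹) * w := by field_simp
        _ = ((‖z * w⁻¹‖ : ℝ) * Complex.exp ((z * w⁻¹).arg * Complex.I)) *
            ((‖w‖ : ℝ) * Complex.exp (w.arg * Complex.I)) := by
            rw [← polar (z * w⁻¹), ← polar w]
        _ = _ := by
            push_cast
            rw [add_mul, Complex.exp_add]; ring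
    rw [Complex.log_im]
    conv_lhs => rw [e]
    exact hatc_polar hp (by positivity) _
  have h2 : ContDiffAt ℝ (⊤ : ℕ∞) (fun z => c ((Complex.log (z * w⁻¹)).im + w.arg)) w := by
    have a1 : ContDiffAt ℝ (⊤ : ℕ∞) (fun z : ℂ => z * w⁻¹) w := contDiffAt_id.mul contDiffAt_const
    have a2 : ContDiffAt ℝ (⊤ : ℕ∞) Complex.log (w * w⁻¹) := by
      refine (Complex.contDiffAt_log ?_).restrict_scalars ℝ
      rw [mul_inv_cancel₀ hw]; exact Complex.one_mem_slitPlane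
    have a3 := Complex.imCLM.contDiff.contDiffAt.comp w (a2.comp w a1)
    exact hs.contDiffAt.comp w (a3.add contDiffAt_const)
  refine h2.congr_of_eventuallyEq ?_
  filter_upwards [isOpen_ne.mem_nhds hw] with z hz using h1 z hz

theorem om_rot (L : ℂ →L[ℝ] E4) (w : ℂ) :
    omega0 (L w) (L (Complex.I * w)) = (w.re ^ 2 + w.im ^ 2) * omega0 (L 1) (L Complex.I) := by
  have e1 : L w = w.re • L 1 + w.im • L Complex.I := by
    rw [← map_smul, ← map_smul, ← map_add]
    congr 1
    apply Complex.ext <;> simp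
  have e2 : L (Complex.I * w) = (-w.im) • L 1 + w.re • L Complex.I := by
    rw [← map_smul, ← map_smul, ← map_add]
    congr 1
    apply Complex.ext <;> simp
  rw [e1, e2]
  simp only [om_add_left, om_add_right, om_smul_left, om_smul_right, om_self]
  rw [om_antisymm (L Complex.I) (L 1)]
  ring

theorem sq_pos_of_ne {w : ℂ} (hw : w ≠ 0) : 0 < w.re ^ 2 + w.im ^ 2 := by
  have := Complex.normSq_pos.2 hw
  rw [Complex.normSq_apply] at this
  nlinarith

theorem inj_of_om {L : ℂ →L[ℝ] E4} (h : 0 < omega0 (L 1) (L Complex.I)) :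
    Function.Injective L := by
  rw [injective_iff_map_eq_zero]
  intro v hv
  by_contra hne
  have h1 := om_rot L v
  rw [hv, om_zero_left] at h1
  have := mul_pos (sq_pos_of_ne hne) h
  linarith

theorem tendsto_scalar {x : ℕ → E4} {a : ℕ → ℝ} {x0 y : E4} (hx : Tendsto x atTop (𝓝 x0))
    (h0 : x0 ≠ 0) (hy : Tendsto (fun n => a n • x n) atTop (𝓝 y)) :
    ∃ a0, Tendsto a atTop (𝓝 a0) ∧ y = a0 • x0 := by
  have h1 : Tendsto (fun n => ⟪x n, a n • x n⟫_ℝ / ‖x n‖ ^ 2) atTop (𝓝 (⟪x0, y⟫_ℝ / ‖x0‖ ^ 2)) :=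
    (hx.inner hy).div (hx.norm.pow 2) (by simpa using h0)
  have h2 : Tendsto a atTop (𝓝 (⟪x0, y⟫_ℝ / ‖x0‖ ^ 2)) := by
    refine h1.congr' ?_
    filter_upwards [hx.eventually (isOpen_ne.mem_nhds h0)] with n hn
    have hn' : x n ≠ 0 := hn
    rw [inner_smul_right, real_inner_self_eq_norm_sq]
    have : ‖x n‖ ≠ 0 := norm_ne_zero_iff.2 hn'
    field_simp
  exact ⟨_, h2, tendsto_nhds_unique hy (h2.smul hx)⟩

/-- strict differentiability up to the boundary -/
theorem Dsk.strict {p : ℝ → E4} {P : ℂ → E4} {D : ℂ → ℂ →L[ℝ] E4} (d : Dsk p P D) {z : ℂ}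
    (hz : z ∈ closedBall (0 : ℂ) 1) {ε : ℝ} (hε : 0 < ε) :
    ∃ δ > 0, ∀ x ∈ closedBall (0 : ℂ) 1, ∀ y ∈ closedBall (0 : ℂ) 1, x ∈ ball z δ → y ∈ ball z δ →
      ‖P y - P x - D z (y - x)‖ ≤ ε * ‖y - x‖ := by
  obtain ⟨δ, hδ, hb⟩ := Metric.continuousWithinAt_iff.1 (d.dcont z hz) ε hε
  refine ⟨δ, hδ, fun x hx y hy hxz hyz => ?_⟩
  refine Convex.norm_image_sub_le_of_norm_hasFDerivWithin_le' (s := closedBall 0 1 ∩ ball z δ)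
    (f' := D) (fun w hw => (d.der w hw.1).mono inter_subset_left) (fun w hw => ?_)
    ((convex_closedBall 0 1).inter (convex_ball z δ)) ⟨hx, hxz⟩ ⟨hy, hyz⟩
  rw [← dist_eq_norm]
  exact (hb hw.1 hw.2).le

theorem hasDerivAt_circle (r θ : ℝ) : HasDerivAt (fun θ : ℝ => (r : ℂ) * Complex.exp (θ * Complex.I))
    (Complex.I * (r * Complex.exp (θ * Complex.I))) θ := by
  have h1 : HasDerivAt (fun θ : ℝ => (θ : ℂ) * Complex.I) Complex.I θ := by
    simpa using (Complex.ofRealCLM.hasDerivAt (x := θ)).mul_const Complex.I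
  have := (h1.cexp).const_mul (r : ℂ)
  refine this.congr_deriv ?_
  ring

theorem circle_mem {r : ℝ} (h0 : 0 ≤ r) (h1 : r ≤ 1) (θ : ℝ) :
    (r : ℂ) * Complex.exp (θ * Complex.I) ∈ closedBall (0 : ℂ) 1 := by
  rw [mem_closedBall_zero_iff, norm_mul, Complex.norm_exp_ofReal_mul_I, Complex.norm_real,
    Real.norm_of_nonneg h0, mul_one]
  exact h1

theorem Dsk.der_circle {p : ℝ → E4} {P : ℂ → E4} {D : ℂ → ℂ →L[ℝ] E4} (d : Dsk p P D) {r : ℝ}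
    (h0 : 0 ≤ r) (h1 : r ≤ 1) (θ : ℝ) :
    HasDerivAt (fun θ : ℝ => P (r * Complex.exp (θ * Complex.I)))
      (D (r * Complex.exp (θ * Complex.I)) (Complex.I * (r * Complex.exp (θ * Complex.I)))) θ := by
  have := (d.der _ (circle_mem h0 h1 θ)).comp_hasDerivWithinAt (s := univ) θ
    (hasDerivAt_circle r θ).hasDerivWithinAt (fun x _ => circle_mem h0 h1 x)
  exact hasDerivWithinAt_univ.1 this

theorem Dsk.bdry_der {p : ℝ → E4} {P : ℂ → E4} {D : ℂ → ℂ →L[ℝ] E4} (d : Dsk p P D) (θ : ℝ) :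
    D (Complex.exp (θ * Complex.I)) (Complex.I * Complex.exp (θ * Complex.I)) = deriv p θ := by
  have h1 := d.der_circle zero_le_one le_rfl θ
  simp only [Complex.ofReal_one, one_mul] at h1
  have : (fun θ : ℝ => P (Complex.exp (θ * Complex.I))) = p := funext d.bdry
  rw [this] at h1
  exact h1.deriv.symm

theorem sphere_exp {z : ℂ} (hz : ‖z‖ = 1) : z = Complex.exp (z.arg * Complex.I) := by
  have := polar z
  rwa [hz, Complex.ofReal_one, one_mul] at this

section
variable {G : E4 → ℝ} {c : ℝ → E4} {η : ℝ} {H : E4 → ℝ} {p : ℝ → E4} {l : ℝ} {P : ℂ → E4}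
  {D : ℂ → ℂ →L[ℝ] E4}

theorem Apx.H_le (a : Apx G c η H p l P D) {z : ℂ} (hz : z ∈ closedBall (0 : ℂ) 1) : H (P z) ≤ 1 := by
  obtain ⟨t, ht, θ, φ, e⟩ := a.dsk.comb z hz
  rw [e]
  have := a.good.conv.2 (mem_univ (p θ)) (mem_univ (p φ)) ht.1 (sub_nonneg.2 ht.2) (by ring)
  rw [a.loop.one, a.loop.one] at this
  simp only [smul_eq_mul] at this
  linarith

theorem Apx.G_le (a : Apx G c η H p l P D) {z : ℂ} (hz : z ∈ closedBall (0 : ℂ) 1) : G (P z) ≤ 1 :=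
  (a.le _).trans (a.H_le hz)

theorem Apx.lemL (a : Apx G c η H p l P D) : ∃ τ > 0, ∀ z1 ∈ closedBall (0 : ℂ) 1,
    ∀ z2 ∈ closedBall (0 : ℂ) 1, ∀ κ : ℝ, 1 ≤ κ → ‖z1‖ ≤ ‖z2‖ → 1 - τ ≤ ‖z2‖ ^ 2 →
      P z1 = κ • P z2 → z1 = z2 := by
  by_contra! hcon
  have hpos : ∀ n : ℕ, (0 : ℝ) < 1 / ((n : ℝ) + 1) := fun n => by positivity
  choose x hx y hy κ hκ hle hge he hne using fun n : ℕ => hcon _ (hpos n)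
  set v : ℕ → ℂ := fun n => (‖x n - y n‖)⁻¹ • (x n - y n) with hv
  have hnpos : ∀ n, 0 < ‖x n - y n‖ := fun n => norm_pos_iff.2 (sub_ne_zero.2 (hne n))
  have hv1 : ∀ n, v n ∈ sphere (0 : ℂ) 1 := by
    intro n
    rw [mem_sphere_zero_iff_norm, hv]
    simp only [norm_smul, norm_inv, norm_norm]
    exact inv_mul_cancel₀ (hnpos n).ne'
  have hK : IsCompact ((closedBall (0 : ℂ) 1) ×ˢ ((closedBall (0 : ℂ) 1) ×ˢ (sphere (0 : ℂ) 1))) :=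
    (isCompact_closedBall 0 1).prod ((isCompact_closedBall 0 1).prod (isCompact_sphere 0 1))
  obtain ⟨⟨x0, y0, v0⟩, hmem, σ, hσ, hlim⟩ := hK.tendsto_subseq (x := fun n => (x n, y n, v n))
    (fun n => ⟨hx n, hy n, hv1 n⟩)
  have hx0 : x0 ∈ closedBall (0 : ℂ) 1 := hmem.1
  have hy0 : y0 ∈ closedBall (0 : ℂ) 1 := hmem.2.1
  have hv0 : ‖v0‖ = 1 := mem_sphere_zero_iff_norm.1 hmem.2.2
  have lx : Tendsto (fun n => x (σ n)) atTop (𝓝 x0) := (continuous_fst.tendsto _).comp hlim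
  have ly : Tendsto (fun n => y (σ n)) atTop (𝓝 y0) :=
    ((continuous_fst.comp continuous_snd).tendsto _).comp hlim
  have lv : Tendsto (fun n => v (σ n)) atTop (𝓝 v0) :=
    ((continuous_snd.comp continuous_snd).tendsto _).comp hlim
  -- the limit is on the circle
  have hy1 : ‖y0‖ = 1 := by
    have h1 : Tendsto (fun n => ‖y (σ n)‖ ^ 2) atTop (𝓝 (‖y0‖ ^ 2)) := ly.norm.pow 2
    have h2 : Tendsto (fun n => 1 - 1 / ((σ n : ℝ) + 1)) atTop (𝓝 (1 - 0)) :=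
      (tendsto_const_nhds.sub ((tendsto_one_div_add_atTop_nhds_zero_nat (𝕜 := ℝ)).comp hσ.tendsto_atTop))
    have h3 := le_of_tendsto_of_tendsto' h2 h1 (fun n => hge (σ n))
    have h4 : ‖y0‖ ≤ 1 := by simpa using hy0
    nlinarith [norm_nonneg y0]
  have hyexp := sphere_exp hy1
  set θ := y0.arg
  have hPy : P y0 = p θ := by rw [hyexp]; exact a.dsk.bdry θ
  have hPne : P y0 ≠ 0 := by
    rw [hPy]; intro h0
    have := a.loop.one θ
    rw [h0, a.good.zero] at this
    norm_num at this
  have lPx : Tendsto (fun n => P (x (σ n))) atTop (𝓝 (P x0)) :=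
    (a.dsk.cont x0 hx0).tendsto.comp (tendsto_nhdsWithin_iff.2 ⟨lx, Eventually.of_forall fun n => hx _⟩)
  have lPy : Tendsto (fun n => P (y (σ n))) atTop (𝓝 (P y0)) :=
    (a.dsk.cont y0 hy0).tendsto.comp (tendsto_nhdsWithin_iff.2 ⟨ly, Eventually.of_forall fun n => hy _⟩)
  -- the limits coincide
  have hxy : x0 = y0 := by
    have h1 : Tendsto (fun n => κ (σ n) • P (y (σ n))) atTop (𝓝 (P x0)) :=
      lPx.congr fun n => he (σ n)
    obtain ⟨k0, hk0, e0⟩ := tendsto_scalar lPy hPne h1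
    have hk1 : 1 ≤ k0 := ge_of_tendsto' hk0 fun n => hκ (σ n)
    have h2 := a.H_le hx0
    rw [e0, a.good.hom _ (by linarith), hPy, a.loop.one] at h2
    have h3 : k0 = 1 := by nlinarith
    rw [h3, one_smul] at e0
    exact a.dsk.inj hx0 hy0 e0
  -- difference quotients
  have hq : ∀ n, ((κ n - 1) / ‖x n - y n‖) • P (y n) = (‖x n - y n‖)⁻¹ • (P (x n) - P (y n)) := by
    intro n
    rw [he n, div_eq_inv_mul]; module
  have lq : Tendsto (fun n => ((κ (σ n) - 1) / ‖x (σ n) - y (σ n)‖) • P (y (σ n))) atTop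
      (𝓝 (D y0 v0)) := by
    have h1 : Tendsto (fun n => D y0 (v (σ n))) atTop (𝓝 (D y0 v0)) :=
      ((D y0).continuous.tendsto _).comp lv
    have h2 : Tendsto (fun n => ((κ (σ n) - 1) / ‖x (σ n) - y (σ n)‖) • P (y (σ n))
        - D y0 (v (σ n))) atTop (𝓝 0) := by
      rw [Metric.tendsto_nhds]
      intro ε hε
      obtain ⟨δ, hδ, hb⟩ := a.dsk.strict hy0 (half_pos hε)
      filter_upwards [(hxy ▸ lx).eventually (ball_mem_nhds y0 hδ), ly.eventually (ball_mem_nhds y0 hδ)]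
        with n h1 h2
      have h3 := hb _ (hy (σ n)) _ (hx (σ n)) h2 h1
      rw [dist_zero_right, hq]
      have e : (‖x (σ n) - y (σ n)‖)⁻¹ • (P (x (σ n)) - P (y (σ n))) - D y0 (v (σ n))
          = (‖x (σ n) - y (σ n)‖)⁻¹ • (P (x (σ n)) - P (y (σ n)) - D y0 (x (σ n) - y (σ n))) := by
        have e1 : v (σ n) = (‖x (σ n) - y (σ n)‖)⁻¹ • (x (σ n) - y (σ n)) := rfl
        rw [e1, map_smul, ← smul_sub]
      rw [e, norm_smul, norm_inv, norm_norm]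
      calc _ ≤ (‖x (σ n) - y (σ n)‖)⁻¹ * (ε / 2 * ‖x (σ n) - y (σ n)‖) := by gcongr
        _ = ε / 2 := by have := (hnpos (σ n)).ne'; field_simp
        _ < ε := by linarith
    have := h2.add h1
    simpa using this
  obtain ⟨a0, ha0, e0⟩ := tendsto_scalar lPy hPne lq
  have ha0' : 0 ≤ a0 := ge_of_tendsto' ha0 fun n =>
    div_nonneg (by linarith [hκ (σ n)]) (norm_nonneg _)
  -- the direction points inwards
  have hin : y0.re * v0.re + y0.im * v0.im ≤ 0 := by
    have hc : Continuous fun q : ℂ × ℂ => q.1.re * q.2.re + q.1.im * q.2.im := by fun_prop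
    have := (hc.tendsto (y0, v0)).comp (ly.prodMk_nhds lv)
    refine le_of_tendsto' this fun n => ?_
    simp only [Function.comp_apply, hv]
    have h1 := hle (σ n)
    have h2 := pow_le_pow_left₀ (norm_nonneg _) h1 2
    rw [Complex.sq_norm, Complex.sq_norm, Complex.normSq_apply, Complex.normSq_apply] at h2
    have h3 : (y (σ n)).re * ((x (σ n)).re - (y (σ n)).re)
        + (y (σ n)).im * ((x (σ n)).im - (y (σ n)).im) ≤ 0 := by
      nlinarith [sq_nonneg ((x (σ n)).re - (y (σ n)).re), sq_nonneg ((x (σ n)).im - (y (σ n)).im)]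
    have h4 := mul_nonpos_of_nonneg_of_nonpos (inv_nonneg.2 (norm_nonneg (x (σ n) - y (σ n)))) h3
    simp only [Complex.smul_re, Complex.smul_im, Complex.sub_re, Complex.sub_im, smul_eq_mul]
    linarith
  have hnsq : y0.re ^ 2 + y0.im ^ 2 = 1 := by
    have := Complex.sq_norm y0
    rw [hy1, Complex.normSq_apply] at this
    linarith
  have hdec : v0 = (y0.re * v0.re + y0.im * v0.im : ℝ) • y0
      + (y0.re * v0.im - y0.im * v0.re : ℝ) • (Complex.I * y0) := by
    apply Complex.ext
    · simp
      linear_combination (-v0.re) * hnsq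
    · simp
      linear_combination (-v0.im) * hnsq
  have hD : D y0 (Complex.I * y0) = deriv p θ := by
    rw [hyexp]; exact a.dsk.bdry_der θ
  have hom := a.loop.om a.good θ
  have hl := a.loop.kpos
  have hpz := a.dsk.pos y0 hy0
  have hrot := om_rot (D y0) y0
  rw [hnsq, one_mul] at hrot
  have hpair : omega0 (D y0 v0) (D y0 (Complex.I * y0))
      = (y0.re * v0.re + y0.im * v0.im) * omega0 (D y0 y0) (D y0 (Complex.I * y0)) := by
    conv_lhs => rw [hdec]
    rw [map_add, map_smul, map_smul, om_add_left, om_smul_left, om_smul_left, om_self, mul_zero,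
      add_zero]
  rw [e0, om_smul_left, hrot, hD, hPy, hom] at hpair
  have ha1 : a0 = 0 := by
    have := mul_nonpos_of_nonpos_of_nonneg hin hpz.le
    nlinarith
  rw [ha1, zero_smul] at e0
  have hv00 : v0 = 0 := (injective_iff_map_eq_zero _).1 (inj_of_om hpz) v0 e0
  rw [hv00] at hv0
  simp at hv0

end

end Hopf

namespace Hopf
open Filter Topology

theorem sepC {G : E4 → ℝ} (h : GoodG G) {R : ℝ} (hR : 0 < R)
    (hb : ∀ z, G z ≤ 1 → ‖z‖ ≤ R ∧ ‖grd G z‖ ≤ R) {c : ℝ → E4} {k : ℝ} (l : Loop G c k)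
    {φ : ℝ → ℝ} {m : ℝ} (pr : Prf φ m) :
    ∃ m0 > 0, ∀ s ∈ Icc (1 / 3 : ℝ) 1, ∀ t ∈ Icc (1 / 3 : ℝ) 1, ∀ α β : ℝ, |α - β| ≤ Real.pi →
      m0 * (|s - t| + |α - β|) ≤ ‖φ s • c α - φ t • c β‖ := by
  obtain ⟨kb, hkb, hbl⟩ := bilip l.smooth l.per (l.dne h) l.inj
  have hm := pr.mpos
  have hpos : 0 < R / m + 2 * (1 + R ^ 2) / kb := by positivity
  refine ⟨(R / m + 2 * (1 + R ^ 2) / kb)⁻¹, inv_pos.2 hpos, fun s hs t ht α β hαβ => ?_⟩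
  rw [inv_mul_le_iff₀ hpos]
  set N := ‖φ s • c α - φ t • c β‖ with hN
  have hN0 : 0 ≤ N := norm_nonneg _
  have ps := pr.ge_half s
  have pt := pr.ge_half t
  have ps1 := pr.le_one hs.2
  have pt1 := pr.le_one ht.2
  have Gs : G (φ s • c α) = φ s ^ 2 := by rw [h.hom _ (by linarith), l.one]; ring
  have Gt : G (φ t • c β) = φ t ^ 2 := by rw [h.hom _ (by linarith), l.one]; ring
  have key : ∀ x y, G x ≤ 1 → G x - G y ≤ R * ‖x - y‖ := by
    intro x y hx
    have h1 := h.subgrad y x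
    have h2 := abs_le.1 (abs_real_inner_le_norm (grd G x) (y - x))
    have h3 := (hb x hx).2
    rw [norm_sub_rev x y]
    nlinarith [norm_nonneg (y - x), h2.1]
  have k1 := key _ (φ t • c β) (by rw [Gs]; nlinarith)
  have k2 := key (φ t • c β) (φ s • c α) (by rw [Gt]; nlinarith)
  rw [norm_sub_rev (φ t • c β), ← hN] at k2
  rw [← hN] at k1
  rw [Gs, Gt] at k1 k2
  have d1 : |φ s - φ t| ≤ R * N := by
    rw [abs_le]
    constructor
    · by_contra hc
      push Not at hc
      have : 0 ≤ R * N := by positivity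
      nlinarith
    · by_contra hc
      push Not at hc
      have : 0 ≤ R * N := by positivity
      nlinarith
  have d2 : m * |s - t| ≤ R * N := (pr.sep hs ht).trans d1
  have d3 : φ s * ‖c α - c β‖ ≤ N + R * N * R := by
    have e : φ s • (c α - c β) = (φ s • c α - φ t • c β) - (φ s - φ t) • c β := by module
    have h1 : ‖φ s • (c α - c β)‖ ≤ N + |φ s - φ t| * ‖c β‖ := by
      rw [e]
      refine (norm_sub_le _ _).trans ?_
      rw [norm_smul (φ s - φ t), Real.norm_eq_abs]
    rw [norm_smul, Real.norm_of_nonneg (by linarith)] at h1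
    refine h1.trans ?_
    have := (hb (c β) (l.one β).le).1
    gcongr
  have d4 := hbl α β hαβ
  have d5 : kb * |α - β| ≤ 2 * (1 + R ^ 2) * N := by
    nlinarith [norm_nonneg (c α - c β)]
  have e1 : |s - t| ≤ R / m * N := by
    rw [div_mul_eq_mul_div, le_div_iff₀ hm]; linarith
  have e2 : |α - β| ≤ 2 * (1 + R ^ 2) / kb * N := by
    rw [div_mul_eq_mul_div, le_div_iff₀ hkb]; linarith
  linarith

theorem sympC {G : E4 → ℝ} (h : GoodG G) {R : ℝ} (hR : 0 < R)
    (hb : ∀ z, G z ≤ 1 → ‖z‖ ≤ R ∧ ‖grd G z‖ ≤ R) {c : ℝ → E4} {k : ℝ} (l : Loop G c k)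
    {φ : ℝ → ℝ} {m : ℝ} (pr : Prf φ m) :
    ∃ l0 > 0, ∀ s ∈ Icc (1 / 3 : ℝ) 1, ∀ θ : ℝ, ∀ a b : E4, ‖a‖ ≤ l0 → ‖b‖ ≤ l0 →
      0 < omega0 (deriv φ s • c θ + a) (φ s • deriv c θ + b) := by
  have hm := pr.mpos
  have hk := l.kpos
  have hdc : Continuous (deriv φ) := (contDiff_infty_iff_deriv.1 pr.smooth).2.continuous
  obtain ⟨B, hB⟩ := isCompact_Icc.exists_bound_of_continuousOn (s := Icc (1 / 3 : ℝ) 1)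
    hdc.continuousOn
  have hB0 : 0 < B := by
    have h1 := hB 1 (by norm_num)
    have h2 := pr.dge 1 (by norm_num)
    have := Real.le_norm_self (deriv φ 1)
    linarith
  have hQ : 0 < B * R + k * R + 1 := by positivity
  refine ⟨min 1 (m * k / (2 * (B * R + k * R + 1))), lt_min one_pos (by positivity), ?_⟩
  intro s hs θ a b ha hb'
  set L := min 1 (m * k / (2 * (B * R + k * R + 1)))
  have hL1 : L ≤ 1 := min_le_left _ _
  have hL2 : L * (2 * (B * R + k * R + 1)) ≤ m * k := by
    rw [← le_div_iff₀ (by positivity)]; exact min_le_right _ _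
  have hL0 : 0 ≤ L := (norm_nonneg a).trans ha
  have ps := pr.ge_half s
  have ps1 := pr.le_one hs.2
  have hd := pr.dge s hs
  have hdB : deriv φ s ≤ B := (Real.le_norm_self _).trans (hB s hs)
  have hc1 : ‖c θ‖ ≤ R := (hb _ (l.one θ).le).1
  have hc2 : ‖deriv c θ‖ ≤ k * R := by
    rw [l.deriv_eq, norm_smul, norm_J0, Real.norm_of_nonneg hk.le]
    have := (hb _ (l.one θ).le).2
    gcongr
  rw [om_add_left, om_add_right, om_add_right, om_smul_left, om_smul_right, om_smul_left,
    om_smul_right, l.om h]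
  have t1 : |omega0 (c θ) b| ≤ R * L := (abs_om_le _ _).trans (by gcongr)
  have t2 : |omega0 a (deriv c θ)| ≤ L * (k * R) := (abs_om_le _ _).trans (by gcongr)
  have t3 : |omega0 a b| ≤ L * L := (abs_om_le _ _).trans (by gcongr)
  have t4 : -(B * (R * L)) ≤ deriv φ s * omega0 (c θ) b := by
    have : |deriv φ s * omega0 (c θ) b| ≤ B * (R * L) := by
      rw [abs_mul, abs_of_nonneg (by linarith : 0 ≤ deriv φ s)]
      gcongr
    exact (abs_le.1 this).1
  have t5 : -(L * (k * R)) ≤ φ s * omega0 a (deriv c θ) := by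
    have : |φ s * omega0 a (deriv c θ)| ≤ 1 * (L * (k * R)) := by
      rw [abs_mul, abs_of_nonneg (by linarith : 0 ≤ φ s)]
      gcongr
    rw [one_mul] at this
    exact (abs_le.1 this).1
  have t6 := (abs_le.1 t3).1
  have t7 : m * k ≤ deriv φ s * (φ s * (2 * k)) := by
    have hd0 : 0 ≤ deriv φ s := hm.le.trans hd
    have : m * (1 / 2 * (2 * k)) ≤ deriv φ s * (φ s * (2 * k)) := by gcongr
    linarith
  have t8 : L * L ≤ L := by nlinarith
  have : 0 < m * k := by positivity
  rcases hL0.eq_or_lt with h0 | h0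
  · rw [← h0] at *
    nlinarith
  · nlinarith

/-- cutoff -/
noncomputable def chi (s : ℝ) : ℝ := Real.smoothTransition (2 * s - 1)

theorem chi_smooth : ContDiff ℝ (⊤ : ℕ∞) chi :=
  Real.smoothTransition.contDiff.comp ((contDiff_const.mul contDiff_id).sub contDiff_const)

theorem chi_zero {s : ℝ} (hs : s ≤ 1 / 2) : chi s = 0 :=
  Real.smoothTransition.zero_of_nonpos (by linarith)

theorem chi_one : chi 1 = 1 := Real.smoothTransition.one_of_one_le (by norm_num)

theorem chi_nonneg (s : ℝ) : 0 ≤ chi s := Real.smoothTransition.nonneg _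

theorem chi_le (s : ℝ) : chi s ≤ 1 := Real.smoothTransition.le_one _

/-- weight of the approximate disk -/
noncomputable def wA (φ : ℝ → ℝ) (s : ℝ) : ℝ := φ s * (1 - chi s)

theorem wA_lip {φ : ℝ → ℝ} {m : ℝ} (pr : Prf φ m) : ∃ C0 : ℝ, 0 ≤ C0 ∧
    ∀ s ∈ Icc (1 / 3 : ℝ) 1, ∀ t ∈ Icc (1 / 3 : ℝ) 1, |wA φ s - wA φ t| ≤ C0 * |s - t| := by
  have hs : ContDiff ℝ (⊤ : ℕ∞) (wA φ) := pr.smooth.mul (contDiff_const.sub chi_smooth)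
  have hdc : Continuous (deriv (wA φ)) := (contDiff_infty_iff_deriv.1 hs).2.continuous
  obtain ⟨B, hB⟩ := isCompact_Icc.exists_bound_of_continuousOn (s := Icc (1 / 3 : ℝ) 1)
    hdc.continuousOn
  refine ⟨B, (norm_nonneg _).trans (hB 1 (by norm_num)), fun s h1 t h2 => ?_⟩
  exact (convex_Icc (1 / 3 : ℝ) 1).norm_image_sub_le_of_norm_deriv_le
    (fun x _ => hs.differentiable (by simp) x) hB h2 h1

theorem wA_abs {φ : ℝ → ℝ} {m : ℝ} (pr : Prf φ m) {s : ℝ} (hs : s ≤ 1) : |wA φ s| ≤ 1 := by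
  have h1 := pr.ge_half s
  have h2 := pr.le_one hs
  have h3 := chi_nonneg s
  have h4 := chi_le s
  rw [wA, abs_of_nonneg (mul_nonneg (by linarith) (by linarith))]
  nlinarith

/-- rescaled squared radius -/
noncomputable def sv (τ : ℝ) (w : ℂ) : ℝ := (w.re ^ 2 + w.im ^ 2 - 1 + τ) / τ

/-- its inverse -/
noncomputable def rr (τ s : ℝ) : ℝ := √(1 - τ + τ * s)

/-- polar coordinates -/
noncomputable def pt (τ s θ : ℝ) : ℂ := (rr τ s : ℂ) * Complex.exp (θ * Complex.I)

theorem re_im_sq (w : ℂ) : w.re ^ 2 + w.im ^ 2 = ‖w‖ ^ 2 := by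
  rw [Complex.sq_norm, Complex.normSq_apply]; ring

theorem sv_smooth (τ : ℝ) : ContDiff ℝ (⊤ : ℕ∞) (sv τ) := by
  have h1 : ContDiff ℝ (⊤ : ℕ∞) fun w : ℂ => w.re := Complex.reCLM.contDiff
  have h2 : ContDiff ℝ (⊤ : ℕ∞) fun w : ℂ => w.im := Complex.imCLM.contDiff
  exact ((((h1.pow 2).add (h2.pow 2)).sub contDiff_const).add contDiff_const).div_const _

theorem sv_mul {τ : ℝ} (hτ : 0 < τ) (w : ℂ) : τ * sv τ w = ‖w‖ ^ 2 - 1 + τ := by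
  rw [sv, re_im_sq]; field_simp

theorem sv_le {τ : ℝ} (hτ : 0 < τ) {w : ℂ} (hw : w ∈ closedBall (0 : ℂ) 1) : sv τ w ≤ 1 := by
  have h1 := sv_mul hτ w
  rw [mem_closedBall_zero_iff] at hw
  nlinarith [norm_nonneg w]

theorem sv_lt {τ : ℝ} (hτ : 0 < τ) {w : ℂ} (hw : w ∈ ball (0 : ℂ) 1) : sv τ w < 1 := by
  have h1 := sv_mul hτ w
  rw [mem_ball_zero_iff] at hw
  have : ‖w‖ ^ 2 < 1 := by nlinarith [norm_nonneg w]
  nlinarith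

theorem sv_sphere {τ : ℝ} (hτ : 0 < τ) {w : ℂ} (hw : ‖w‖ = 1) : sv τ w = 1 := by
  have h1 := sv_mul hτ w
  rw [hw] at h1
  nlinarith

theorem sv_ne {τ : ℝ} (hτ : 0 < τ) (hτ1 : τ ≤ 1 / 2) {w : ℂ} (hw : 0 < sv τ w) : w ≠ 0 := by
  rintro rfl
  have h1 := sv_mul hτ 0
  rw [norm_zero] at h1
  nlinarith

theorem rr_sq {τ s : ℝ} (h1 : τ ≤ 1 / 2) (h0 : 0 < τ) (hs : 0 ≤ s) : rr τ s ^ 2 = 1 - τ + τ * s :=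
  Real.sq_sqrt (by nlinarith)

theorem rr_ge {τ s : ℝ} (h1 : τ ≤ 1 / 2) (h0 : 0 < τ) (hs : 0 ≤ s) : 1 / 2 ≤ rr τ s := by
  have h2 := rr_sq h1 h0 hs
  have h3 : 0 ≤ rr τ s := Real.sqrt_nonneg _
  nlinarith [mul_nonneg h0.le hs]

theorem rr_le {τ s : ℝ} (h0 : 0 < τ) (hs : s ≤ 1) : rr τ s ≤ 1 :=
  Real.sqrt_le_one.2 (by nlinarith)

theorem rr_dist {τ s t : ℝ} (h1 : τ ≤ 1 / 2) (h0 : 0 < τ) (hs : 0 ≤ s) (ht : 0 ≤ t) :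
    |rr τ s - rr τ t| ≤ τ * |s - t| := by
  have e : (rr τ s - rr τ t) * (rr τ s + rr τ t) = τ * (s - t) := by
    have := rr_sq h1 h0 hs
    have := rr_sq h1 h0 ht
    nlinarith
  have hp : 1 ≤ rr τ s + rr τ t := by linarith [rr_ge h1 h0 hs, rr_ge h1 h0 ht]
  have e2 := congrArg abs e
  rw [abs_mul, abs_mul, abs_of_pos h0, abs_of_pos (by linarith : 0 < rr τ s + rr τ t)] at e2
  nlinarith [abs_nonneg (rr τ s - rr τ t)]

theorem pt_mem {τ s : ℝ} (h0 : 0 < τ) (hs : s ≤ 1) (θ : ℝ) : pt τ s θ ∈ closedBall (0 : ℂ) 1 :=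
  circle_mem (Real.sqrt_nonneg _) (rr_le h0 hs) θ

theorem norm_pt (τ s θ : ℝ) : ‖pt τ s θ‖ = rr τ s := by
  rw [pt, norm_mul, Complex.norm_exp_ofReal_mul_I, Complex.norm_real, mul_one]
  exact Real.norm_of_nonneg (Real.sqrt_nonneg _)

theorem sv_pt {τ s : ℝ} (h1 : τ ≤ 1 / 2) (h0 : 0 < τ) (hs : 0 ≤ s) (θ : ℝ) : sv τ (pt τ s θ) = s := by
  have := sv_mul h0 (pt τ s θ)
  rw [norm_pt, rr_sq h1 h0 hs] at this
  have h2 : τ * (sv τ (pt τ s θ) - s) = 0 := by linarith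
  rcases mul_eq_zero.1 h2 with h3 | h3 <;> linarith

theorem pt_sv {τ : ℝ} (h0 : 0 < τ) (w : ℂ) : pt τ (sv τ w) w.arg = w := by
  have : rr τ (sv τ w) = ‖w‖ := by
    rw [rr, sv_mul h0, show 1 - τ + (‖w‖ ^ 2 - 1 + τ) = ‖w‖ ^ 2 by ring,
      Real.sqrt_sq (norm_nonneg _)]
  rw [pt, this]; exact (polar w).symm

theorem pt_dist (τ s t θ : ℝ) : ‖pt τ s θ - pt τ t θ‖ = |rr τ s - rr τ t| := by
  rw [pt, pt, ← sub_mul, norm_mul, Complex.norm_exp_ofReal_mul_I, mul_one, ← Complex.ofReal_sub,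
    Complex.norm_real, Real.norm_eq_abs]

theorem rr_one (τ : ℝ) : rr τ 1 = 1 := by simp [rr]

theorem pt_one (τ θ : ℝ) : pt τ 1 θ = Complex.exp (θ * Complex.I) := by simp [pt, rr_one]

/-- the final disk -/
noncomputable def uu (φ : ℝ → ℝ) (τ : ℝ) (P : ℂ → E4) (c : ℝ → E4) (w : ℂ) : E4 :=
  φ (sv τ w) • ((1 - chi (sv τ w)) • P w + chi (sv τ w) • hatc c w)

end Hopf

namespace Hopf
open Filter Topology

/-- all data and smallness conditions used for the final disk -/
structure Setup (G : E4 → ℝ) (c : ℝ → E4) (k R : ℝ) (φ : ℝ → ℝ) (m C0 η τ : ℝ) (H : E4 → ℝ)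
    (p : ℝ → E4) (l : ℝ) (P : ℂ → E4) (D : ℂ → ℂ →L[ℝ] E4) (M : ℝ) : Prop where
  good : GoodG G
  bnd : ∀ z, G z ≤ 1 → ‖z‖ ≤ R ∧ ‖grd G z‖ ≤ R
  loop : Loop G c k
  prf : Prf φ m
  C0pos : 0 ≤ C0
  lipA : ∀ s ∈ Icc (1 / 3 : ℝ) 1, ∀ t ∈ Icc (1 / 3 : ℝ) 1, |wA φ s - wA φ t| ≤ C0 * |s - t|
  ηpos : 0 < η
  sep : ∃ m0, (2 * C0 + 2) * η < m0 ∧ ∀ s ∈ Icc (1 / 3 : ℝ) 1, ∀ t ∈ Icc (1 / 3 : ℝ) 1, ∀ α β : ℝ,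
    |α - β| ≤ Real.pi → m0 * (|s - t| + |α - β|) ≤ ‖φ s • c α - φ t • c β‖
  symp : ∀ s ∈ Icc (1 / 3 : ℝ) 1, ∀ θ : ℝ, ∀ a b : E4, ‖a‖ ≤ (2 * C0 + 2) * η →
    ‖b‖ ≤ (2 * C0 + 2) * η → 0 < omega0 (deriv φ s • c θ + a) (φ s • deriv c θ + b)
  gap : 2 * R * η < φ (1 / 2) ^ 2 - φ (1 / 3) ^ 2
  apx : Apx G c η H p l P D
  Mb : ∀ z ∈ closedBall (0 : ℂ) 1, ‖D z‖ ≤ M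
  τpos : 0 < τ
  τle : τ ≤ 1 / 2
  Mτ : M * τ ≤ η
  lemL : ∀ z1 ∈ closedBall (0 : ℂ) 1,
    ∀ z2 ∈ closedBall (0 : ℂ) 1, ∀ κ : ℝ, 1 ≤ κ → ‖z1‖ ≤ ‖z2‖ → 1 - τ ≤ ‖z2‖ ^ 2 →
      P z1 = κ • P z2 → z1 = z2
  unif : ∀ z1 ∈ closedBall (0 : ℂ) 1, ∀ z2 ∈ closedBall (0 : ℂ) 1, ‖z1 - z2‖ ≤ τ →
    ‖D z1 (Complex.I * z1) - D z2 (Complex.I * z2)‖ ≤ η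
  outw : ∀ z ∈ closedBall (0 : ℂ) 1, 1 - τ ≤ ‖z‖ ^ 2 → 0 < omega0 (P z) (D z (Complex.I * z))

namespace Setup
variable {G : E4 → ℝ} {c : ℝ → E4} {k R : ℝ} {φ : ℝ → ℝ} {m C0 η τ : ℝ} {H : E4 → ℝ}
    {p : ℝ → E4} {l : ℝ} {P : ℂ → E4} {D : ℂ → ℂ →L[ℝ] E4} {M : ℝ}

theorem Mnonneg (S : Setup G c k R φ m C0 η τ H p l P D M) : 0 ≤ M :=
  (norm_nonneg _).trans (S.Mb 0 (by simp))

theorem Plip (S : Setup G c k R φ m C0 η τ H p l P D M) {x y : ℂ} (hx : x ∈ closedBall (0 : ℂ) 1)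
    (hy : y ∈ closedBall (0 : ℂ) 1) : ‖P y - P x‖ ≤ M * ‖y - x‖ :=
  (convex_closedBall (0 : ℂ) 1).norm_image_sub_le_of_norm_hasFDerivWithin_le
    (fun z hz => S.apx.dsk.der z hz) S.Mb hx hy

theorem near (S : Setup G c k R φ m C0 η τ H p l P D M) {s : ℝ} (h0 : 0 ≤ s) (h1 : s ≤ 1) (θ : ℝ) :
    ‖P (pt τ s θ) - c θ‖ ≤ 2 * η := by
  have e1 := S.Plip (pt_mem S.τpos le_rfl θ) (pt_mem S.τpos h1 θ)
  rw [pt_dist] at e1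
  have e2 := rr_dist S.τle S.τpos h0 zero_le_one
  have e3 : |s - 1| ≤ 1 := by rw [abs_le]; constructor <;> linarith
  have e4 := S.apx.near θ
  rw [pt_one, S.apx.dsk.bdry] at e1
  have e5 : M * |rr τ s - rr τ 1| ≤ M * τ := by
    have := S.Mnonneg
    gcongr
    nlinarith [S.τpos]
  have e6 : P (pt τ s θ) - c θ = (P (pt τ s θ) - p θ) + (p θ - c θ) := by abel
  rw [e6]
  have := norm_add_le (P (pt τ s θ) - p θ) (p θ - c θ)
  linarith [S.Mτ]

/-- the perturbation term -/
noncomputable def gg (φ : ℝ → ℝ) (τ : ℝ) (P : ℂ → E4) (c : ℝ → E4) (s θ : ℝ) : E4 :=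
  wA φ s • (P (pt τ s θ) - c θ)

theorem uu_pt (S : Setup G c k R φ m C0 η τ H p l P D M) {s : ℝ} (h0 : 0 ≤ s) (θ : ℝ) :
    uu φ τ P c (pt τ s θ) = φ s • c θ + gg φ τ P c s θ := by
  have h1 : hatc c (pt τ s θ) = c θ :=
    hatc_polar S.loop.per (by linarith [rr_ge S.τle S.τpos h0]) θ
  rw [uu, gg, wA, sv_pt S.τle S.τpos h0, h1]
  module

theorem gg_s (S : Setup G c k R φ m C0 η τ H p l P D M) {s t : ℝ} (hs : s ∈ Icc (1 / 3 : ℝ) 1)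
    (ht : t ∈ Icc (1 / 3 : ℝ) 1) (θ : ℝ) :
    ‖gg φ τ P c s θ - gg φ τ P c t θ‖ ≤ (2 * C0 + 2) * η * |s - t| := by
  have e : gg φ τ P c s θ - gg φ τ P c t θ = (wA φ s - wA φ t) • (P (pt τ s θ) - c θ)
      + wA φ t • (P (pt τ s θ) - P (pt τ t θ)) := by
    rw [gg, gg]; module
  have hs0 : 0 ≤ s := by linarith [hs.1]
  have ht0 : 0 ≤ t := by linarith [ht.1]
  have a1 : ‖(wA φ s - wA φ t) • (P (pt τ s θ) - c θ)‖ ≤ (C0 * |s - t|) * (2 * η) := by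
    rw [norm_smul, Real.norm_eq_abs]
    have := S.C0pos
    exact mul_le_mul (S.lipA s hs t ht) (S.near hs0 hs.2 θ) (norm_nonneg _) (by positivity)
  have a2 : ‖wA φ t • (P (pt τ s θ) - P (pt τ t θ))‖ ≤ 1 * (η * |s - t|) := by
    rw [norm_smul, Real.norm_eq_abs]
    refine mul_le_mul (wA_abs S.prf ht.2) ?_ (norm_nonneg _) zero_le_one
    have e1 := S.Plip (pt_mem S.τpos ht.2 θ) (pt_mem S.τpos hs.2 θ)
    rw [pt_dist] at e1
    have e2 := rr_dist S.τle S.τpos hs0 ht0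
    calc _ ≤ _ := e1
      _ ≤ M * (τ * |s - t|) := mul_le_mul_of_nonneg_left e2 S.Mnonneg
      _ = M * τ * |s - t| := by ring
      _ ≤ _ := mul_le_mul_of_nonneg_right S.Mτ (abs_nonneg _)
  rw [e]
  refine (norm_add_le _ _).trans ?_
  have : 0 ≤ η * |s - t| := mul_nonneg S.ηpos.le (abs_nonneg _)
  nlinarith

theorem gg_t (S : Setup G c k R φ m C0 η τ H p l P D M) {s : ℝ} (hs : s ∈ Icc (1 / 3 : ℝ) 1)
    (α β : ℝ) :
    ‖gg φ τ P c s α - gg φ τ P c s β‖ ≤ (2 * C0 + 2) * η * |α - β| := by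
  have hs0 : 0 ≤ s := by linarith [hs.1]
  have hd : ∀ θ : ℝ, HasDerivAt (fun θ => P (pt τ s θ) - c θ)
      (D (pt τ s θ) (Complex.I * pt τ s θ) - deriv c θ) θ := fun θ =>
    (S.apx.dsk.der_circle (Real.sqrt_nonneg _) (rr_le S.τpos hs.2) θ).sub
      ((S.loop.smooth.differentiable (by simp)) θ).hasDerivAt
  have hb : ∀ θ : ℝ, ‖D (pt τ s θ) (Complex.I * pt τ s θ) - deriv c θ‖ ≤ 2 * η := by
    intro θ
    have e1 := S.unif _ (pt_mem S.τpos hs.2 θ) _ (pt_mem S.τpos le_rfl θ) (by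
      rw [pt_dist]
      have e2 := rr_dist S.τle S.τpos hs0 zero_le_one
      have e3 : |s - 1| ≤ 1 := by rw [abs_le]; constructor <;> linarith [hs.2]
      nlinarith [S.τpos])
    rw [pt_one, S.apx.dsk.bdry_der] at e1
    have e4 := S.apx.dnear θ
    have := norm_add_le (D (pt τ s θ) (Complex.I * pt τ s θ) - deriv p θ) (deriv p θ - deriv c θ)
    rw [sub_add_sub_cancel] at this
    linarith
  have key := convex_univ.norm_image_sub_le_of_norm_hasDerivWithin_le
    (f := fun θ => P (pt τ s θ) - c θ) (C := 2 * η)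
    (fun x _ => (hd x).hasDerivWithinAt) (fun x _ => hb x) (mem_univ β) (mem_univ α)
  rw [gg, gg, ← smul_sub, norm_smul, Real.norm_eq_abs]
  have h1 := wA_abs S.prf hs.2
  simp only [Real.norm_eq_abs] at key
  have h2 := mul_le_mul h1 key (norm_nonneg _) zero_le_one
  have h3 : 0 ≤ C0 * (η * |α - β|) := mul_nonneg S.C0pos (mul_nonneg S.ηpos.le (abs_nonneg _))
  nlinarith

theorem inj_ann (S : Setup G c k R φ m C0 η τ H p l P D M) {w z : ℂ}
    (hw : w ∈ closedBall (0 : ℂ) 1) (hz : z ∈ closedBall (0 : ℂ) 1) (h1 : 1 / 3 ≤ sv τ w)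
    (h2 : 1 / 3 ≤ sv τ z) (he : uu φ τ P c w = uu φ τ P c z) : w = z := by
  have hw0 : w ≠ 0 := sv_ne S.τpos S.τle (by linarith)
  have hz0 : z ≠ 0 := sv_ne S.τpos S.τle (by linarith)
  set β := z.arg with hβ
  set α := z.arg + (w / z).arg with hα
  set s := sv τ w with hs
  set t := sv τ z with ht
  have ez : z = pt τ t β := (pt_sv S.τpos z).symm
  have ew : w = pt τ s α := by
    have e1 : Complex.exp (w.arg * Complex.I) = Complex.exp (α * Complex.I) := by
      have a1 := polar w
      have a2 := polar z
      have a3 := polar (w / z)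
      have hn : ((‖w‖ : ℝ) : ℂ) ≠ 0 := by simpa using hw0
      apply mul_left_cancel₀ hn
      rw [← a1, hα]
      push_cast
      rw [add_mul, Complex.exp_add]
      calc w = (w / z) * z := by field_simp
        _ = ((‖w / z‖ : ℝ) * Complex.exp ((w / z).arg * Complex.I)) *
            ((‖z‖ : ℝ) * Complex.exp (z.arg * Complex.I)) := by rw [← a3, ← a2]
        _ = ((‖w / z‖ : ℝ) * (‖z‖ : ℝ) : ℂ) * (Complex.exp (z.arg * Complex.I) *
            Complex.exp ((w / z).arg * Complex.I)) := by ring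
        _ = _ := by
            rw [← Complex.ofReal_mul, ← norm_mul, div_mul_cancel₀ _ hz0]
    have e2 := (pt_sv S.τpos w).symm
    rw [pt, e1] at e2
    exact e2
  have hs1 : s ∈ Icc (1 / 3 : ℝ) 1 := ⟨h1, sv_le S.τpos hw⟩
  have ht1 : t ∈ Icc (1 / 3 : ℝ) 1 := ⟨h2, sv_le S.τpos hz⟩
  have hd : |α - β| ≤ Real.pi := by
    rw [hα, hβ, add_sub_cancel_left]; exact Complex.abs_arg_le_pi _
  obtain ⟨m0, hm0, hsep⟩ := S.sep
  have k1 := hsep s hs1 t ht1 α β hd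
  rw [ew, ez, S.uu_pt (by linarith), S.uu_pt (by linarith)] at he
  have e3 : φ s • c α - φ t • c β = -((gg φ τ P c s α - gg φ τ P c t α)
      + (gg φ τ P c t α - gg φ τ P c t β)) := by
    have e5 : φ s • c α = φ t • c β + gg φ τ P c t β - gg φ τ P c s α := eq_sub_of_add_eq he
    rw [e5]; abel
  have k2 : ‖φ s • c α - φ t • c β‖ ≤ (2 * C0 + 2) * η * |s - t| + (2 * C0 + 2) * η * |α - β| := by
    rw [e3, norm_neg]
    exact (norm_add_le _ _).trans (add_le_add (S.gg_s hs1 ht1 α) (S.gg_t ht1 α β))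
  have h0 : |s - t| + |α - β| = 0 := by
    by_contra hne
    have : 0 < |s - t| + |α - β| := lt_of_le_of_ne (by positivity) (Ne.symm hne)
    nlinarith
  have h3 : s = t := by
    have := abs_nonneg (α - β)
    have h4 : |s - t| = 0 := le_antisymm (by linarith) (abs_nonneg _)
    exact sub_eq_zero.1 (abs_eq_zero.1 h4)
  have h5 : α = β := by
    have := abs_nonneg (s - t)
    have h4 : |α - β| = 0 := le_antisymm (by linarith) (abs_nonneg _)
    exact sub_eq_zero.1 (abs_eq_zero.1 h4)
  rw [ew, ez, h3, h5]

theorem comb_le (S : Setup G c k R φ m C0 η τ H p l P D M) {w : ℂ}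
    (hw : w ∈ closedBall (0 : ℂ) 1) : G (uu φ τ P c w) ≤ φ (sv τ w) ^ 2 := by
  rw [uu, S.good.hom _ (by linarith [S.prf.ge_half (sv τ w)])]
  have h1 := S.good.conv.2 (mem_univ (P w)) (mem_univ (hatc c w))
    (sub_nonneg.2 (chi_le (sv τ w))) (chi_nonneg (sv τ w)) (by ring)
  rw [hatc, S.loop.one] at h1
  have h2 := S.apx.G_le hw
  simp only [smul_eq_mul] at h1
  have h3 := chi_le (sv τ w)
  have h4 : G ((1 - chi (sv τ w)) • P w + chi (sv τ w) • hatc c w) ≤ 1 := by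
    rw [hatc]; nlinarith
  nlinarith [sq_nonneg (φ (sv τ w))]

theorem comb_ge (S : Setup G c k R φ m C0 η τ H p l P D M) {w : ℂ}
    (hw : w ∈ closedBall (0 : ℂ) 1) (h0 : 0 ≤ sv τ w) :
    φ (sv τ w) ^ 2 - 2 * R * η ≤ G (uu φ τ P c w) := by
  have hs1 := sv_le S.τpos hw
  set s := sv τ w with hs
  have e := S.uu_pt h0 w.arg
  rw [hs, pt_sv S.τpos w, ← hs] at e
  have p1 := S.prf.ge_half s
  have p2 := S.prf.le_one hs1
  have Gs : G (φ s • c w.arg) = φ s ^ 2 := by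
    rw [S.good.hom _ (by linarith), S.loop.one]; ring
  have h1 := S.good.subgrad (uu φ τ P c w) (φ s • c w.arg)
  have e2 : uu φ τ P c w - φ s • c w.arg = gg φ τ P c s w.arg := by rw [e]; abel
  rw [e2, Gs] at h1
  have h2 := (abs_le.1 (abs_real_inner_le_norm (grd G (φ s • c w.arg)) (gg φ τ P c s w.arg))).1
  have h3 : ‖grd G (φ s • c w.arg)‖ ≤ R := (S.bnd _ (by rw [Gs]; nlinarith)).2
  have h4 : ‖gg φ τ P c s w.arg‖ ≤ 2 * η := by
    rw [gg, norm_smul, Real.norm_eq_abs]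
    have := mul_le_mul (wA_abs S.prf hs1) (S.near h0 hs1 w.arg) (norm_nonneg _) zero_le_one
    linarith
  have h5 := mul_le_mul h3 h4 (norm_nonneg _) ((norm_nonneg _).trans h3)
  linarith

theorem inj_aux (S : Setup G c k R φ m C0 η τ H p l P D M) {w z : ℂ}
    (hw : w ∈ closedBall (0 : ℂ) 1) (hz : z ∈ closedBall (0 : ℂ) 1) (hle : ‖w‖ ≤ ‖z‖)
    (he : uu φ τ P c w = uu φ τ P c z) : w = z := by
  have hsle : sv τ w ≤ sv τ z := by
    have h1 := sv_mul S.τpos w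
    have h2 := sv_mul S.τpos z
    have h3 : ‖w‖ ^ 2 ≤ ‖z‖ ^ 2 := by gcongr
    have := S.τpos
    nlinarith
  rcases le_or_gt (sv τ z) (1 / 2) with h1 | h1
  · have he' := he
    rw [uu, uu, chi_zero h1, chi_zero (hsle.trans h1)] at he'
    simp only [sub_zero, one_smul, zero_smul, add_zero] at he'
    rcases le_or_gt (sv τ z) 0 with h2 | h2
    · rw [S.prf.half _ h2, S.prf.half _ (hsle.trans h2)] at he'
      exact S.apx.dsk.inj hw hz (smul_right_injective E4 (by norm_num : (1 / 2 : ℝ) ≠ 0) he')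
    · have p1 := S.prf.ge_half (sv τ w)
      have hm := S.prf.mono hsle
      refine S.lemL w hw z hz (φ (sv τ z) / φ (sv τ w)) ?_ hle ?_ ?_
      · rw [le_div_iff₀ (by linarith)]; linarith
      · have h3 := sv_mul S.τpos z
        nlinarith [S.τpos]
      · have hne : φ (sv τ w) ≠ 0 := by linarith
        rw [div_eq_inv_mul, ← smul_smul, ← he', smul_smul, inv_mul_cancel₀ hne, one_smul]
  · rcases le_or_gt (1 / 3) (sv τ w) with h2 | h2
    · exact S.inj_ann hw hz h2 (by linarith) he
    · exfalso
      have k1 := S.comb_le hw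
      have k2 := S.comb_ge hz (by linarith)
      rw [he] at k1
      have g := S.gap
      have m1 := S.prf.mono h2.le
      have m2 := S.prf.mono h1.le
      have q1 := S.prf.ge_half (sv τ w)
      have q2 := S.prf.ge_half (1 / 2)
      nlinarith

theorem inj (S : Setup G c k R φ m C0 η τ H p l P D M) :
    InjOn (uu φ τ P c) (closedBall 0 1) := by
  intro w hw z hz he
  rcases le_total ‖w‖ ‖z‖ with h | h
  · exact S.inj_aux hw hz h he
  · exact (S.inj_aux hz hw h he.symm).symm

theorem eq_small {w : ℂ} (hs : sv τ w ≤ 1 / 2) : uu φ τ P c w = φ (sv τ w) • P w := by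
  rw [uu, chi_zero hs]; simp

theorem ev_small {w : ℂ} (hs : sv τ w < 1 / 2) :
    uu φ τ P c =ᶠ[𝓝 w] fun w => φ (sv τ w) • P w := by
  filter_upwards [(sv_smooth τ).continuous.tendsto w |>.eventually (gt_mem_nhds hs)] with z hz
  exact eq_small hz.le

theorem smoothAt (S : Setup G c k R φ m C0 η τ H p l P D M) {w : ℂ} (hw : w ∈ ball (0 : ℂ) 1) :
    ContDiffAt ℝ (⊤ : ℕ∞) (uu φ τ P c) w := by
  have hP : ContDiffAt ℝ (⊤ : ℕ∞) P w := S.apx.dsk.smooth.contDiffAt (isOpen_ball.mem_nhds hw)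
  have hφ : ContDiffAt ℝ (⊤ : ℕ∞) (fun w => φ (sv τ w)) w :=
    (S.prf.smooth.comp (sv_smooth τ)).contDiffAt
  rcases lt_or_ge (sv τ w) (1 / 2) with h | h
  · exact (hφ.smul hP).congr_of_eventuallyEq (ev_small h)
  · have hw0 : w ≠ 0 := sv_ne S.τpos S.τle (by linarith)
    have hχ : ContDiffAt ℝ (⊤ : ℕ∞) (fun w => chi (sv τ w)) w :=
      (chi_smooth.comp (sv_smooth τ)).contDiffAt
    exact hφ.smul (((contDiffAt_const.sub hχ).smul hP).add
      (hχ.smul (hatc_smooth S.loop.smooth S.loop.per hw0)))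

theorem cont (S : Setup G c k R φ m C0 η τ H p l P D M) :
    ContinuousOn (uu φ τ P c) (closedBall 0 1) := by
  intro w hw
  have hP := S.apx.dsk.cont w hw
  have hφ : ContinuousWithinAt (fun w => φ (sv τ w)) (closedBall 0 1) w :=
    (S.prf.smooth.comp (sv_smooth τ)).continuous.continuousWithinAt
  rcases lt_or_ge (sv τ w) (1 / 2) with h | h
  · exact (hφ.smul hP).congr_of_eventuallyEq (mem_nhdsWithin_of_mem_nhds (ev_small h))
      (eq_small h.le)
  · have hw0 : w ≠ 0 := sv_ne S.τpos S.τle (by linarith)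
    have hχ : ContinuousWithinAt (fun w => chi (sv τ w)) (closedBall 0 1) w :=
      (chi_smooth.comp (sv_smooth τ)).continuous.continuousWithinAt
    exact hφ.smul (((continuousWithinAt_const.sub hχ).smul hP).add
      (hχ.smul (hatc_smooth S.loop.smooth S.loop.per hw0).continuousAt.continuousWithinAt))

end Setup
end Hopf

namespace Hopf
open Filter Topology

namespace Setup
variable {G : E4 → ℝ} {c : ℝ → E4} {k R : ℝ} {φ : ℝ → ℝ} {m C0 η τ : ℝ} {H : E4 → ℝ}
    {p : ℝ → E4} {l : ℝ} {P : ℂ → E4} {D : ℂ → ℂ →L[ℝ] E4} {M : ℝ}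

theorem rr_der (S : Setup G c k R φ m C0 η τ H p l P D M) {s : ℝ} (hs : 0 ≤ s) :
    HasDerivAt (rr τ) (τ / (2 * rr τ s)) s := by
  have h1 : HasDerivAt (fun s : ℝ => 1 - τ + τ * s) τ s := by
    simpa using ((hasDerivAt_id s).const_mul τ).const_add (1 - τ)
  have h2 := rr_sq S.τle S.τpos hs
  have h3 := rr_ge S.τle S.τpos hs
  exact h1.sqrt (by nlinarith)

theorem symp_ann (S : Setup G c k R φ m C0 η τ H p l P D M) {w : ℂ} (hw : w ∈ ball (0 : ℂ) 1)
    (h1 : 1 / 3 < sv τ w) :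
    0 < omega0 (fderiv ℝ (uu φ τ P c) w 1) (fderiv ℝ (uu φ τ P c) w Complex.I) := by
  have hs1 := sv_lt S.τpos hw
  have hw0 : w ≠ 0 := sv_ne S.τpos S.τle (by linarith)
  set s := sv τ w with hs
  set θ := w.arg with hθ
  set L := fderiv ℝ (uu φ τ P c) w with hL
  have ew : pt τ s θ = w := pt_sv S.τpos w
  have hsI : s ∈ Icc (1 / 3 : ℝ) 1 := ⟨h1.le, hs1.le⟩
  have hs0 : 0 ≤ s := by linarith
  have hu : HasFDerivAt (uu φ τ P c) L w := ((S.smoothAt hw).differentiableAt (by simp)).hasFDerivAt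
  have hrp := rr_ge S.τle S.τpos hs0
  have hrw : rr τ s = ‖w‖ := by rw [← norm_pt τ s θ, ew]
  -- radial derivative
  have c1 : HasDerivAt (fun σ => pt τ σ θ) (((τ / (2 * rr τ s ^ 2) : ℝ)) • w) s := by
    have a1 := ((S.rr_der hs0).ofReal_comp).mul_const (Complex.exp (θ * Complex.I))
    refine a1.congr_deriv ?_
    rw [← ew, pt, Complex.real_smul]
    have : (rr τ s : ℂ) ≠ 0 := by
      exact_mod_cast (by linarith : rr τ s ≠ 0)
    push_cast
    field_simp
  have c2 : HasDerivAt (fun σ => uu φ τ P c (pt τ σ θ)) (L (((τ / (2 * rr τ s ^ 2) : ℝ)) • w)) s :=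
    HasFDerivAt.comp_hasDerivAt_of_eq s hu c1 ew.symm
  have c3 : HasDerivAt (fun σ => gg φ τ P c σ θ)
      (L (((τ / (2 * rr τ s ^ 2) : ℝ)) • w) - deriv φ s • c θ) s := by
    refine (c2.sub ((S.prf.der s).smul_const (c θ))).congr_of_eventuallyEq ?_
    filter_upwards [Ioi_mem_nhds (show 0 < s by linarith)] with σ hσ
    have e := S.uu_pt (le_of_lt hσ) θ
    simp only [Pi.sub_apply, e]
    abel
  have b1 : ‖L (((τ / (2 * rr τ s ^ 2) : ℝ)) • w) - deriv φ s • c θ‖ ≤ (2 * C0 + 2) * η := by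
    refine c3.le_of_lip' (mul_nonneg (by linarith [S.C0pos]) S.ηpos.le) ?_
    filter_upwards [Icc_mem_nhds h1 hs1] with σ hσ
    exact S.gg_s hσ hsI θ
  -- angular derivative
  have d1 : HasDerivAt (fun α => pt τ s α) (Complex.I * w) θ := by
    have := hasDerivAt_circle (rr τ s) θ
    rw [← ew]; exact this
  have d2 : HasDerivAt (fun α => uu φ τ P c (pt τ s α)) (L (Complex.I * w)) θ :=
    HasFDerivAt.comp_hasDerivAt_of_eq θ hu d1 ew.symm
  have d3 : HasDerivAt (fun α => gg φ τ P c s α) (L (Complex.I * w) - φ s • deriv c θ) θ := by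
    refine (d2.sub (((S.loop.smooth.differentiable (by simp)) θ).hasDerivAt.const_smul
      (φ s))).congr_of_eventuallyEq (Eventually.of_forall fun α => ?_)
    have e := S.uu_pt hs0 α
    simp only [Pi.sub_apply, Pi.smul_apply, e]
    abel
  have b2 : ‖L (Complex.I * w) - φ s • deriv c θ‖ ≤ (2 * C0 + 2) * η := by
    refine d3.le_of_lip' (mul_nonneg (by linarith [S.C0pos]) S.ηpos.le) ?_
    exact Eventually.of_forall fun α => S.gg_t hsI α θ
  have key := S.symp s hsI θ _ _ b1 b2
  rw [add_sub_cancel, add_sub_cancel, map_smul, om_smul_left, om_rot] at key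
  have q1 : 0 < τ / (2 * rr τ s ^ 2) := by have := S.τpos; positivity
  have q2 := sq_pos_of_ne hw0
  exact pos_of_mul_pos_right (pos_of_mul_pos_right key q1.le) q2.le

theorem sv_der (τ : ℝ) (w : ℂ) : HasFDerivAt (sv τ)
    ((2 * w.re / τ) • Complex.reCLM + (2 * w.im / τ) • Complex.imCLM) w := by
  have h1 : HasFDerivAt (fun z : ℂ => z.re) Complex.reCLM w := Complex.reCLM.hasFDerivAt
  have h2 : HasFDerivAt (fun z : ℂ => z.im) Complex.imCLM w := Complex.imCLM.hasFDerivAt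
  have h3 := ((((h1.pow 2).add (h2.pow 2)).sub_const 1).add_const τ).mul_const τ⁻¹
  have h4 : sv τ = fun z : ℂ => (z.re ^ 2 + z.im ^ 2 - 1 + τ) * τ⁻¹ := by
    funext z; rw [sv, div_eq_mul_inv]
  rw [h4]
  refine h3.congr_fderiv ?_
  ext v
  simp
  ring

theorem symp_small (S : Setup G c k R φ m C0 η τ H p l P D M) {w : ℂ} (hw : w ∈ ball (0 : ℂ) 1)
    (h1 : sv τ w < 1 / 2) :
    0 < omega0 (fderiv ℝ (uu φ τ P c) w 1) (fderiv ℝ (uu φ τ P c) w Complex.I) := by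
  have hwc : w ∈ closedBall (0 : ℂ) 1 := ball_subset_closedBall hw
  have hP : HasFDerivAt P (D w) w :=
    (S.apx.dsk.der w hwc).hasFDerivAt (mem_of_superset (isOpen_ball.mem_nhds hw) ball_subset_closedBall)
  set ds : ℂ →L[ℝ] ℝ := (2 * w.re / τ) • Complex.reCLM + (2 * w.im / τ) • Complex.imCLM with hds
  have hsv : HasFDerivAt (sv τ) ds w := sv_der τ w
  have hφ : HasFDerivAt (fun z => φ (sv τ z)) (deriv φ (sv τ w) • ds) w :=
    (S.prf.der (sv τ w)).comp_hasFDerivAt w hsv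
  have hu := (hφ.smul hP).congr_of_eventuallyEq (ev_small (c := c) h1)
  rw [hu.fderiv]
  set L := φ (sv τ w) • D w + (deriv φ (sv τ w) • ds).smulRight (P w) with hL
  have hLv : ∀ v, L v = φ (sv τ w) • D w v + (deriv φ (sv τ w) * ds v) • P w := fun v => by
    simp [hL]
  have p1 := S.prf.ge_half (sv τ w)
  have hpos := S.apx.dsk.pos w hwc
  rcases le_or_gt (sv τ w) 0 with h2 | h2
  · rw [hLv, hLv, S.prf.dzero h2]
    simp only [zero_mul, zero_smul, add_zero, om_smul_left, om_smul_right]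
    positivity
  · have hw0 : w ≠ 0 := sv_ne S.τpos S.τle h2
    have q2 := sq_pos_of_ne hw0
    have key := om_rot L w
    have e1 : ds w = 2 * (w.re ^ 2 + w.im ^ 2) / τ := by
      simp [hds]; ring
    have e2 : ds (Complex.I * w) = 0 := by
      simp [hds]; ring
    have ho := S.outw w hwc (by have := sv_mul S.τpos w; nlinarith [S.τpos])
    have hrot := om_rot (D w) w
    have hd := S.prf.dnonneg (sv τ w)
    have hds0 : 0 < ds w := by rw [e1]; have := S.τpos; positivity
    have : 0 < omega0 (L w) (L (Complex.I * w)) := by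
      rw [hLv, hLv, e2, mul_zero, zero_smul, add_zero, om_add_left, om_smul_left, om_smul_left,
        om_smul_right, om_smul_right, hrot]
      have a1 : 0 < φ (sv τ w) * (φ (sv τ w) * ((w.re ^ 2 + w.im ^ 2) *
          omega0 (D w 1) (D w Complex.I))) := by positivity
      have a2 : 0 ≤ deriv φ (sv τ w) * ds w * (φ (sv τ w) * omega0 (P w) (D w (Complex.I * w))) := by
        positivity
      linarith
    rw [key] at this
    exact pos_of_mul_pos_right this q2.le

theorem sympAt (S : Setup G c k R φ m C0 η τ H p l P D M) {w : ℂ} (hw : w ∈ ball (0 : ℂ) 1) :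
    0 < omega0 (fderiv ℝ (uu φ τ P c) w 1) (fderiv ℝ (uu φ τ P c) w Complex.I) := by
  rcases lt_or_ge (sv τ w) (1 / 2) with h | h
  · exact S.symp_small hw h
  · exact S.symp_ann hw (by linarith)

theorem bdry (S : Setup G c k R φ m C0 η τ H p l P D M) (θ : ℝ) :
    uu φ τ P c (Complex.exp (θ * Complex.I)) = c θ := by
  have e := S.uu_pt zero_le_one θ
  rw [pt_one] at e
  rw [e, gg, wA, chi_one, S.prf.one]
  simp

theorem sphere_image (S : Setup G c k R φ m C0 η τ H p l P D M) :
    uu φ τ P c '' sphere 0 1 = range c := by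
  ext x
  constructor
  · rintro ⟨w, hw, rfl⟩
    rw [mem_sphere_zero_iff_norm] at hw
    exact ⟨w.arg, by rw [← S.bdry, ← sphere_exp hw]⟩
  · rintro ⟨θ, rfl⟩
    exact ⟨_, by rw [mem_sphere_zero_iff_norm]; exact Complex.norm_exp_ofReal_mul_I θ, S.bdry θ⟩

theorem G_le (S : Setup G c k R φ m C0 η τ H p l P D M) {w : ℂ} (hw : w ∈ closedBall (0 : ℂ) 1) :
    G (uu φ τ P c w) ≤ 1 := by
  have h1 := S.comb_le hw
  have h2 := S.prf.le_one (sv_le S.τpos hw)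
  have h3 := S.prf.ge_half (sv τ w)
  nlinarith

theorem G_lt (S : Setup G c k R φ m C0 η τ H p l P D M) {w : ℂ} (hw : w ∈ ball (0 : ℂ) 1) :
    G (uu φ τ P c w) < 1 := by
  have h1 := S.comb_le (ball_subset_closedBall hw)
  have h2 := S.prf.lt _ (sv_lt S.τpos hw)
  have h3 := S.prf.ge_half (sv τ w)
  nlinarith

end Setup

theorem exists_min5 {a b c d : ℝ} (ha : 0 < a) (hb : 0 < b) (hc : 0 < c) (hd : 0 < d) :
    ∃ τ : ℝ, 0 < τ ∧ τ ≤ 1 / 2 ∧ τ ≤ a ∧ τ ≤ b ∧ τ ≤ c ∧ τ ≤ d :=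
  ⟨min (1 / 2) (min a (min b (min c d))), lt_min (by norm_num) (lt_min ha (lt_min hb (lt_min hc hd))),
    by simp, by simp, by simp, by simp, by simp⟩

theorem exists_eta {C m l R g : ℝ} (hC : 0 < C) (hm : 0 < m) (hl : 0 < l) (hR : 0 < R)
    (hg : 0 < g) : ∃ η > 0, C * η < m ∧ C * η ≤ l ∧ R * η < g := by
  refine ⟨min (m / (2 * C)) (min (l / C) (g / (2 * R))),
    lt_min (by positivity) (lt_min (by positivity) (by positivity)), ?_, ?_, ?_⟩
  · calc _ ≤ C * (m / (2 * C)) := by gcongr; exact min_le_left _ _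
      _ = m / 2 := by field_simp
      _ < m := by linarith
  · calc _ ≤ C * (l / C) := by
          gcongr; exact (min_le_right _ _).trans (min_le_left _ _)
      _ = l := by field_simp
      _ ≤ l := le_rfl
  · calc _ ≤ R * (g / (2 * R)) := by
          gcongr; exact (min_le_right _ _).trans (min_le_right _ _)
      _ = g / 2 := by field_simp
      _ < g := by linarith

theorem exists_setup {G : E4 → ℝ} (h : GoodG G) {c : ℝ → E4} {k : ℝ} (lp : Loop G c k)
    (happ : ∀ η : ℝ, 0 < η → ∃ H p l P D, Apx G c η H p l P D) :
    ∃ R φ m C0 η τ H p l P D M, Setup G c k R φ m C0 η τ H p l P D M := by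
  obtain ⟨R, hR, hb⟩ := Orb.bound h
  obtain ⟨φ, m, pr⟩ := exists_prf
  obtain ⟨C0, hC0, hlip⟩ := wA_lip pr
  obtain ⟨m0, hm0, hsep⟩ := sepC h hR hb lp pr
  obtain ⟨l0, hl0, hsy⟩ := sympC h hR hb lp pr
  have hgap : 0 < φ (1 / 2) ^ 2 - φ (1 / 3) ^ 2 := by
    have h1 := pr.sep (s := 1 / 2) (t := 1 / 3) (by norm_num) (by norm_num)
    have h2 : φ (1 / 3) ≤ φ (1 / 2) := pr.mono (by norm_num)
    rw [abs_of_nonneg (sub_nonneg.2 h2), abs_of_pos (by norm_num)] at h1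
    have := pr.mpos
    have := pr.ge_half (1 / 3)
    nlinarith
  obtain ⟨η, hη, n1, n2, n3⟩ : ∃ η > 0, (2 * C0 + 2) * η < m0 ∧ (2 * C0 + 2) * η ≤ l0 ∧
      2 * R * η < φ (1 / 2) ^ 2 - φ (1 / 3) ^ 2 := by
    exact exists_eta (by linarith) hm0 hl0 (by linarith) hgap
  obtain ⟨H, p, l, P, D, a⟩ := happ η hη
  obtain ⟨M, hM⟩ := (isCompact_closedBall (0 : ℂ) 1).exists_bound_of_continuousOn a.dsk.dcont
  have hM0 : 0 ≤ M := (norm_nonneg _).trans (hM 0 (by simp))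
  obtain ⟨τ1, hτ1, hL⟩ := a.lemL
  have hXc : ContinuousOn (fun z => D z (Complex.I * z)) (closedBall (0 : ℂ) 1) := by
    have hid : ContinuousOn (fun z : ℂ => Complex.I * z) (closedBall (0 : ℂ) 1) :=
      (continuous_const.mul continuous_id).continuousOn
    exact ContinuousOn.clm_apply (f := D) (g := fun z : ℂ => Complex.I * z) a.dsk.dcont hid
  have hXu := (isCompact_closedBall (0 : ℂ) 1).uniformContinuousOn_of_continuous hXc
  obtain ⟨τ2, hτ2, hu⟩ := Metric.uniformContinuousOn_iff.1 hXu η hη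
  have hYc : ContinuousOn (fun z => omega0 (P z) (D z (Complex.I * z))) (closedBall (0 : ℂ) 1) := by
    have hpr : ContinuousOn (fun z => (P z, D z (Complex.I * z))) (closedBall (0 : ℂ) 1) :=
      ContinuousOn.prodMk a.dsk.cont hXc
    exact Continuous.comp_continuousOn (f := fun z => (P z, D z (Complex.I * z))) om_continuous hpr
  have hYu := (isCompact_closedBall (0 : ℂ) 1).uniformContinuousOn_of_continuous hYc
  have hl := a.loop.kpos
  obtain ⟨τ3, hτ3, hy⟩ := Metric.uniformContinuousOn_iff.1 hYu (2 * l) (by linarith)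
  obtain ⟨τ, t0, u1, u2, u3, u4, u5⟩ : ∃ τ : ℝ, 0 < τ ∧ τ ≤ 1 / 2 ∧ τ ≤ η / (M + 1) ∧ τ ≤ τ1 ∧
      τ ≤ τ2 / 2 ∧ τ ≤ τ3 / 2 := exists_min5 (by positivity) hτ1 (half_pos hτ2) (half_pos hτ3)
  have hsy' : ∀ s ∈ Icc (1 / 3 : ℝ) 1, ∀ θ : ℝ, ∀ a b : E4, ‖a‖ ≤ (2 * C0 + 2) * η →
      ‖b‖ ≤ (2 * C0 + 2) * η → 0 < omega0 (deriv φ s • c θ + a) (φ s • deriv c θ + b) :=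
    fun s hs θ a b ha hb => hsy s hs θ a b (ha.trans n2) (hb.trans n2)
  suffices hS : Setup G c k R φ m C0 η τ H p l P D M from
    ⟨R, φ, m, C0, η, τ, H, p, l, P, D, M, hS⟩
  refine { good := h, bnd := hb, loop := lp, prf := pr, C0pos := hC0, lipA := hlip, ηpos := hη,
           sep := ⟨m0, n1, hsep⟩, symp := hsy', gap := n3, apx := a, Mb := hM, τpos := t0, τle := u1,
           Mτ := ?_, lemL := ?_, unif := ?_, outw := ?_ }
  · rw [le_div_iff₀ (by linarith)] at u2
    nlinarith
  · intro z1 h1 z2 h2 κ hκ hle hge he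
    exact hL z1 h1 z2 h2 κ hκ hle (by linarith) he
  · intro z1 h1 z2 h2 hd
    have := hu z1 h1 z2 h2 (by rw [dist_eq_norm]; linarith)
    rw [dist_eq_norm] at this
    exact this.le
  · intro z hz hge
    have hz1 : ‖z‖ ≤ 1 := mem_closedBall_zero_iff.1 hz
    set e := Complex.exp (z.arg * Complex.I) with he
    have hemem : e ∈ closedBall (0 : ℂ) 1 := by
      rw [mem_closedBall_zero_iff, he, Complex.norm_exp_ofReal_mul_I]
    have hd : dist z e < τ3 := by
      have e1 : z - e = ((‖z‖ - 1 : ℝ) : ℂ) * e := by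
        conv_lhs => rw [polar z]
        rw [← he]; push_cast; ring
      rw [dist_eq_norm, e1, norm_mul, he, Complex.norm_exp_ofReal_mul_I, Complex.norm_real,
        Real.norm_eq_abs, mul_one, abs_sub_comm, abs_of_nonneg (by linarith)]
      nlinarith [norm_nonneg z]
    have h1 := hy z hz e hemem hd
    have h2 : omega0 (P e) (D e (Complex.I * e)) = 2 * l := by
      rw [he, a.dsk.bdry, a.dsk.bdry_der, a.loop.om a.good]
    rw [h2, Real.dist_eq] at h1
    linarith [(abs_lt.1 h1).1]

end Hopf

/-- On the boundary of a smooth convex domain in `ℝ⁴` there exists a systole which bounds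
an embedded positively symplectic disk in `X`, i.e. which is a Hopf orbit. -/
theorem stmt5
    (G : E4 → ℝ)
    (hGcont : Continuous G)
    (hGconv : ConvexOn ℝ Set.univ G)
    (hGhom : ∀ r : ℝ, 0 ≤ r → ∀ z : E4, G (r • z) = r ^ 2 * G z)
    (hGsmooth : ContDiffOn ℝ (⊤ : ℕ∞) G {z : E4 | z ≠ 0})
    (hGpos : ∀ z : E4, z ≠ 0 → 0 < G z) :
    ∃ (γ : ℝ → E4) (T : ℝ),
      IsHamSol G γ ∧
      (∀ t, G (γ t) = 1) ∧
      (∃ s t, γ s ≠ γ t) ∧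
      0 < T ∧
      Function.Periodic γ T ∧
      (∀ T' : ℝ, 0 < T' → Function.Periodic γ T' → T ≤ T') ∧
      (∀ (δ : ℝ → E4) (T' : ℝ), IsHamSol G δ → (∀ t, G (δ t) = 1) →
        (∃ s t, δ s ≠ δ t) → 0 < T' → Function.Periodic δ T' → T ≤ T') ∧
      ∃ u : ℂ → E4,
        ContinuousOn u (closedBall 0 1) ∧
        InjOn u (closedBall 0 1) ∧
        u '' closedBall 0 1 ⊆ {z : E4 | G z ≤ 1} ∧
        ContDiffOn ℝ (⊤ : ℕ∞) u (ball 0 1) ∧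
        (∀ w ∈ ball (0 : ℂ) 1, Function.Injective (fderiv ℝ u w)) ∧
        u '' sphere 0 1 = range γ ∧
        u '' ball 0 1 ⊆ {z : E4 | G z < 1} ∧
        (∀ w ∈ ball (0 : ℂ) 1, 0 < omega0 (fderiv ℝ u w 1) (fderiv ℝ u w Complex.I)) := by
  have h : Hopf.GoodG G := ⟨hGcont, hGconv, hGhom, hGsmooth, hGpos⟩
  obtain ⟨γ, T, c, k, hT, o, hc, hmin, lp, hr, happ⟩ := h.approx2
  obtain ⟨R, φ, m, C0, η, τ, H, p, l, P, D, M, S⟩ := Hopf.exists_setup h lp happ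
  have hper : Function.Periodic γ T := by
    have := o.periodic_of_eq h hc.symm
    rwa [sub_zero] at this
  have hmin2 : ∀ (δ : ℝ → E4) (T' : ℝ), IsHamSol G δ → (∀ t, G (δ t) = 1) → 0 < T' →
      Function.Periodic δ T' → T ≤ T' := fun δ T' h1 h2 h3 h4 =>
    hmin δ T' ⟨h1, h2⟩ h3 (by simpa using h4 0)
  refine ⟨γ, T, o.der, o.one, ?_, hT, hper, fun T' h1 h2 => hmin2 γ T' o.der o.one h1 h2,
    fun δ T' h1 h2 _ h3 h4 => hmin2 δ T' h1 h2 h3 h4, Hopf.uu φ τ P c, S.cont, S.inj, ?_, ?_, ?_, ?_,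
    ?_, fun w hw => S.sympAt hw⟩
  · have hne := lp.inj 0 Real.pi Real.pi_pos (by linarith [Real.pi_pos])
    obtain ⟨s, hs⟩ : c (0 + Real.pi) ∈ range γ := hr ▸ mem_range_self _
    obtain ⟨t, ht⟩ : c 0 ∈ range γ := hr ▸ mem_range_self _
    exact ⟨s, t, by rw [hs, ht]; exact hne⟩
  · rintro _ ⟨w, hw, rfl⟩
    exact S.G_le hw
  · exact fun w hw => (S.smoothAt hw).contDiffWithinAt
  · exact fun w hw => Hopf.inj_of_om (S.sympAt hw)
  · rw [S.sphere_image, hr]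
  · rintro _ ⟨w, hw, rfl⟩
    exact S.G_lt hw
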